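/- The Poincaré polynomial of the real Grassmannian Gr(2j+1, 2m) over ℚ equals (1 + t^{2m-1}) · [m-1 choose j]_{t^4}. -/

import Mathlib

open CategoryTheory Polynomial

/-- The singular chain complex of a topological space `X` with coefficients in `R`,
i.e. the alternating face map complex of the free simplicial `R`-module on the
singular simplicial set of `X`. -/
noncomputable def singularChainComplex (R : Type) [CommRing R] (X : TopCat) :
    ChainComplex (ModuleCat R) ℕ :=
  (AlgebraicTopology.alternatingFaceMapComplex (ModuleCat R)).obj
    (TopCat.toSSet.obj X ⋙ ModuleCat.free R)

/-- Singular cohomology of `X` with coefficients in `R`, the homology of the dual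
cochain complex `Hom(C_•(X; R), R)`. -/
noncomputable def singularCohomology (R : Type) [CommRing R] (X : TopCat) (n : ℕ) :
    ModuleCat R :=
  (((((linearYoneda R (ModuleCat R)).obj (ModuleCat.of R R)).mapHomologicalComplex _).obj
    (singularChainComplex R X).op)).homology n


/-- The setoid on linearly independent `k`-frames in `ℝⁿ` identifying frames with the
same span. -/
def grassSetoid (k n : ℕ) :
    Setoid {A : Fin k → (Fin n → ℝ) // LinearIndependent ℝ A} :=
  Setoid.ker fun A => Submodule.span ℝ (Set.range (A.1))

/-- The real Grassmann manifold `Gr(k, n)` of `k`-dimensional linear subspaces of `ℝⁿ`,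
topologized as the quotient of the space of linearly independent `k`-frames. -/
def Grassmannian (k n : ℕ) : Type := _root_.Quotient (grassSetoid k n)

noncomputable instance (k n : ℕ) : TopologicalSpace (Grassmannian k n) :=
  inferInstanceAs (TopologicalSpace (_root_.Quotient _))

/-- The `q`-integer `[r]_q = 1 + q + ⋯ + q^(r-1)` as a polynomial in `q`. -/
noncomputable def qInt (r : ℕ) : Polynomial ℤ := ∑ i ∈ Finset.range r, X ^ i

/-- The `q`-factorial `[r]_q! = [r]_q [r-1]_q ⋯ [1]_q`. -/
noncomputable def qFact : ℕ → Polynomial ℤ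
  | 0 => 1
  | r + 1 => qInt (r + 1) * qFact r

set_option linter.unusedSectionVars false

namespace RatHomology

/-- Singular `n`-simplices of a space. -/
abbrev Sing (n : ℕ) (X : Type) [TopologicalSpace X] : Type :=
  C(stdSimplex ℝ (Fin (n + 1)), X)

/-- Rational singular `n`-chains. -/
abbrev Chain (n : ℕ) (X : Type) [TopologicalSpace X] : Type := Sing n X →₀ ℚ

variable {X Y Z : Type} [TopologicalSpace X] [TopologicalSpace Y] [TopologicalSpace Z]

/-- The map of standard simplices induced by a map of vertices. -/
noncomputable def simpMap {m n : ℕ} (f : Fin m → Fin n) : C(stdSimplex ℝ (Fin m), stdSimplex ℝ (Fin n)) :=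
  ⟨stdSimplex.map f, stdSimplex.continuous_map f⟩

/-- The singular boundary operator. -/
noncomputable def bdry (n : ℕ) (X : Type) [TopologicalSpace X] : Chain (n + 1) X →ₗ[ℚ] Chain n X :=
  ∑ i : Fin (n + 2), (-1 : ℚ) ^ (i : ℕ) •
    Finsupp.lmapDomain ℚ ℚ (fun σ : Sing (n + 1) X => σ.comp (simpMap i.succAbove))

/-- The map on chains induced by a continuous map. -/
noncomputable def chainMap (n : ℕ) (f : C(X, Y)) : Chain n X →ₗ[ℚ] Chain n Y :=
  Finsupp.lmapDomain ℚ ℚ (fun σ => f.comp σ)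

@[simp] lemma chainMap_single (n : ℕ) (f : C(X, Y)) (σ : Sing n X) (a : ℚ) :
    chainMap n f (Finsupp.single σ a) = Finsupp.single (f.comp σ) a := by
  simp [chainMap]

lemma bdry_single (n : ℕ) (σ : Sing (n + 1) X) (a : ℚ) :
    bdry n X (Finsupp.single σ a) = ∑ i : Fin (n + 2), (-1 : ℚ) ^ (i : ℕ) •
      Finsupp.single (σ.comp (simpMap i.succAbove)) a := by
  simp [bdry, LinearMap.sum_apply]

lemma chainMap_bdry (n : ℕ) (f : C(X, Y)) (c : Chain (n + 1) X) :
    chainMap n f (bdry n X c) = bdry n Y (chainMap (n + 1) f c) := by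
  induction c using Finsupp.induction_linear with
  | zero => simp
  | add a b ha hb => simp only [map_add, ha, hb]
  | single σ a =>
    simp only [bdry_single, chainMap_single, map_sum, map_smul]
    rfl

lemma chainMap_id (n : ℕ) (c : Chain n X) : chainMap n (ContinuousMap.id X) c = c := by
  have : (fun σ : Sing n X => (ContinuousMap.id X).comp σ) = id := by ext; rfl
  rw [chainMap, this, Finsupp.lmapDomain_apply, Finsupp.mapDomain_id]

lemma chainMap_comp (n : ℕ) (g : C(Y, Z)) (f : C(X, Y)) (c : Chain n X) :
    chainMap n (g.comp f) c = chainMap n g (chainMap n f c) := by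
  simp only [chainMap, Finsupp.lmapDomain_apply, ← Finsupp.mapDomain_comp]
  rfl

/-- The comparison of concrete chains with the singular chain complex. -/
noncomputable def chainEquiv (n : ℕ) (X : Type) [TopologicalSpace X] :
    Chain n X ≃ₗ[ℚ] (singularChainComplex ℚ (TopCat.of X)).X n :=
  Finsupp.domLCongr ((TopCat.of X).toSSetObjEquiv (.op (SimplexCategory.mk n))).symm

lemma chainEquiv_single (n : ℕ) (σ : Sing n X) (a : ℚ) :
    chainEquiv n X (Finsupp.single σ a) =
      Finsupp.single (((TopCat.of X).toSSetObjEquiv (.op (SimplexCategory.mk n))).symm σ) a :=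
  Finsupp.domLCongr_single _ _ _

lemma chain_hom_ext {n : ℕ} {M : Type} [AddCommGroup M] [Module ℚ M] {f g : Chain n X →ₗ[ℚ] M}
    (h : ∀ σ, f (Finsupp.single σ 1) = g (Finsupp.single σ 1)) : f = g :=
  Finsupp.lhom_ext' fun σ => LinearMap.ext_ring (h σ)

lemma alternating_sum_apply {M N : ModuleCat.{0} ℚ} {n : ℕ} (f : Fin n → (M ⟶ N)) (x : M) :
    (∑ i : Fin n, (-1 : ℤ) ^ (i : ℕ) • f i).hom x = ∑ i : Fin n, (-1 : ℚ) ^ (i : ℕ) • (f i).hom x := by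
  rw [ModuleCat.hom_sum, LinearMap.sum_apply]
  refine Finset.sum_congr rfl fun i _ => ?_
  rw [ModuleCat.hom_zsmul, LinearMap.smul_apply, ← Int.cast_smul_eq_zsmul ℚ]
  push_cast
  rfl

open AlgebraicTopology in
lemma chainEquiv_bdry (n : ℕ) (c : Chain (n + 1) X) :
    chainEquiv n X (bdry n X c) =
      ((singularChainComplex ℚ (TopCat.of X)).d (n + 1) n).hom (chainEquiv (n + 1) X c) := by
  have hd : (singularChainComplex ℚ (TopCat.of X)).d (n + 1) n =
      ∑ i : Fin (n + 2), (-1 : ℤ) ^ (i : ℕ) •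
        (ModuleCat.free ℚ).map (((TopCat.toSSet.obj (TopCat.of X))).δ i) :=
    alternatingFaceMapComplex_obj_d _ n
  suffices h : (chainEquiv n X).toLinearMap ∘ₗ bdry n X =
      ((singularChainComplex ℚ (TopCat.of X)).d (n + 1) n).hom ∘ₗ
        (chainEquiv (n + 1) X).toLinearMap from LinearMap.congr_fun h c
  refine chain_hom_ext fun σ => ?_
  refine Eq.trans ?_ (LinearMap.congr_fun (congrArg ModuleCat.Hom.hom hd) _).symm
  refine Eq.trans ?_ (alternating_sum_apply _ _).symm
  simp only [LinearMap.comp_apply, LinearEquiv.coe_coe, bdry_single, map_sum, map_smul,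
    chainEquiv_single]
  refine Finset.sum_congr rfl fun i _ => congrArg _ ?_
  exact (ModuleCat.free_map_apply (R := ℚ) ((TopCat.toSSet.obj (TopCat.of X)).δ i)
    (((TopCat.of X).toSSetObjEquiv (.op (SimplexCategory.mk (n + 1)))).symm σ)).symm

lemma chainEquiv_map (n : ℕ) (f : C(X, Y)) (c : Chain n X) :
    chainEquiv n Y (chainMap n f c) =
      (ModuleCat.free ℚ).map ((TopCat.toSSet.map (TopCat.ofHom f)).app (.op (SimplexCategory.mk n)))
        (chainEquiv n X c) := by
  suffices h : (chainEquiv n Y).toLinearMap ∘ₗ chainMap n f =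
      ((ModuleCat.free ℚ).map ((TopCat.toSSet.map (TopCat.ofHom f)).app
        (.op (SimplexCategory.mk n)))).hom ∘ₗ (chainEquiv n X).toLinearMap from
    LinearMap.congr_fun h c
  refine chain_hom_ext fun σ => ?_
  rw [LinearMap.comp_apply, chainMap_single, LinearEquiv.coe_coe, chainEquiv_single]
  change _ = ((ModuleCat.free ℚ).map ((TopCat.toSSet.map (TopCat.ofHom f)).app
        (.op (SimplexCategory.mk n)))).hom (chainEquiv n X (Finsupp.single σ 1))
  rw [chainEquiv_single]
  exact (ModuleCat.free_map_apply (R := ℚ)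
    ((TopCat.toSSet.map (TopCat.ofHom f)).app (.op (SimplexCategory.mk n)))
    (((TopCat.of X).toSSetObjEquiv (.op (SimplexCategory.mk n))).symm σ)).symm

lemma bdry_bdry (n : ℕ) (c : Chain (n + 2) X) : bdry n X (bdry (n + 1) X c) = 0 := by
  apply (chainEquiv n X).injective
  rw [chainEquiv_bdry, chainEquiv_bdry, map_zero, ← LinearMap.comp_apply, ← ModuleCat.hom_comp,
    HomologicalComplex.d_comp_d]
  rfl

/-- Cycles. -/
noncomputable def cycles : ∀ (n : ℕ) (X : Type) [TopologicalSpace X], Submodule ℚ (Chain n X)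
  | 0, _, _ => ⊤
  | n + 1, X, _ => LinearMap.ker (bdry n X)

lemma mem_cycles_succ {n : ℕ} {c : Chain (n + 1) X} : c ∈ cycles (n + 1) X ↔ bdry n X c = 0 :=
  LinearMap.mem_ker

lemma bdry_mem_cycles {n : ℕ} (c : Chain (n + 1) X) : bdry n X c ∈ cycles n X := by
  cases n with
  | zero => trivial
  | succ n => exact bdry_bdry n c

lemma chainMap_mem_cycles {n : ℕ} (f : C(X, Y)) {c : Chain n X} (hc : c ∈ cycles n X) :
    chainMap n f c ∈ cycles n Y := by
  cases n with
  | zero => trivial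
  | succ n =>
    rw [mem_cycles_succ] at hc ⊢
    rw [← chainMap_bdry, hc, map_zero]

/-- Singular homology with rational coefficients. -/
abbrev H (n : ℕ) (X : Type) [TopologicalSpace X] : Type :=
  cycles n X ⧸ (LinearMap.range (bdry n X)).comap (cycles n X).subtype

namespace H

/-- The homology class of a cycle. -/
noncomputable def mk {n : ℕ} (c : Chain n X) (hc : c ∈ cycles n X) : H n X :=
  Submodule.Quotient.mk ⟨c, hc⟩

lemma ind {n : ℕ} {p : H n X → Prop} (h : ∀ c hc, p (mk c hc)) (x : H n X) : p x := by
  obtain ⟨⟨c, hc⟩, rfl⟩ := Submodule.Quotient.mk_surjective _ x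
  exact h c hc

lemma mk_eq_zero {n : ℕ} {c : Chain n X} (hc : c ∈ cycles n X) :
    mk c hc = 0 ↔ ∃ b, bdry n X b = c := by
  rw [mk, Submodule.Quotient.mk_eq_zero]
  rfl

lemma mk_add {n : ℕ} {c c' : Chain n X} (hc : c ∈ cycles n X) (hc' : c' ∈ cycles n X) :
    mk c hc + mk c' hc' = mk (c + c') (add_mem hc hc') := rfl

lemma mk_sub {n : ℕ} {c c' : Chain n X} (hc : c ∈ cycles n X) (hc' : c' ∈ cycles n X) :
    mk c hc - mk c' hc' = mk (c - c') (sub_mem hc hc') := rfl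

lemma mk_neg {n : ℕ} {c : Chain n X} (hc : c ∈ cycles n X) :
    - mk c hc = mk (-c) (neg_mem hc) := rfl

lemma mk_eq_mk {n : ℕ} {c c' : Chain n X} (hc : c ∈ cycles n X) (hc' : c' ∈ cycles n X) :
    mk c hc = mk c' hc' ↔ ∃ b, bdry n X b = c - c' := by
  rw [← sub_eq_zero, mk_sub, mk_eq_zero]

/-- The map on homology induced by a continuous map. -/
noncomputable def map (n : ℕ) (f : C(X, Y)) : H n X →ₗ[ℚ] H n Y :=
  Submodule.mapQ _ _ ((chainMap n f).restrict fun _ hc => chainMap_mem_cycles f hc) <| by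
    rintro ⟨c, hc⟩ ⟨b, rfl⟩
    exact ⟨chainMap (n + 1) f b, (chainMap_bdry n f b).symm⟩

@[simp] lemma map_mk {n : ℕ} (f : C(X, Y)) {c : Chain n X} (hc : c ∈ cycles n X) :
    map n f (mk c hc) = mk (chainMap n f c) (chainMap_mem_cycles f hc) := rfl

@[simp] lemma map_id (n : ℕ) : map n (ContinuousMap.id X) = LinearMap.id := by
  refine LinearMap.ext fun x => ?_
  induction x using ind with
  | h c hc => simp [chainMap_id]

lemma map_comp (n : ℕ) (g : C(Y, Z)) (f : C(X, Y)) : map n (g.comp f) = map n g ∘ₗ map n f := by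
  refine LinearMap.ext fun x => ?_
  induction x using ind with
  | h c hc => simp [chainMap_comp]

lemma map_map (n : ℕ) (g : C(Y, Z)) (f : C(X, Y)) (x : H n X) :
    map n g (map n f x) = map n (g.comp f) x := by
  rw [map_comp]; rfl

end H

end RatHomology

namespace RatHomology

variable {X Y Z : Type} [TopologicalSpace X] [TopologicalSpace Y] [TopologicalSpace Z]

lemma eq_sub_of_eq_add_add {M : Type} [AddCommGroup M] {a b p q r : M} (h : a = p + q + b)
    (hp : p = 0) (hq : q = r) : r = a - b := by
  rw [h, hp, hq]; abel

open AlgebraicTopology in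
lemma exists_bdry_eq_of_homotopy {f g : C(X, Y)} (F : f.Homotopy g) {n : ℕ} {c : Chain n X}
    (hc : c ∈ cycles n X) : ∃ b, bdry n Y b = chainMap n f c - chainMap n g c := by
  let F' : TopCat.Homotopy (TopCat.ofHom f) (TopCat.ofHom g) := F
  let K : Homotopy (C := singularChainComplex ℚ (TopCat.of X))
      (D := singularChainComplex ℚ (TopCat.of Y)) _ _ :=
    (F'.toSSet.toSimplicialObjectHomotopy.whiskerRight (ModuleCat.free ℚ)).toChainHomotopy
  have key := LinearMap.congr_fun (congrArg ModuleCat.Hom.hom (K.comm n)) (chainEquiv n X c)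
  have h0 : (dNext n K.hom).hom (chainEquiv n X c) = 0 := by
    cases n with
    | zero =>
      rw [dNext_eq_zero _ _ (by simp)]
      rfl
    | succ n =>
      rw [dNext_eq _ (show (ComplexShape.down ℕ).Rel (n + 1) n by simp), ModuleCat.hom_comp,
        LinearMap.comp_apply, ← chainEquiv_bdry, mem_cycles_succ.1 hc]
      simp
  have h1 : (prevD n K.hom).hom (chainEquiv n X c) =
      ((singularChainComplex ℚ (TopCat.of Y)).d (n + 1) n).hom
        ((K.hom n (n + 1)).hom (chainEquiv n X c)) := by
    rw [prevD_eq _ (show (ComplexShape.down ℕ).Rel (n + 1) n by simp), ModuleCat.hom_comp,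
        LinearMap.comp_apply]
  refine ⟨(chainEquiv (n + 1) Y).symm ((K.hom n (n + 1)).hom (chainEquiv n X c)), ?_⟩
  apply (chainEquiv n Y).injective
  rw [chainEquiv_bdry, LinearEquiv.apply_symm_apply, map_sub, chainEquiv_map, chainEquiv_map]
  exact eq_sub_of_eq_add_add key h0 h1

lemma H.map_eq_of_homotopic {f g : C(X, Y)} (h : f.Homotopic g) (n : ℕ) :
    H.map n f = H.map n g := by
  obtain ⟨F⟩ := h
  refine LinearMap.ext fun x => ?_
  induction x using H.ind with
  | h c hc =>
    rw [H.map_mk, H.map_mk, H.mk_eq_mk]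
    exact exists_bdry_eq_of_homotopy F hc

/-- A homotopy given by a jointly continuous function. -/
lemma H.map_congr_of_continuous {f g : C(X, Y)} (F : unitInterval × X → Y) (hF : Continuous F)
    (h0 : ∀ x, F (0, x) = f x) (h1 : ∀ x, F (1, x) = g x) (n : ℕ) : H.map n f = H.map n g :=
  H.map_eq_of_homotopic ⟨⟨⟨F, hF⟩, h0, h1⟩⟩ n

end RatHomology

namespace RatHomology

variable {X Y Z : Type} [TopologicalSpace X] [TopologicalSpace Y] [TopologicalSpace Z]

/-- The affine map from a standard simplex to a standard simplex with prescribed vertices. -/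
noncomputable def aff {k m : ℕ} (v : Fin k → stdSimplex ℝ (Fin m)) :
    C(stdSimplex ℝ (Fin k), stdSimplex ℝ (Fin m)) where
  toFun t := ⟨∑ i, t i • (v i : Fin m → ℝ), (convex_stdSimplex ℝ (Fin m)).sum_mem
    (fun i _ => t.2.1 i) t.2.2 fun i _ => (v i).2⟩
  continuous_toFun := by
    refine Continuous.subtype_mk (continuous_finsetSum _ fun i _ => ?_) _
    exact ((continuous_apply i).comp continuous_subtype_val).smul continuous_const

lemma aff_coe {k m : ℕ} (v : Fin k → stdSimplex ℝ (Fin m)) (t : stdSimplex ℝ (Fin k)) :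
    (aff v t : Fin m → ℝ) = ∑ i, t i • (v i : Fin m → ℝ) := rfl

lemma aff_apply {k m : ℕ} (v : Fin k → stdSimplex ℝ (Fin m)) (t : stdSimplex ℝ (Fin k))
    (l : Fin m) : aff v t l = ∑ i, t i * v i l := by
  have := congrFun (aff_coe v t) l
  simpa [Finset.sum_apply] using this

lemma aff_aff {k l m : ℕ} (w : Fin l → stdSimplex ℝ (Fin m)) (v : Fin k → stdSimplex ℝ (Fin l))
    (t : stdSimplex ℝ (Fin k)) : aff w (aff v t) = aff (fun i => aff w (v i)) t := by
  ext a
  simp only [aff_apply, Finset.sum_mul, Finset.mul_sum]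
  rw [Finset.sum_comm]
  simp only [mul_assoc]

lemma aff_simpMap {k l m : ℕ} (v : Fin l → stdSimplex ℝ (Fin m)) (f : Fin k → Fin l) :
    (aff v).comp (simpMap f) = aff (v ∘ f) := by
  ext t a
  change aff v (stdSimplex.map f t) a = aff (v ∘ f) t a
  simp only [aff_apply, stdSimplex.map_coe]
  simp only [FunOnFinite.linearMap_apply_apply, Finset.sum_mul]
  rw [← Finset.sum_fiberwise Finset.univ f]
  refine Finset.sum_congr rfl fun j _ => Finset.sum_congr rfl fun i hi => ?_
  rw [Function.comp_apply, (Finset.mem_filter.1 hi).2]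

/-- The vertices of the standard simplex. -/
noncomputable def vert (m : ℕ) : Fin m → stdSimplex ℝ (Fin m) := stdSimplex.vertex

lemma aff_vert (m : ℕ) : aff (vert m) = ContinuousMap.id _ := by
  ext t a
  change aff (vert m) t a = t a
  simp [aff_apply, vert, Pi.single_apply]

lemma aff_apply_vert {k m : ℕ} (v : Fin k → stdSimplex ℝ (Fin m)) (i : Fin k) :
    aff v (vert k i) = v i := by
  ext a
  simp [aff_apply, vert, Pi.single_apply]

/-- The barycenter of a tuple of points. -/
noncomputable def bary {k m : ℕ} (v : Fin (k + 1) → stdSimplex ℝ (Fin m)) :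
    stdSimplex ℝ (Fin m) := aff v stdSimplex.barycenter

/-- Augmented affine chains: formal combinations of `k`-tuples of points. -/
abbrev AffChain (k m : ℕ) : Type := (Fin k → stdSimplex ℝ (Fin m)) →₀ ℚ

variable {k l m n : ℕ}

lemma affChain_hom_ext {M : Type} [AddCommGroup M] [Module ℚ M] {f g : AffChain k m →ₗ[ℚ] M}
    (h : ∀ v, f (Finsupp.single v 1) = g (Finsupp.single v 1)) : f = g :=
  Finsupp.lhom_ext' fun σ => LinearMap.ext_ring (h σ)

/-- The boundary of augmented affine chains. -/
noncomputable def affBdry (k m : ℕ) : AffChain (k + 1) m →ₗ[ℚ] AffChain k m :=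
  ∑ i : Fin (k + 1), (-1 : ℚ) ^ (i : ℕ) • Finsupp.lmapDomain ℚ ℚ (fun v => v ∘ i.succAbove)

lemma affBdry_single (v : Fin (k + 1) → stdSimplex ℝ (Fin m)) :
    affBdry k m (Finsupp.single v 1) = ∑ i : Fin (k + 1), (-1 : ℚ) ^ (i : ℕ) •
      Finsupp.single (v ∘ i.succAbove) 1 := by
  simp [affBdry, LinearMap.sum_apply]

/-- The cone operator. -/
noncomputable def cone (k : ℕ) (b : stdSimplex ℝ (Fin m)) : AffChain k m →ₗ[ℚ] AffChain (k + 1) m :=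
  Finsupp.lmapDomain ℚ ℚ (fun v => Fin.cons b v)

@[simp] lemma cone_single (b : stdSimplex ℝ (Fin m)) (v : Fin k → stdSimplex ℝ (Fin m)) (a : ℚ) :
    cone k b (Finsupp.single v a) = Finsupp.single (Fin.cons b v) a := by
  simp [cone]

lemma affBdry_cone_zero (b : stdSimplex ℝ (Fin m)) (c : AffChain 0 m) :
    affBdry 0 m (cone 0 b c) = c := by
  suffices h : affBdry 0 m ∘ₗ cone 0 b = LinearMap.id from LinearMap.congr_fun h c
  refine affChain_hom_ext fun v => ?_
  simp only [LinearMap.comp_apply, cone_single, affBdry_single, LinearMap.id_apply]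
  simp only [Fin.sum_univ_succ, Fin.val_zero, pow_zero, one_smul]
  simp [Subsingleton.elim _ v]

lemma affBdry_cone (b : stdSimplex ℝ (Fin m)) (c : AffChain (k + 1) m) :
    affBdry (k + 1) m (cone (k + 1) b c) = c - cone k b (affBdry k m c) := by
  suffices h : affBdry (k + 1) m ∘ₗ cone (k + 1) b = LinearMap.id - cone k b ∘ₗ affBdry k m from
    LinearMap.congr_fun h c
  refine affChain_hom_ext fun v => ?_
  simp only [LinearMap.comp_apply, LinearMap.sub_apply, cone_single, affBdry_single,
    LinearMap.id_apply, map_sum, map_smul]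
  rw [Fin.sum_univ_succ, sub_eq_add_neg, ← Finset.sum_neg_distrib]
  congr 1
  · simp only [Fin.val_zero, pow_zero, one_smul]
    rfl
  · refine Finset.sum_congr rfl fun i _ => ?_
    have : (Fin.cons b v : Fin (k + 2) → stdSimplex ℝ (Fin m)) ∘ i.succ.succAbove =
        Fin.cons b (v ∘ i.succAbove) := by
      funext j
      refine Fin.cases ?_ (fun j => ?_) j <;> simp
    rw [this, Fin.val_succ, pow_succ, mul_neg_one, neg_smul]

lemma affBdry_affBdry (c : AffChain (k + 2) m) : affBdry k m (affBdry (k + 1) m c) = 0 := by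
  suffices h : affBdry k m ∘ₗ affBdry (k + 1) m = 0 from LinearMap.congr_fun h c
  clear c
  induction k with
  | zero =>
    refine affChain_hom_ext fun v => ?_
    have : Finsupp.single v (1 : ℚ) = cone 1 (v 0) (Finsupp.single (Fin.tail v) 1) := by
      rw [cone_single, Fin.cons_self_tail]
    simp [this, affBdry_cone, affBdry_cone_zero, -cone_single]
  | succ k ih =>
    refine affChain_hom_ext fun v => ?_
    have : Finsupp.single v (1 : ℚ) = cone (k + 2) (v 0) (Finsupp.single (Fin.tail v) 1) := by
      rw [cone_single, Fin.cons_self_tail]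
    have h := LinearMap.congr_fun ih (Finsupp.single (Fin.tail v) 1)
    rw [LinearMap.comp_apply, LinearMap.zero_apply] at h
    simp [this, affBdry_cone, h, -cone_single]

/-- Barycentric subdivision of affine chains. -/
noncomputable def affSd (m : ℕ) : ∀ k, AffChain k m →ₗ[ℚ] AffChain k m
  | 0 => LinearMap.id
  | k + 1 => Finsupp.linearCombination ℚ fun v =>
      cone k (bary v) (affSd m k (affBdry k m (Finsupp.single v 1)))

/-- The chain homotopy between barycentric subdivision and the identity. -/
noncomputable def affT (m : ℕ) : ∀ k, AffChain k m →ₗ[ℚ] AffChain (k + 1) m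
  | 0 => 0
  | k + 1 => Finsupp.linearCombination ℚ fun v =>
      cone (k + 1) (bary v) (Finsupp.single v 1 - affT m k (affBdry k m (Finsupp.single v 1)))

lemma affSd_single (v : Fin (k + 1) → stdSimplex ℝ (Fin m)) :
    affSd m (k + 1) (Finsupp.single v 1) =
      cone k (bary v) (affSd m k (affBdry k m (Finsupp.single v 1))) := by
  simp [affSd]

lemma affT_single (v : Fin (k + 1) → stdSimplex ℝ (Fin m)) :
    affT m (k + 1) (Finsupp.single v 1) = cone (k + 1) (bary v)
      (Finsupp.single v 1 - affT m k (affBdry k m (Finsupp.single v 1))) := by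
  simp [affT]

lemma affBdry_affSd (c : AffChain (k + 1) m) :
    affBdry k m (affSd m (k + 1) c) = affSd m k (affBdry k m c) := by
  suffices h : affBdry k m ∘ₗ affSd m (k + 1) = affSd m k ∘ₗ affBdry k m from
    LinearMap.congr_fun h c
  clear c
  induction k with
  | zero =>
    refine affChain_hom_ext fun v => ?_
    simp only [LinearMap.comp_apply, affSd_single, affBdry_cone_zero]
  | succ k ih =>
    refine affChain_hom_ext fun v => ?_
    have h := LinearMap.congr_fun ih (affBdry (k + 1) m (Finsupp.single v 1))
    simp only [LinearMap.comp_apply, affBdry_affBdry, map_zero] at h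
    simp only [LinearMap.comp_apply, affSd_single v, affBdry_cone, h, map_zero, sub_zero]

lemma affBdry_affT (c : AffChain (k + 1) m) :
    affBdry (k + 1) m (affT m (k + 1) c) + affT m k (affBdry k m c) = c - affSd m (k + 1) c := by
  suffices h : affBdry (k + 1) m ∘ₗ affT m (k + 1) + affT m k ∘ₗ affBdry k m =
      LinearMap.id - affSd m (k + 1) from LinearMap.congr_fun h c
  clear c
  induction k with
  | zero =>
    refine affChain_hom_ext fun v => ?_
    simp only [LinearMap.comp_apply, LinearMap.add_apply, LinearMap.sub_apply, affT_single,
      affSd_single, affBdry_cone, LinearMap.id_apply]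
    simp [affT, affSd]
  | succ k ih =>
    refine affChain_hom_ext fun v => ?_
    have h := LinearMap.congr_fun ih (affBdry (k + 1) m (Finsupp.single v 1))
    simp only [LinearMap.comp_apply, LinearMap.add_apply, LinearMap.sub_apply, LinearMap.id_apply,
      affBdry_affBdry, map_zero, add_zero] at h
    simp only [LinearMap.comp_apply, LinearMap.add_apply, LinearMap.sub_apply, affT_single v,
      affSd_single v, affBdry_cone, LinearMap.id_apply, map_sub, h]
    abel

/-- The action of an affine map on affine chains. -/
noncomputable def affMap (k : ℕ) (w : Fin l → stdSimplex ℝ (Fin m)) :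
    AffChain k l →ₗ[ℚ] AffChain k m :=
  Finsupp.lmapDomain ℚ ℚ fun v i => aff w (v i)

@[simp] lemma affMap_single (w : Fin l → stdSimplex ℝ (Fin m)) (v : Fin k → stdSimplex ℝ (Fin l))
    (a : ℚ) : affMap k w (Finsupp.single v a) = Finsupp.single (fun i => aff w (v i)) a := by
  simp [affMap]

lemma affMap_affBdry (w : Fin l → stdSimplex ℝ (Fin m)) (c : AffChain (k + 1) l) :
    affMap k w (affBdry k l c) = affBdry k m (affMap (k + 1) w c) := by
  suffices h : affMap k w ∘ₗ affBdry k l = affBdry k m ∘ₗ affMap (k + 1) w from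
    LinearMap.congr_fun h c
  refine affChain_hom_ext fun v => ?_
  simp only [LinearMap.comp_apply, affMap_single, affBdry_single, map_sum, map_smul]
  rfl

lemma affMap_cone (w : Fin l → stdSimplex ℝ (Fin m)) (b : stdSimplex ℝ (Fin l))
    (c : AffChain k l) : affMap (k + 1) w (cone k b c) = cone k (aff w b) (affMap k w c) := by
  suffices h : affMap (k + 1) w ∘ₗ cone k b = cone k (aff w b) ∘ₗ affMap k w from
    LinearMap.congr_fun h c
  refine affChain_hom_ext fun v => ?_
  simp only [LinearMap.comp_apply, affMap_single, cone_single]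
  congr 1
  funext j
  refine Fin.cases ?_ (fun j => ?_) j <;> simp

lemma affMap_affSd (w : Fin l → stdSimplex ℝ (Fin m)) (c : AffChain k l) :
    affMap k w (affSd l k c) = affSd m k (affMap k w c) := by
  suffices h : affMap k w ∘ₗ affSd l k = affSd m k ∘ₗ affMap k w from LinearMap.congr_fun h c
  clear c
  induction k with
  | zero => rfl
  | succ k ih =>
    refine affChain_hom_ext fun v => ?_
    have h := LinearMap.congr_fun ih (affBdry k l (Finsupp.single v 1))
    simp only [LinearMap.comp_apply, affMap_affBdry, affMap_single] at h
    simp only [LinearMap.comp_apply, affMap_single, affSd_single, affMap_cone, h]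
    rw [bary, aff_aff]
    rfl

lemma affMap_affT (w : Fin l → stdSimplex ℝ (Fin m)) (c : AffChain k l) :
    affMap (k + 1) w (affT l k c) = affT m k (affMap k w c) := by
  suffices h : affMap (k + 1) w ∘ₗ affT l k = affT m k ∘ₗ affMap k w from LinearMap.congr_fun h c
  clear c
  induction k with
  | zero => simp [affT]
  | succ k ih =>
    refine affChain_hom_ext fun v => ?_
    have h := LinearMap.congr_fun ih (affBdry k l (Finsupp.single v 1))
    simp only [LinearMap.comp_apply, affMap_affBdry, affMap_single] at h
    simp only [LinearMap.comp_apply, affMap_single, affT_single, affMap_cone, h, map_sub]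
    rw [bary, aff_aff]
    rfl

/-- Realization of affine chains as singular chains of the simplex. -/
noncomputable def affReal (k m : ℕ) : AffChain (k + 1) m →ₗ[ℚ] Chain k (stdSimplex ℝ (Fin m)) :=
  Finsupp.lmapDomain ℚ ℚ aff

@[simp] lemma affReal_single (v : Fin (k + 1) → stdSimplex ℝ (Fin m)) (a : ℚ) :
    affReal k m (Finsupp.single v a) = Finsupp.single (aff v) a := by
  simp [affReal]

lemma bdry_affReal (c : AffChain (k + 2) m) :
    bdry k _ (affReal (k + 1) m c) = affReal k m (affBdry (k + 1) m c) := by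
  suffices h : bdry k _ ∘ₗ affReal (k + 1) m = affReal k m ∘ₗ affBdry (k + 1) m from
    LinearMap.congr_fun h c
  refine affChain_hom_ext fun v => ?_
  simp only [LinearMap.comp_apply, affReal_single, bdry_single, affBdry_single, map_sum, map_smul,
    aff_simpMap]

lemma chainMap_aff_affReal (w : Fin l → stdSimplex ℝ (Fin m)) (c : AffChain (k + 1) l) :
    chainMap k (aff w) (affReal k l c) = affReal k m (affMap (k + 1) w c) := by
  suffices h : chainMap k (aff w) ∘ₗ affReal k l = affReal k m ∘ₗ affMap (k + 1) w from
    LinearMap.congr_fun h c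
  refine affChain_hom_ext fun v => ?_
  simp only [LinearMap.comp_apply, affReal_single, affMap_single, chainMap_single]
  congr 1
  ext1 t
  exact aff_aff w v t

end RatHomology

namespace RatHomology

variable {X Y Z : Type} [TopologicalSpace X] [TopologicalSpace Y] [TopologicalSpace Z]
  {k l m n : ℕ}

/-- Barycentric subdivision of singular chains. -/
noncomputable def sd (n : ℕ) (X : Type) [TopologicalSpace X] : Chain n X →ₗ[ℚ] Chain n X :=
  Finsupp.linearCombination ℚ fun σ => chainMap n σ
    (affReal n (n + 1) (affSd (n + 1) (n + 1) (Finsupp.single (vert (n + 1)) 1)))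

/-- The natural homotopy between subdivision and the identity. -/
noncomputable def sdT (n : ℕ) (X : Type) [TopologicalSpace X] : Chain n X →ₗ[ℚ] Chain (n + 1) X :=
  Finsupp.linearCombination ℚ fun σ => chainMap (n + 1) σ
    (affReal (n + 1) (n + 1) (affT (n + 1) (n + 1) (Finsupp.single (vert (n + 1)) 1)))

lemma sd_single (σ : Sing n X) : sd n X (Finsupp.single σ 1) = chainMap n σ
    (affReal n (n + 1) (affSd (n + 1) (n + 1) (Finsupp.single (vert (n + 1)) 1))) := by
  simp [sd]

lemma sdT_single (σ : Sing n X) : sdT n X (Finsupp.single σ 1) = chainMap (n + 1) σ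
    (affReal (n + 1) (n + 1) (affT (n + 1) (n + 1) (Finsupp.single (vert (n + 1)) 1))) := by
  simp [sdT]

lemma affMap_vert (w : Fin l → stdSimplex ℝ (Fin m)) (a : ℚ) :
    affMap l w (Finsupp.single (vert l) a) = Finsupp.single w a := by
  simp [aff_apply_vert]

/-- Subdivision of a singular chain carried by an affine chain. -/
lemma sd_chainMap_affReal (σ : C(stdSimplex ℝ (Fin m), X)) (c : AffChain (n + 1) m) :
    sd n X (chainMap n σ (affReal n m c)) = chainMap n σ (affReal n m (affSd m (n + 1) c)) := by
  suffices h : sd n X ∘ₗ chainMap n σ ∘ₗ affReal n m =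
      chainMap n σ ∘ₗ affReal n m ∘ₗ affSd m (n + 1) from LinearMap.congr_fun h c
  refine affChain_hom_ext fun v => ?_
  simp only [LinearMap.comp_apply, affReal_single, chainMap_single, sd_single, chainMap_comp,
    chainMap_aff_affReal, affMap_affSd, affMap_vert]

lemma sdT_chainMap_affReal (σ : C(stdSimplex ℝ (Fin m), X)) (c : AffChain (n + 1) m) :
    sdT n X (chainMap n σ (affReal n m c)) =
      chainMap (n + 1) σ (affReal (n + 1) m (affT m (n + 1) c)) := by
  suffices h : sdT n X ∘ₗ chainMap n σ ∘ₗ affReal n m =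
      chainMap (n + 1) σ ∘ₗ affReal (n + 1) m ∘ₗ affT m (n + 1) from LinearMap.congr_fun h c
  refine affChain_hom_ext fun v => ?_
  simp only [LinearMap.comp_apply, affReal_single, chainMap_single, sdT_single, chainMap_comp,
    chainMap_aff_affReal, affMap_affT, affMap_vert]

lemma single_eq_chainMap_affReal (σ : Sing n X) : Finsupp.single σ (1 : ℚ) =
    chainMap n σ (affReal n (n + 1) (Finsupp.single (vert (n + 1)) 1)) := by
  rw [affReal_single, aff_vert, chainMap_single, ContinuousMap.comp_id]

lemma chainMap_sd (f : C(X, Y)) (c : Chain n X) :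
    chainMap n f (sd n X c) = sd n Y (chainMap n f c) := by
  suffices h : chainMap n f ∘ₗ sd n X = sd n Y ∘ₗ chainMap n f from LinearMap.congr_fun h c
  refine chain_hom_ext fun v => ?_
  simp only [LinearMap.comp_apply, sd_single, chainMap_single, chainMap_comp]

lemma chainMap_sdT (f : C(X, Y)) (c : Chain n X) :
    chainMap (n + 1) f (sdT n X c) = sdT n Y (chainMap n f c) := by
  suffices h : chainMap (n + 1) f ∘ₗ sdT n X = sdT n Y ∘ₗ chainMap n f from LinearMap.congr_fun h c
  refine chain_hom_ext fun v => ?_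
  simp only [LinearMap.comp_apply, sdT_single, chainMap_single, chainMap_comp]

lemma bdry_sd (c : Chain (n + 1) X) : bdry n X (sd (n + 1) X c) = sd n X (bdry n X c) := by
  suffices h : bdry n X ∘ₗ sd (n + 1) X = sd n X ∘ₗ bdry n X from LinearMap.congr_fun h c
  refine chain_hom_ext fun σ => ?_
  rw [single_eq_chainMap_affReal]
  simp only [LinearMap.comp_apply, sd_chainMap_affReal, ← chainMap_bdry, bdry_affReal,
    affBdry_affSd]

lemma bdry_sdT_succ (c : Chain (n + 1) X) :
    bdry (n + 1) X (sdT (n + 1) X c) + sdT n X (bdry n X c) = c - sd (n + 1) X c := by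
  suffices h : bdry (n + 1) X ∘ₗ sdT (n + 1) X + sdT n X ∘ₗ bdry n X =
    LinearMap.id - sd (n + 1) X from LinearMap.congr_fun h c
  refine chain_hom_ext fun σ => ?_
  rw [single_eq_chainMap_affReal]
  simp only [LinearMap.comp_apply, LinearMap.add_apply, LinearMap.sub_apply, LinearMap.id_apply,
    sd_chainMap_affReal, sdT_chainMap_affReal, ← chainMap_bdry, bdry_affReal, ← map_add, ← map_sub,
    affBdry_affT]

lemma bdry_sdT_zero (c : Chain 0 X) : bdry 0 X (sdT 0 X c) = c - sd 0 X c := by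
  suffices h : bdry 0 X ∘ₗ sdT 0 X = LinearMap.id - sd 0 X from LinearMap.congr_fun h c
  refine chain_hom_ext fun σ => ?_
  have := affBdry_affT (k := 0) (m := 1) (Finsupp.single (vert 1) 1)
  rw [show affT 1 0 = 0 from rfl, LinearMap.zero_apply, add_zero] at this
  rw [single_eq_chainMap_affReal]
  simp only [LinearMap.comp_apply, LinearMap.sub_apply, LinearMap.id_apply,
    sd_chainMap_affReal, sdT_chainMap_affReal, ← chainMap_bdry, bdry_affReal, ← map_sub, this]

/-! ### Diameter estimates -/

lemma dist_aff_le {v : Fin k → stdSimplex ℝ (Fin m)} {p : stdSimplex ℝ (Fin m)} {r : ℝ}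
    (h : ∀ i, dist p (v i) ≤ r) (t : stdSimplex ℝ (Fin k)) : dist p (aff v t) ≤ r := by
  have : (aff v t : Fin m → ℝ) ∈ Metric.closedBall (p : Fin m → ℝ) r :=
    (convex_closedBall _ _).sum_mem (fun i _ => t.2.1 i) t.2.2 fun i _ => by
      rw [Metric.mem_closedBall, dist_comm]
      exact h i
  rw [Metric.mem_closedBall, dist_comm] at this
  exact this

lemma dist_bary_le {v : Fin (k + 1) → stdSimplex ℝ (Fin m)} {D : ℝ}
    (h : ∀ i j, dist (v i) (v j) ≤ D) (i : Fin (k + 1)) :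
    dist (bary v) (v i) ≤ k / (k + 1) * D := by
  have hk : (k + 1 : ℝ) ≠ 0 := by positivity
  rw [Subtype.dist_eq, dist_eq_norm]
  have h1 : (bary v : Fin m → ℝ) - v i =
      (k + 1 : ℝ)⁻¹ • ∑ j ∈ Finset.univ.erase i, ((v j : Fin m → ℝ) - v i) := by
    rw [Finset.sum_erase _ (sub_self _), Finset.sum_sub_distrib, Finset.sum_const, Finset.card_univ,
      Fintype.card_fin, smul_sub, ← Nat.cast_smul_eq_nsmul ℝ, smul_smul, Nat.cast_add_one,
      inv_mul_cancel₀ hk, one_smul, bary, aff_coe, Finset.smul_sum]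
    have hb (i : Fin (k + 1)) :
        (stdSimplex.barycenter : stdSimplex ℝ (Fin (k + 1))) i = ((k : ℝ) + 1)⁻¹ := by
      change (Fintype.card (Fin (k + 1)) : ℝ)⁻¹ = _
      simp
    simp [hb]
  change ‖(bary v : Fin m → ℝ) - v i‖ ≤ _
  rw [h1, norm_smul, norm_inv, Real.norm_of_nonneg (by positivity), div_mul_eq_mul_div,
    ← div_eq_inv_mul]
  gcongr
  refine (norm_sum_le_of_le _ fun j _ => (dist_eq_norm _ _).symm.trans_le (h j i)).trans ?_
  simp

lemma mapDomain_mem_supported {α β : Type} {s : Set α} {t : Set β} {f : α → β}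
    (h : Set.MapsTo f s t) {c : α →₀ ℚ} (hc : c ∈ Finsupp.supported ℚ ℚ s) :
    Finsupp.lmapDomain ℚ ℚ f c ∈ Finsupp.supported ℚ ℚ t :=
  Finsupp.supported_mono h.image_subset
    (Finsupp.lmapDomain_supported ℚ ℚ f s ▸ Submodule.mem_map_of_mem hc)

lemma affSd_single_mem_of (P : ∀ k, (Fin k → stdSimplex ℝ (Fin m)) →
    (Fin k → stdSimplex ℝ (Fin m)) → Prop) (h0 : ∀ v, P 0 v v)
    (hs : ∀ k v (i : Fin (k + 1)) w, P k (v ∘ i.succAbove) w → P (k + 1) v (Fin.cons (bary v) w))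
    (v : Fin k → stdSimplex ℝ (Fin m)) :
    affSd m k (Finsupp.single v 1) ∈ Finsupp.supported ℚ ℚ {w | P k v w} := by
  induction k with
  | zero => exact Finsupp.single_mem_supported ℚ _ (h0 v)
  | succ k ih =>
    rw [affSd_single, affBdry_single, map_sum, map_sum]
    refine Submodule.sum_mem _ fun i _ => ?_
    rw [map_smul, map_smul]
    exact Submodule.smul_mem _ _ (mapDomain_mem_supported (fun w hw => hs k v i w hw) (ih _))

lemma affSd_single_mem_dist {D : ℝ} (v : Fin (n + 1) → stdSimplex ℝ (Fin m))
    (hv : ∀ i j, dist (v i) (v j) ≤ D) :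
    affSd m (n + 1) (Finsupp.single v 1) ∈ Finsupp.supported ℚ ℚ
      {w | ∀ i j, dist (w i) (w j) ≤ n / (n + 1) * D} := by
  have key := affSd_single_mem_of (m := m) (fun k v w =>
    (∀ p r, (∀ i, dist p (v i) ≤ r) → ∀ i, dist p (w i) ≤ r) ∧ ∀ D, 0 ≤ D →
      (∀ i j, dist (v i) (v j) ≤ D) → ∀ i j, dist (w i) (w j) ≤ (k - 1 : ℝ) / k * D)
    (fun v => ⟨fun p r h => h, fun D _ _ i => i.elim0⟩) (fun k v i w hw => ⟨fun p r h j => ?_,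
      fun D hD h => ?_⟩) v
  · refine Finsupp.supported_mono (fun w hw i j => ?_) key
    have := hw.2 D (dist_nonneg.trans (hv i i)) hv i j
    push_cast at this
    simpa using this
  · refine Fin.cases ?_ (fun j => ?_) j
    · exact dist_aff_le h _
    · exact hw.1 p r (fun a => h _) j
  · have hb := dist_bary_le h
    push_cast
    rw [add_sub_cancel_right]
    have h1 : ∀ j, dist (bary v) (w j) ≤ k / (k + 1) * D :=
      hw.1 _ _ fun a => hb _
    have h2 : ∀ a b, dist (w a) (w b) ≤ k / (k + 1) * D := fun a b => by
      have hk : k ≠ 0 := fun h => by subst h; exact a.elim0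
      refine (hw.2 D hD (fun a b => h _ _) a b).trans (mul_le_mul_of_nonneg_right ?_ hD)
      have : (0 : ℝ) < k := by positivity
      rw [div_le_div_iff₀ this (by positivity)]
      nlinarith
    have h0 : 0 ≤ (k : ℝ) / (k + 1) * D := by positivity
    intro a b
    refine Fin.cases ?_ (fun a => ?_) a <;> refine Fin.cases ?_ (fun b => ?_) b
    · simpa using h0
    · simpa using h1 b
    · simpa [dist_comm] using h1 a
    · simpa using h2 a b

lemma affSd_mem_dist {D : ℝ} {c : AffChain (n + 1) m}
    (hc : c ∈ Finsupp.supported ℚ ℚ {w | ∀ i j, dist (w i) (w j) ≤ D}) :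
    affSd m (n + 1) c ∈ Finsupp.supported ℚ ℚ {w | ∀ i j, dist (w i) (w j) ≤ n / (n + 1) * D} := by
  rw [Finsupp.supported_eq_span_single] at hc
  refine Submodule.span_induction ?_ ?_ ?_ ?_ hc
  · rintro _ ⟨v, hv, rfl⟩
    exact affSd_single_mem_dist v hv
  · simp
  · intro x y _ _ hx hy
    rw [map_add]; exact add_mem hx hy
  · intro a x _ hx
    rw [map_smul]; exact Submodule.smul_mem _ _ hx

lemma affSd_iterate_mem_dist {D : ℝ} {c : AffChain (n + 1) m}
    (hc : c ∈ Finsupp.supported ℚ ℚ {w | ∀ i j, dist (w i) (w j) ≤ D}) (N : ℕ) :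
    (affSd m (n + 1))^[N] c ∈
      Finsupp.supported ℚ ℚ {w | ∀ i j, dist (w i) (w j) ≤ (n / (n + 1)) ^ N * D} := by
  induction N with
  | zero => simpa using hc
  | succ N ih =>
    rw [Function.iterate_succ_apply', pow_succ', mul_assoc]
    exact affSd_mem_dist ih

end RatHomology

namespace RatHomology

open Topology

section ChainLift

variable {X Y : Type} [TopologicalSpace X] [TopologicalSpace Y]

lemma chainMap_injective {n : ℕ} {f : C(X, Y)} (hf : Function.Injective f) :
    Function.Injective (chainMap n f) := by
  refine Finsupp.mapDomain_injective fun σ τ h => ?_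
  ext x
  exact hf (DFunLike.congr_fun h x)

lemma exists_comp_eq_of_range_subset {n : ℕ} {f : C(X, Y)} (hf : IsEmbedding f) (σ : Sing n Y)
    (h : ∀ t, σ t ∈ Set.range f) : ∃ τ : Sing n X, f.comp τ = σ := by
  refine ⟨⟨fun t => hf.toHomeomorph.symm ⟨σ t, h t⟩, by fun_prop⟩, ?_⟩
  ext t
  have := hf.toHomeomorph.apply_symm_apply ⟨σ t, h t⟩
  exact congrArg Subtype.val this

lemma exists_chainMap_eq {n : ℕ} {f : C(X, Y)} {c : Chain n Y}
    (h : ∀ σ ∈ c.support, ∃ τ : Sing n X, f.comp τ = σ) : ∃ c', chainMap n f c' = c := by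
  change c ∈ LinearMap.range (chainMap n f)
  rw [← Finsupp.sum_single c]
  refine Submodule.sum_mem _ fun σ hσ => ?_
  obtain ⟨τ, rfl⟩ := h σ hσ
  exact ⟨Finsupp.single τ (c (f.comp τ)), chainMap_single n f τ _⟩

lemma bdry_sd_iterate {n : ℕ} (N : ℕ) (c : Chain (n + 1) X) :
    bdry n X ((sd (n + 1) X)^[N] c) = (sd n X)^[N] (bdry n X c) := by
  induction N generalizing c with
  | zero => rfl
  | succ N ih => rw [Function.iterate_succ_apply, ih, bdry_sd, Function.iterate_succ_apply]

lemma bdry_sdT_of_mem_cycles {n : ℕ} {c : Chain n X} (hc : c ∈ cycles n X) :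
    bdry n X (sdT n X c) = c - sd n X c := by
  cases n with
  | zero => exact bdry_sdT_zero c
  | succ n =>
    have := bdry_sdT_succ c
    rwa [mem_cycles_succ.1 hc, map_zero, add_zero] at this

lemma sd_mem_cycles {n : ℕ} {c : Chain n X} (hc : c ∈ cycles n X) : sd n X c ∈ cycles n X := by
  cases n with
  | zero => trivial
  | succ n => rw [mem_cycles_succ] at hc ⊢; rw [bdry_sd, hc, map_zero]

end ChainLift

/-- A square of spaces `I → A, B → X` exhibiting `X` as the union of the open subspaces `A` and
`B` with intersection `I`. -/
structure MVSquare (I A B X : Type) [TopologicalSpace I] [TopologicalSpace A] [TopologicalSpace B]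
    [TopologicalSpace X] where
  iA : C(I, A)
  iB : C(I, B)
  jA : C(A, X)
  jB : C(B, X)
  comm : jA.comp iA = jB.comp iB
  openA : IsOpenEmbedding jA
  openB : IsOpenEmbedding jB
  embI : IsEmbedding iA
  cover : ∀ x, x ∈ Set.range jA ∨ x ∈ Set.range jB
  inter : ∀ a b, jA a = jB b → ∃ i, iA i = a

namespace MVSquare

variable {I A B X : Type} [TopologicalSpace I] [TopologicalSpace A] [TopologicalSpace B]
  [TopologicalSpace X] (S : MVSquare I A B X)

lemma comm_apply (i : I) : S.jA (S.iA i) = S.jB (S.iB i) := DFunLike.congr_fun S.comm i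

lemma chainMap_comm {n : ℕ} (c : Chain n I) :
    chainMap n S.jA (chainMap n S.iA c) = chainMap n S.jB (chainMap n S.iB c) := by
  rw [← chainMap_comp, S.comm, chainMap_comp]

lemma map_comm {n : ℕ} (c : H n I) :
    H.map n S.jA (H.map n S.iA c) = H.map n S.jB (H.map n S.iB c) := by
  rw [H.map_map, S.comm, ← H.map_map]

/-- The square with the two open sets interchanged. -/
def symm : MVSquare I B A X where
  iA := S.iB
  iB := S.iA
  jA := S.jB
  jB := S.jA
  comm := S.comm.symm
  openA := S.openB
  openB := S.openA
  embI := by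
    have h : IsEmbedding (S.jB ∘ S.iB) := by
      have := S.openA.isEmbedding.comp S.embI
      convert this using 1
      exact (funext S.comm_apply).symm
    exact IsEmbedding.of_comp S.iB.continuous S.jB.continuous h
  cover x := (S.cover x).symm
  inter b a h := by
    obtain ⟨i, rfl⟩ := S.inter a b h.symm
    exact ⟨i, S.openB.injective (by rw [← S.comm_apply, h])⟩

/-- Chains which are sums of chains in the two open sets. -/
noncomputable def small (n : ℕ) : Submodule ℚ (Chain n X) :=
  LinearMap.range (chainMap n S.jA) ⊔ LinearMap.range (chainMap n S.jB)

variable {S}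

lemma mem_small {n : ℕ} {c : Chain n X} :
    c ∈ S.small n ↔ ∃ u w, chainMap n S.jA u + chainMap n S.jB w = c := by
  simp only [small, Submodule.mem_sup, LinearMap.mem_range]
  constructor
  · rintro ⟨_, ⟨u, rfl⟩, _, ⟨w, rfl⟩, h⟩; exact ⟨u, w, h⟩
  · rintro ⟨u, w, h⟩; exact ⟨_, ⟨u, rfl⟩, _, ⟨w, rfl⟩, h⟩

lemma sd_mem_small {n : ℕ} {c : Chain n X} (hc : c ∈ S.small n) : sd n X c ∈ S.small n := by
  obtain ⟨u, w, rfl⟩ := mem_small.1 hc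
  exact mem_small.2 ⟨sd n A u, sd n B w, by rw [map_add, chainMap_sd, chainMap_sd]⟩

lemma sdT_mem_small {n : ℕ} {c : Chain n X} (hc : c ∈ S.small n) :
    sdT n X c ∈ S.small (n + 1) := by
  obtain ⟨u, w, rfl⟩ := mem_small.1 hc
  exact mem_small.2 ⟨sdT n A u, sdT n B w, by rw [map_add, chainMap_sdT, chainMap_sdT]⟩

lemma exists_bdry_eq_sub_sd_iterate {n : ℕ} (N : ℕ) {c : Chain n X} (hc : c ∈ cycles n X) :
    ∃ b, bdry n X b = c - (sd n X)^[N] c ∧ (c ∈ S.small n → b ∈ S.small (n + 1)) := by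
  induction N generalizing c with
  | zero => exact ⟨0, by simp, fun _ => zero_mem _⟩
  | succ N ih =>
    obtain ⟨b, hb, hs⟩ := ih (sd_mem_cycles hc)
    refine ⟨sdT n X c + b, ?_, fun h => add_mem (sdT_mem_small h) (hs (sd_mem_small h))⟩
    rw [map_add, bdry_sdT_of_mem_cycles hc, hb, Function.iterate_succ_apply]
    abel

lemma sd_iterate_mem_small {n : ℕ} {M N : ℕ} (h : M ≤ N) {c : Chain n X}
    (hc : (sd n X)^[M] c ∈ S.small n) : (sd n X)^[N] c ∈ S.small n := by
  induction N, h using Nat.le_induction with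
  | base => exact hc
  | succ N _ ih => rw [Function.iterate_succ_apply']; exact sd_mem_small ih

variable (S)

lemma single_mem_small {n : ℕ} (σ : Sing n X) (a : ℚ)
    (h : (∀ t, σ t ∈ Set.range S.jA) ∨ ∀ t, σ t ∈ Set.range S.jB) :
    Finsupp.single σ a ∈ S.small n := by
  rcases h with h | h
  · obtain ⟨τ, rfl⟩ := exists_comp_eq_of_range_subset S.openA.isEmbedding σ h
    exact mem_small.2 ⟨Finsupp.single τ a, 0, by simp⟩
  · obtain ⟨τ, rfl⟩ := exists_comp_eq_of_range_subset S.openB.isEmbedding σ h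
    exact mem_small.2 ⟨0, Finsupp.single τ a, by simp⟩

lemma exists_sd_iterate_single_mem_small {n : ℕ} (σ : Sing n X) :
    ∃ N, (sd n X)^[N] (Finsupp.single σ 1) ∈ S.small n := by
  obtain ⟨δ, hδ, h⟩ := lebesgue_number_lemma_of_metric
    (s := (Set.univ : Set (stdSimplex ℝ (Fin (n + 1))))) isCompact_univ
    (c := fun b : Bool => σ ⁻¹' (if b then Set.range S.jA else Set.range S.jB))
    (fun b => by
      cases b
      · exact S.openB.isOpen_range.preimage σ.continuous
      · exact S.openA.isOpen_range.preimage σ.continuous)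
    (fun t _ => by
      rcases S.cover (σ t) with h | h
      · exact Set.mem_iUnion.2 ⟨true, h⟩
      · exact Set.mem_iUnion.2 ⟨false, h⟩)
  set D := Metric.diam (Set.univ : Set (stdSimplex ℝ (Fin (n + 1))))
  have hsingle : Finsupp.single (vert (n + 1)) (1 : ℚ) ∈
      Finsupp.supported ℚ ℚ {w | ∀ i j, dist (w i) (w j) ≤ D} :=
    Finsupp.single_mem_supported _ _ fun i j =>
      Metric.dist_le_diam_of_mem isCompact_univ.isBounded trivial trivial
  obtain ⟨N, hN⟩ : ∃ N : ℕ, ((n : ℝ) / (n + 1)) ^ N * D < δ := by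
    have h0 : Filter.Tendsto (fun N : ℕ => ((n : ℝ) / (n + 1)) ^ N * D) Filter.atTop
        (𝓝 (0 * D)) :=
      (tendsto_pow_atTop_nhds_zero_of_lt_one (by positivity)
        (by rw [div_lt_one (by positivity)]; linarith)).mul_const D
    rw [zero_mul] at h0
    exact (h0.eventually (gt_mem_nhds hδ)).exists
  refine ⟨N, ?_⟩
  have hiter : ∀ M, (sd n X)^[M] (Finsupp.single σ 1) = chainMap n σ (affReal n (n + 1)
      ((affSd (n + 1) (n + 1))^[M] (Finsupp.single (vert (n + 1)) 1))) := by
    intro M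
    induction M with
    | zero => exact single_eq_chainMap_affReal σ
    | succ M ih =>
      rw [Function.iterate_succ_apply', ih, sd_chainMap_affReal, Function.iterate_succ_apply']
  rw [hiter]
  have hmem := affSd_iterate_mem_dist hsingle N
  generalize (affSd (n + 1) (n + 1))^[N] (Finsupp.single (vert (n + 1)) 1) = c at hmem
  rw [← Finsupp.sum_single c, Finsupp.sum, map_sum, map_sum]
  refine Submodule.sum_mem _ fun w hw => ?_
  rw [affReal_single, chainMap_single]
  obtain ⟨b, hb⟩ := h (w 0) trivial
  have hw' : ∀ t, aff w t ∈ Metric.ball (w 0) δ := fun t => by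
    rw [Metric.mem_ball, dist_comm]
    exact (dist_aff_le (fun i => (Finsupp.mem_supported _ _).1 hmem hw 0 i) t).trans_lt hN
  refine S.single_mem_small _ _ ?_
  cases b
  · exact Or.inr fun t => hb (hw' t)
  · exact Or.inl fun t => hb (hw' t)

lemma exists_sd_iterate_mem_small {n : ℕ} (c : Chain n X) :
    ∃ N, (sd n X)^[N] c ∈ S.small n := by
  induction c using Finsupp.induction_linear with
  | zero => exact ⟨0, zero_mem _⟩
  | add a b ha hb =>
    obtain ⟨M, hM⟩ := ha
    obtain ⟨N, hN⟩ := hb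
    refine ⟨max M N, ?_⟩
    rw [← Module.End.pow_apply, map_add, Module.End.pow_apply, Module.End.pow_apply]
    exact add_mem (sd_iterate_mem_small (le_max_left _ _) hM)
      (sd_iterate_mem_small (le_max_right _ _) hN)
  | single σ a =>
    obtain ⟨N, hN⟩ := S.exists_sd_iterate_single_mem_small σ
    refine ⟨N, ?_⟩
    rw [← mul_one a, ← smul_eq_mul, ← Finsupp.smul_single, ← Module.End.pow_apply, map_smul,
      Module.End.pow_apply]
    exact Submodule.smul_mem _ _ hN

lemma exists_add_homologous {n : ℕ} {z : Chain n X} (hz : z ∈ cycles n X) :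
    ∃ u w b, bdry n X b = z - (chainMap n S.jA u + chainMap n S.jB w) := by
  obtain ⟨N, hN⟩ := S.exists_sd_iterate_mem_small z
  obtain ⟨u, w, h⟩ := mem_small.1 hN
  obtain ⟨b, hb, -⟩ := exists_bdry_eq_sub_sd_iterate (S := S) N hz
  exact ⟨u, w, b, by rw [h, hb]⟩

lemma exists_add_of_bdry_eq_add {n : ℕ} {u : Chain n A} {w : Chain n B} {b : Chain (n + 1) X}
    (h : bdry n X b = chainMap n S.jA u + chainMap n S.jB w) :
    ∃ u' w', chainMap n S.jA u + chainMap n S.jB w =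
      chainMap n S.jA (bdry n A u') + chainMap n S.jB (bdry n B w') := by
  obtain ⟨N, hN⟩ := S.exists_sd_iterate_mem_small b
  obtain ⟨b', hb', hs⟩ := exists_bdry_eq_sub_sd_iterate (S := S) N (bdry_mem_cycles b)
  obtain ⟨u', w', h'⟩ := mem_small.1 (add_mem (hs (mem_small.2 ⟨u, w, h.symm⟩)) hN)
  refine ⟨u', w', ?_⟩
  rw [chainMap_bdry, chainMap_bdry, ← map_add, h', map_add, hb', bdry_sd_iterate, ← h]
  abel

lemma exists_chain_of_eq {n : ℕ} {u : Chain n A} {w : Chain n B}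
    (h : chainMap n S.jA u = chainMap n S.jB w) :
    ∃ c, chainMap n S.iA c = u ∧ chainMap n S.iB c = w := by
  classical
  obtain ⟨c, hc⟩ : ∃ c, chainMap n S.iA c = u := by
    refine exists_chainMap_eq fun σ hσ => exists_comp_eq_of_range_subset S.embI σ fun t => ?_
    have h1 : chainMap n S.jA u (S.jA.comp σ) ≠ 0 := by
      have : chainMap n S.jA u (S.jA.comp σ) = u σ :=
        Finsupp.mapDomain_apply (fun σ τ h => by
          ext x
          exact S.openA.injective (DFunLike.congr_fun h x)) _ _
      rw [this]
      exact Finsupp.mem_support_iff.1 hσ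
    rw [h] at h1
    obtain ⟨τ, -, hτ⟩ := Finset.mem_image.1
      (Finsupp.mapDomain_support (Finsupp.mem_support_iff.2 h1))
    exact S.inter _ (τ t) (DFunLike.congr_fun hτ t).symm
  refine ⟨c, hc, chainMap_injective S.openB.injective ?_⟩
  rw [← S.chainMap_comm, hc, h]

end MVSquare

end RatHomology

namespace RatHomology

namespace MVSquare

variable {I A B X : Type} [TopologicalSpace I] [TopologicalSpace A] [TopologicalSpace B]
  [TopologicalSpace X] (S : MVSquare I A B X)

/-- The relation underlying the connecting homomorphism. -/
def Connects (n : ℕ) (x : H (n + 1) X) (y : H n I) : Prop :=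
  ∃ u w c hz hc, x = H.mk (chainMap (n + 1) S.jA u + chainMap (n + 1) S.jB w) hz ∧ y = H.mk c hc ∧
    chainMap n S.iA c = bdry n A u ∧ chainMap n S.iB c = -bdry n B w

variable {S}

lemma mem_cycles_of_connecting {n : ℕ} {u : Chain (n + 1) A} {c : Chain n I}
    (h : chainMap n S.iA c = bdry n A u) : c ∈ cycles n I := by
  cases n with
  | zero => trivial
  | succ n =>
    rw [mem_cycles_succ]
    refine chainMap_injective S.embI.injective ?_
    rw [chainMap_bdry, h, bdry_bdry, map_zero]

lemma add_mem_cycles_of_connecting {n : ℕ} {u : Chain (n + 1) A} {w : Chain (n + 1) B}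
    {c : Chain n I} (hA : chainMap n S.iA c = bdry n A u) (hB : chainMap n S.iB c = -bdry n B w) :
    chainMap (n + 1) S.jA u + chainMap (n + 1) S.jB w ∈ cycles (n + 1) X := by
  rw [mem_cycles_succ, map_add, ← chainMap_bdry, ← chainMap_bdry, ← hA, ← neg_eq_iff_eq_neg.2 hB,
    map_neg, S.chainMap_comm, add_neg_cancel]

lemma connects_mk {n : ℕ} {u : Chain (n + 1) A} {w : Chain (n + 1) B}
    {c : Chain n I} (hA : chainMap n S.iA c = bdry n A u) (hB : chainMap n S.iB c = -bdry n B w) :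
    S.Connects n (H.mk _ (add_mem_cycles_of_connecting hA hB))
      (H.mk c (mem_cycles_of_connecting hA)) :=
  ⟨u, w, c, _, _, rfl, rfl, hA, hB⟩

variable (S)

lemma exists_connects (n : ℕ) (x : H (n + 1) X) : ∃ y, S.Connects n x y := by
  induction x using H.ind with
  | h z hz =>
    obtain ⟨u, w, b, hb⟩ := S.exists_add_homologous hz
    have hz' : chainMap (n + 1) S.jA u + chainMap (n + 1) S.jB w ∈ cycles (n + 1) X := by
      have := sub_mem hz (bdry_mem_cycles b)
      rwa [hb, sub_sub_cancel] at this
    have h0 := mem_cycles_succ.1 hz'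
    rw [map_add, ← chainMap_bdry, ← chainMap_bdry, ← eq_neg_iff_add_eq_zero, ← map_neg] at h0
    obtain ⟨c, hA, hB⟩ := S.exists_chain_of_eq h0
    exact ⟨_, u, w, c, hz', mem_cycles_of_connecting hA, (H.mk_eq_mk _ _).2 ⟨b, hb⟩, rfl, hA, hB⟩

variable {S}

lemma Connects.add {n : ℕ} {x x' : H (n + 1) X} {y y' : H n I} (h : S.Connects n x y)
    (h' : S.Connects n x' y') : S.Connects n (x + x') (y + y') := by
  obtain ⟨u, w, c, hz, hc, rfl, rfl, hA, hB⟩ := h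
  obtain ⟨u', w', c', hz', hc', rfl, rfl, hA', hB'⟩ := h'
  refine ⟨u + u', w + w', c + c', ?_, add_mem hc hc', ?_, rfl, by simp [hA, hA'], ?_⟩
  · convert add_mem hz hz' using 1
    simp only [map_add]; abel
  · rw [H.mk_add]
    congr 1
    simp only [map_add]; abel
  · simp only [map_add, hB, hB']; abel

lemma Connects.smul {n : ℕ} (a : ℚ) {x : H (n + 1) X} {y : H n I} (h : S.Connects n x y) :
    S.Connects n (a • x) (a • y) := by
  obtain ⟨u, w, c, hz, hc, rfl, rfl, hA, hB⟩ := h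
  refine ⟨a • u, a • w, a • c, ?_, Submodule.smul_mem _ a hc, ?_, rfl, by simp [hA], by simp [hB]⟩
  · convert Submodule.smul_mem _ a hz using 1
    simp
  · change H.mk (a • _) (Submodule.smul_mem _ a hz) = _
    congr 1
    simp

lemma Connects.eq_zero {n : ℕ} {y : H n I} (h : S.Connects n 0 y) : y = 0 := by
  obtain ⟨u, w, c, hz, hc, hx, rfl, hA, hB⟩ := h
  obtain ⟨b, hb⟩ := (H.mk_eq_zero hz).1 hx.symm
  obtain ⟨u', w', h⟩ := S.exists_add_of_bdry_eq_add hb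
  have h1 : chainMap (n + 1) S.jA (u - bdry (n + 1) A u') =
      chainMap (n + 1) S.jB (bdry (n + 1) B w' - w) := by
    rw [map_sub, map_sub, sub_eq_sub_iff_add_eq_add, h, add_comm (chainMap _ S.jA _)]
  obtain ⟨e, heA, -⟩ := S.exists_chain_of_eq h1
  refine (H.mk_eq_zero hc).2 ⟨e, chainMap_injective S.embI.injective ?_⟩
  rw [chainMap_bdry, heA, map_sub, bdry_bdry, sub_zero, hA]

lemma Connects.unique {n : ℕ} {x : H (n + 1) X} {y y' : H n I} (h : S.Connects n x y)
    (h' : S.Connects n x y') : y = y' := by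
  have := h.add (h'.smul (-1))
  rw [neg_one_smul, neg_one_smul, add_neg_cancel] at this
  exact sub_eq_zero.1 ((sub_eq_add_neg y y').trans this.eq_zero)

variable (S)

/-- The connecting homomorphism of the Mayer-Vietoris sequence. -/
noncomputable def δ (n : ℕ) : H (n + 1) X →ₗ[ℚ] H n I where
  toFun x := (S.exists_connects n x).choose
  map_add' x y := (S.exists_connects n _).choose_spec.unique
    ((S.exists_connects n x).choose_spec.add (S.exists_connects n y).choose_spec)
  map_smul' a x := (S.exists_connects n _).choose_spec.unique
    ((S.exists_connects n x).choose_spec.smul a)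

variable {S}

lemma δ_eq_iff {n : ℕ} {x : H (n + 1) X} {y : H n I} : S.δ n x = y ↔ S.Connects n x y :=
  ⟨fun h => h ▸ (S.exists_connects n x).choose_spec,
    (S.exists_connects n x).choose_spec.unique⟩

variable (S)

lemma δ_jA {n : ℕ} (x : H (n + 1) A) : S.δ n (H.map (n + 1) S.jA x) = 0 := by
  induction x using H.ind with
  | h c hc =>
    refine δ_eq_iff.2 ⟨c, 0, 0, ?_, zero_mem _, ?_, rfl, ?_, by simp⟩
    · simpa using chainMap_mem_cycles S.jA hc
    · simp
    · rw [mem_cycles_succ.1 hc, map_zero]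

lemma iA_δ {n : ℕ} (x : H (n + 1) X) : H.map n S.iA (S.δ n x) = 0 := by
  obtain ⟨u, w, c, hz, hc, -, h, hA, hB⟩ := δ_eq_iff.1 (rfl : S.δ n x = _)
  rw [h, H.map_mk, H.mk_eq_zero]
  exact ⟨u, hA.symm⟩

lemma δ_symm {n : ℕ} (x : H (n + 1) X) : S.symm.δ n x = -S.δ n x := by
  refine δ_eq_iff.2 ?_
  obtain ⟨u, w, c, hz, hc, hx, h, hA, hB⟩ := δ_eq_iff.1 (rfl : S.δ n x = _)
  refine ⟨w, u, -c, add_comm (chainMap (n + 1) S.jA u) _ ▸ hz, neg_mem hc, ?_, ?_, ?_, ?_⟩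
  · rw [hx]; congr 1; exact add_comm _ _
  · rw [h, H.mk_neg]
  · rw [map_neg]; exact neg_eq_iff_eq_neg.2 hB
  · rw [map_neg]; exact congrArg _ hA

lemma δ_jB {n : ℕ} (x : H (n + 1) B) : S.δ n (H.map (n + 1) S.jB x) = 0 := by
  have := S.symm.δ_jA x
  rwa [δ_symm, neg_eq_zero] at this

lemma iB_δ {n : ℕ} (x : H (n + 1) X) : H.map n S.iB (S.δ n x) = 0 := by
  have := S.symm.iA_δ x
  rwa [δ_symm, map_neg, neg_eq_zero] at this

lemma exists_eq_add_of_δ_eq_zero {n : ℕ} {z : H (n + 1) X} (h : S.δ n z = 0) :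
    ∃ x y, H.map (n + 1) S.jA x + H.map (n + 1) S.jB y = z := by
  obtain ⟨u, w, c, hz, hc, rfl, h, hA, hB⟩ := δ_eq_iff.1 h
  obtain ⟨b, hb⟩ := (H.mk_eq_zero hc).1 h.symm
  have h1 : u - chainMap (n + 1) S.iA b ∈ cycles (n + 1) A := by
    rw [mem_cycles_succ, map_sub, ← chainMap_bdry, hb, hA, sub_self]
  have h2 : w + chainMap (n + 1) S.iB b ∈ cycles (n + 1) B := by
    rw [mem_cycles_succ, map_add, ← chainMap_bdry, hb, hB, add_neg_cancel]
  refine ⟨H.mk _ h1, H.mk _ h2, ?_⟩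
  rw [H.map_mk, H.map_mk, H.mk_add]
  congr 1
  rw [map_sub, map_add, S.chainMap_comm]
  abel

lemma exists_eq_add_zero (z : H 0 X) : ∃ x y, H.map 0 S.jA x + H.map 0 S.jB y = z := by
  induction z using H.ind with
  | h c hc =>
    obtain ⟨u, w, b, hb⟩ := S.exists_add_homologous hc
    exact ⟨H.mk u (by trivial), H.mk w (by trivial), ((H.mk_eq_mk hc (by trivial)).2 ⟨b, hb⟩).symm⟩

lemma exists_δ_eq {n : ℕ} {c : H n I} (hA : H.map n S.iA c = 0) (hB : H.map n S.iB c = 0) :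
    ∃ z, S.δ n z = c := by
  induction c using H.ind with
  | h c hc =>
    rw [H.map_mk, H.mk_eq_zero] at hA hB
    obtain ⟨u, hu⟩ := hA
    obtain ⟨w, hw⟩ := hB
    exact ⟨_, δ_eq_iff.2 (connects_mk (u := u) (w := -w) hu.symm (by rw [map_neg, neg_neg, hw]))⟩

lemma exists_of_jA_eq_jB {n : ℕ} {x : H n A} {y : H n B}
    (h : H.map n S.jA x = H.map n S.jB y) :
    ∃ c, H.map n S.iA c = x ∧ H.map n S.iB c = y := by
  induction x using H.ind with
  | h u hu =>
  induction y using H.ind with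
  | h w hw =>
    rw [H.map_mk, H.map_mk, H.mk_eq_mk] at h
    obtain ⟨b, hb⟩ := h
    rw [sub_eq_add_neg, ← map_neg] at hb
    obtain ⟨u', w', h'⟩ := S.exists_add_of_bdry_eq_add hb
    have h1 : chainMap n S.jA (u - bdry n A u') = chainMap n S.jB (w + bdry n B w') := by
      rw [map_neg] at h'
      rw [map_sub, map_add, sub_eq_iff_eq_add, add_assoc, add_comm (chainMap n S.jB (bdry n B w')),
        ← h']
      abel
    obtain ⟨c, hcA, hcB⟩ := S.exists_chain_of_eq h1
    have hc : c ∈ cycles n I := by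
      cases n with
      | zero => trivial
      | succ n =>
        rw [mem_cycles_succ]
        refine chainMap_injective S.embI.injective ?_
        rw [chainMap_bdry, hcA, map_sub, mem_cycles_succ.1 hu, bdry_bdry, sub_zero, map_zero]
    refine ⟨H.mk c hc, ?_, ?_⟩
    · rw [H.map_mk, H.mk_eq_mk]
      exact ⟨-u', by rw [hcA, map_neg]; abel⟩
    · rw [H.map_mk, H.mk_eq_mk]
      exact ⟨w', by rw [hcB]; abel⟩

/-- Naturality of the connecting homomorphism. -/
lemma δ_map {I' A' B' X' : Type} [TopologicalSpace I'] [TopologicalSpace A'] [TopologicalSpace B']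
    [TopologicalSpace X'] (S' : MVSquare I' A' B' X') {fI : C(I, I')} {fA : C(A, A')}
    {fB : C(B, B')} {fX : C(X, X')} (hiA : S'.iA.comp fI = fA.comp S.iA)
    (hiB : S'.iB.comp fI = fB.comp S.iB) (hjA : S'.jA.comp fA = fX.comp S.jA)
    (hjB : S'.jB.comp fB = fX.comp S.jB) {n : ℕ} (x : H (n + 1) X) :
    S'.δ n (H.map (n + 1) fX x) = H.map n fI (S.δ n x) := by
  obtain ⟨u, w, c, hz, hc, rfl, h, hA, hB⟩ := δ_eq_iff.1 (rfl : S.δ n x = _)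
  refine δ_eq_iff.2 ⟨chainMap (n + 1) fA u, chainMap (n + 1) fB w, chainMap n fI c, ?_,
    chainMap_mem_cycles fI hc, ?_, by rw [h]; rfl, ?_, ?_⟩
  · have := chainMap_mem_cycles fX hz
    rwa [map_add, ← chainMap_comp, ← chainMap_comp, ← hjA, ← hjB, chainMap_comp, chainMap_comp]
      at this
  · rw [H.map_mk]
    congr 1
    rw [map_add, ← chainMap_comp, ← chainMap_comp, ← hjA, ← hjB, chainMap_comp, chainMap_comp]
  · rw [← chainMap_comp, hiA, chainMap_comp, hA, chainMap_bdry]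
  · rw [← chainMap_comp, hiB, chainMap_comp, hB, map_neg, chainMap_bdry]

end MVSquare

end RatHomology

namespace RatHomology

open Topology

section Equivalences

variable {X Y : Type} [TopologicalSpace X] [TopologicalSpace Y]

lemma H.bijective_of_homotopic {f : C(X, Y)} {g : C(Y, X)}
    (h : (g.comp f).Homotopic (ContinuousMap.id X)) (h' : (f.comp g).Homotopic (ContinuousMap.id Y))
    (n : ℕ) : Function.Bijective (H.map n f) := by
  refine Function.bijective_iff_has_inverse.2 ⟨H.map n g, fun x => ?_, fun y => ?_⟩
  · rw [H.map_map, H.map_eq_of_homotopic h, H.map_id]; rfl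
  · rw [H.map_map, H.map_eq_of_homotopic h', H.map_id]; rfl

lemma H.bijective_of_homeomorph (e : X ≃ₜ Y) (n : ℕ) :
    Function.Bijective (H.map n (e : C(X, Y))) := by
  refine H.bijective_of_homotopic (g := (e.symm : C(Y, X))) ?_ ?_ n
  · rw [Homeomorph.symm_comp_toContinuousMap]
  · rw [Homeomorph.toContinuousMap_comp_symm]

lemma homotopic_of_continuous {f g : C(X, Y)} (F : unitInterval × X → Y) (hF : Continuous F)
    (h0 : ∀ x, F (0, x) = f x) (h1 : ∀ x, F (1, x) = g x) : f.Homotopic g :=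
  ⟨⟨⟨F, hF⟩, h0, h1⟩⟩

lemma H.eq_zero_of_isEmpty [IsEmpty X] {n : ℕ} (x : H n X) : x = 0 := by
  induction x using H.ind with
  | h c hc =>
    have : IsEmpty (Sing n X) := ⟨fun σ => isEmptyElim (σ (stdSimplex.vertex 0))⟩
    exact (H.mk_eq_zero hc).2 ⟨0, Subsingleton.elim _ _⟩

end Equivalences

namespace MVSquare

/-- The square of an open cover by two sets. -/
def ofOpens {X : Type} [TopologicalSpace X] {U W : Set X} (hU : IsOpen U) (hW : IsOpen W)
    (h : ∀ x, x ∈ U ∨ x ∈ W) : MVSquare (U ∩ W : Set X) U W X where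
  iA := ⟨fun x => ⟨x, x.2.1⟩, by fun_prop⟩
  iB := ⟨fun x => ⟨x, x.2.2⟩, by fun_prop⟩
  jA := ⟨Subtype.val, continuous_subtype_val⟩
  jB := ⟨Subtype.val, continuous_subtype_val⟩
  comm := rfl
  openA := hU.isOpenEmbedding_subtypeVal
  openB := hW.isOpenEmbedding_subtypeVal
  embI := IsEmbedding.inclusion Set.inter_subset_left
  cover x := (h x).imp (fun hx => ⟨⟨x, hx⟩, rfl⟩) (fun hx => ⟨⟨x, hx⟩, rfl⟩)
  inter := by
    rintro ⟨a, ha⟩ ⟨b, hb⟩ rfl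
    exact ⟨⟨a, ha, hb⟩, rfl⟩

section Suspension

variable {I A B X V : Type} [TopologicalSpace I] [TopologicalSpace A] [TopologicalSpace B]
  [TopologicalSpace X] [TopologicalSpace V] (S : MVSquare I A B X) {p : C(X, V)}
  (hA : ∀ n, Function.Bijective (H.map n (p.comp S.jA)))
  (hB : ∀ n, Function.Bijective (H.map n (p.comp S.jB)))
  (hq : ∀ n, Function.Surjective (H.map n ((p.comp S.jA).comp S.iA)))

include hA hB hq in
lemma eq_zero_of_eq_add {n : ℕ} {z : H n X} (hz : H.map n p z = 0)
    (h : ∃ x y, H.map n S.jA x + H.map n S.jB y = z) : z = 0 := by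
  obtain ⟨x, y, rfl⟩ := h
  obtain ⟨c, hc⟩ := hq n (H.map n (p.comp S.jA) x)
  rw [← H.map_map] at hc
  rw [← (hA n).1 hc, S.map_comm, ← map_add] at hz ⊢
  rw [H.map_map] at hz
  rw [(map_eq_zero_iff _ (hB n).1).1 hz, map_zero]

include hA hB hq in
lemma eq_zero_of_map_eq_zero {z : H 0 X} (hz : H.map 0 p z = 0) : z = 0 :=
  S.eq_zero_of_eq_add hA hB hq hz (S.exists_eq_add_zero z)

include hA hB hq in
lemma eq_zero_of_δ_eq_zero {n : ℕ} {z : H (n + 1) X} (hz : H.map (n + 1) p z = 0)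
    (h : S.δ n z = 0) : z = 0 :=
  S.eq_zero_of_eq_add hA hB hq hz (S.exists_eq_add_of_δ_eq_zero h)

lemma map_δ {n : ℕ} (z : H (n + 1) X) : H.map n ((p.comp S.jA).comp S.iA) (S.δ n z) = 0 := by
  rw [← H.map_map, iA_δ, map_zero]

include hA hB in
lemma exists_δ_eq_of_map_eq_zero {n : ℕ} {c : H n I}
    (h : H.map n ((p.comp S.jA).comp S.iA) c = 0) :
    ∃ z, H.map (n + 1) p z = 0 ∧ S.δ n z = c := by
  have h1 : H.map n S.iA c = 0 := by
    rw [← H.map_map] at h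
    exact (map_eq_zero_iff _ (hA n).1).1 h
  have h2 : H.map n S.iB c = 0 := by
    rw [ContinuousMap.comp_assoc, S.comm, ← ContinuousMap.comp_assoc, ← H.map_map] at h
    exact (map_eq_zero_iff _ (hB n).1).1 h
  obtain ⟨z, rfl⟩ := S.exists_δ_eq h1 h2
  obtain ⟨x, hx⟩ := (hA (n + 1)).2 (H.map (n + 1) p z)
  refine ⟨z - H.map (n + 1) S.jA x, ?_, ?_⟩
  · rw [map_sub, H.map_map, hx, sub_self]
  · rw [map_sub, δ_jA, sub_zero]

/-- The connecting homomorphism of a fibrewise suspension is an isomorphism on kernels. -/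
noncomputable def suspEquiv (n : ℕ) : LinearMap.ker (H.map (n + 1) p) ≃ₗ[ℚ]
    LinearMap.ker (H.map n ((p.comp S.jA).comp S.iA)) :=
  LinearEquiv.ofBijective ((S.δ n).restrict fun z _ => S.map_δ z) <| by
    constructor
    · refine (injective_iff_map_eq_zero _).2 fun z hz => ?_
      exact Subtype.ext (S.eq_zero_of_δ_eq_zero hA hB hq z.2 (congrArg Subtype.val hz))
    · rintro ⟨c, hc⟩
      obtain ⟨z, hz, rfl⟩ := S.exists_δ_eq_of_map_eq_zero hA hB hc
      exact ⟨⟨z, hz⟩, rfl⟩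

end Suspension

end MVSquare

end RatHomology

namespace RatHomology

open Topology

/-- The nonzero vectors of a vector space. -/
abbrev Punctured (L : Type) [Zero L] : Type := {w : L // w ≠ 0}

section Punctured

variable (V : Type) [TopologicalSpace V] (L : Type) [NormedAddCommGroup L] [NormedSpace ℝ L]

/-- The projection from the trivial bundle of nonzero vectors. -/
def prP : C(V × Punctured L, V) := ⟨Prod.fst, continuous_fst⟩

/-- The fibrewise antipodal map. -/
def negP : C(V × Punctured L, V × Punctured L) :=
  ⟨fun x => (x.1, ⟨-x.2.1, neg_ne_zero.2 x.2.2⟩), by fun_prop⟩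

/-- The homology of a trivial bundle of nonzero vectors of rank `r`. -/
structure FibreHomology (r : ℕ) : Prop where
  neg : ∀ n x, H.map n (prP V L) x = 0 → H.map n (negP V L) x = (-1 : ℚ) ^ r • x
  low : ∀ n, n + 1 < r → ∀ x, H.map n (prP V L) x = 0 → x = 0
  equiv : ∀ n k, n + 1 = k + r → Nonempty (LinearMap.ker (H.map n (prP V L)) ≃ₗ[ℚ] H k V)

variable {V L}

/-- The constant section. -/
def secP (w : Punctured L) : C(V, V × Punctured L) := ⟨fun v => (v, w), by fun_prop⟩

lemma prP_secP (w : Punctured L) {n : ℕ} (x : H n V) :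
    H.map n (prP V L) (H.map n (secP w) x) = x := by
  rw [H.map_map]
  exact LinearMap.congr_fun (H.map_id n) x

lemma prP_surjective [Nontrivial L] (n : ℕ) : Function.Surjective (H.map n (prP V L)) := by
  obtain ⟨w, hw⟩ := exists_ne (0 : L)
  exact fun x => ⟨_, prP_secP ⟨w, hw⟩ x⟩

variable {M : Type} [NormedAddCommGroup M] [NormedSpace ℝ M]

lemma FibreHomology.congr (e : L ≃L[ℝ] M) {r : ℕ} (h : FibreHomology V L r) :
    FibreHomology V M r := by
  let f : C(V × Punctured L, V × Punctured M) :=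
    ⟨fun x => (x.1, ⟨e x.2.1, by simpa using x.2.2⟩), by fun_prop⟩
  let g : C(V × Punctured M, V × Punctured L) :=
    ⟨fun x => (x.1, ⟨e.symm x.2.1, by simpa using x.2.2⟩), by fun_prop⟩
  have hgf : g.comp f = ContinuousMap.id _ := by ext x <;> simp [f, g]
  have hfg : f.comp g = ContinuousMap.id _ := by ext x <;> simp [f, g]
  have hgf' {n} (x) : H.map n g (H.map n f x) = x := by rw [H.map_map, hgf, H.map_id]; rfl
  have hfg' {n} (x) : H.map n f (H.map n g x) = x := by rw [H.map_map, hfg, H.map_id]; rfl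
  have hp {n} (x) : H.map n (prP V L) (H.map n g x) = H.map n (prP V M) x := by
    rw [H.map_map]; rfl
  have hp' {n} (x) : H.map n (prP V M) (H.map n f x) = H.map n (prP V L) x := by
    rw [H.map_map]; rfl
  have hneg : (negP V M).comp f = f.comp (negP V L) := by
    refine ContinuousMap.ext fun x => ?_
    refine Prod.ext rfl (Subtype.ext ?_)
    exact (map_neg e _).symm
  refine ⟨fun n x hx => ?_, fun n hn x hx => ?_, fun n k hnk => ?_⟩
  · rw [← hfg' x, H.map_map, hneg, ← H.map_map, h.neg n _ (by rwa [hp]), map_smul]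
  · rw [← hfg' x, h.low n hn (H.map n g x) (by rwa [hp]), map_zero]
  · obtain ⟨E⟩ := h.equiv n k hnk
    have E' : LinearMap.ker (H.map n (prP V M)) ≃ₗ[ℚ] LinearMap.ker (H.map n (prP V L)) :=
      LinearEquiv.ofLinearMap
      ((H.map n g).restrict fun x hx => by rw [LinearMap.mem_ker, hp]; exact hx)
      ((H.map n f).restrict fun x hx => by rw [LinearMap.mem_ker, hp']; exact hx)
      (LinearMap.ext fun x => Subtype.ext (hgf' _)) (LinearMap.ext fun x => Subtype.ext (hfg' _))
    exact ⟨E'.trans E⟩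

end Punctured

section Line

variable (V : Type) [TopologicalSpace V]

/-- The vectors of positive last coordinate, or nonzero first coordinate. -/
def coneSet (M : Type) [NormedAddCommGroup M] (s : ℝ) : Set (V × Punctured (M × ℝ)) :=
  {x | x.2.1.1 ≠ 0 ∨ 0 < s * x.2.1.2}

/-- The common part of the two cones. -/
abbrev coneInter (M : Type) [NormedAddCommGroup M] : Set (V × Punctured (M × ℝ)) :=
  coneSet V M 1 ∩ coneSet V M (-1)

variable {V} {M : Type} [NormedAddCommGroup M] [NormedSpace ℝ M]

lemma isOpen_coneSet (s : ℝ) : IsOpen (coneSet V M s) :=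
  (isOpen_ne_fun (f := fun x : V × Punctured (M × ℝ) => x.2.1.1) (by fun_prop)
    continuous_const).union (isOpen_lt (g := fun x : V × Punctured (M × ℝ) => s * x.2.1.2)
    continuous_const (by fun_prop))

lemma coneSet_cover (x : V × Punctured (M × ℝ)) : x ∈ coneSet V M 1 ∨ x ∈ coneSet V M (-1) := by
  by_cases h : x.2.1.1 = 0
  · have h2 : x.2.1.2 ≠ 0 := fun h2 => x.2.2 (Prod.ext h h2)
    rcases h2.lt_or_gt with h2 | h2
    · exact Or.inr (Or.inr (by linarith))
    · exact Or.inl (Or.inr (by linarith))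
  · exact Or.inl (Or.inl h)

lemma bijective_coneSet {s : ℝ} (hs : s * s = 1) (n : ℕ) :
    Function.Bijective (H.map n ((prP V (M × ℝ)).comp
      (⟨Subtype.val, continuous_subtype_val⟩ : C(coneSet V M s, _)))) := by
  have hs0 : s ≠ 0 := by rintro rfl; simp at hs
  let g : C(V, coneSet V M s) :=
    ⟨fun v => ⟨(v, ⟨(0, s), fun h => hs0 (congrArg Prod.snd h)⟩), Or.inr (by simp [hs])⟩,
      by fun_prop⟩
  have hmem : ∀ (t : unitInterval) (x : coneSet V M s),
      (1 - (t : ℝ)) • x.1.2.1.1 ≠ 0 ∨ 0 < s * ((1 - t) * x.1.2.1.2 + t * s) := by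
    rintro t ⟨⟨v, w⟩, hx⟩
    have he : s * ((1 - t) * w.1.2 + t * s) = (1 - t) * (s * w.1.2) + t := by
      linear_combination (t : ℝ) * hs
    rw [he]
    have h0 := t.2.1
    have h1 := t.2.2
    rcases h1.eq_or_lt with h1 | h1
    · exact Or.inr (by rw [h1]; simp)
    rcases hx with hx | hx
    · exact Or.inl (smul_ne_zero (by linarith) hx)
    · have := mul_pos (sub_pos.2 h1) hx
      exact Or.inr (by linarith)
  refine H.bijective_of_homotopic (g := g) (.symm ?_) (.refl _) n
  have hne : ∀ y : unitInterval × coneSet V M s,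
      ((1 - (y.1 : ℝ)) • y.2.1.2.1.1, (1 - (y.1 : ℝ)) * y.2.1.2.1.2 + y.1 * s) ≠ (0 : M × ℝ) := by
    intro y h
    rcases hmem y.1 y.2 with h' | h'
    · exact h' (congrArg Prod.fst h)
    · rw [show (1 - (y.1 : ℝ)) * y.2.1.2.1.2 + y.1 * s = 0 from congrArg Prod.snd h] at h'
      simp at h'
  refine homotopic_of_continuous (fun y : unitInterval × coneSet V M s =>
    ⟨(y.2.1.1, ⟨_, hne y⟩), hmem y.1 y.2⟩)
    (.subtype_mk (.prodMk (by fun_prop) (.subtype_mk (by fun_prop) _)) _) ?_ ?_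
  · rintro ⟨⟨v, w⟩, hx⟩
    ext <;> simp
  · rintro ⟨⟨v, w⟩, hx⟩
    ext <;> simp [g, prP]

lemma coneInter_fst_ne_zero (x : coneInter (V := V) M) : x.1.2.1.1 ≠ 0 := by
  rcases x.2 with ⟨h | h, h' | h'⟩
  · exact h
  · exact h
  · exact h'
  · linarith

/-- The projection of the common part of the two cones. -/
def coneInterProj (V : Type) [TopologicalSpace V] (M : Type) [NormedAddCommGroup M]
    [NormedSpace ℝ M] : C(coneInter (V := V) M, V × Punctured M) :=
  ⟨fun x => (x.1.1, ⟨x.1.2.1.1, coneInter_fst_ne_zero x⟩),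
    .prodMk (by fun_prop) (.subtype_mk (by fun_prop) _)⟩

lemma bijective_coneInterProj (n : ℕ) : Function.Bijective (H.map n (coneInterProj V M)) := by
  let g : C(V × Punctured M, coneInter (V := V) M) :=
    ⟨fun x => ⟨(x.1, ⟨(x.2.1, 0), fun h => x.2.2 (congrArg Prod.fst h)⟩),
      Or.inl x.2.2, Or.inl x.2.2⟩,
      .subtype_mk (.prodMk (by fun_prop) (.subtype_mk (by fun_prop) _)) _⟩
  refine H.bijective_of_homotopic (g := g) (.symm ?_) (.refl _) n
  refine homotopic_of_continuous (fun y : unitInterval × coneInter (V := V) M =>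
    ⟨(y.2.1.1, ⟨(y.2.1.2.1.1, (1 - (y.1 : ℝ)) * y.2.1.2.1.2),
      fun h => coneInter_fst_ne_zero y.2 (congrArg Prod.fst h)⟩),
      Or.inl (coneInter_fst_ne_zero y.2), Or.inl (coneInter_fst_ne_zero y.2)⟩)
    (.subtype_mk (.prodMk (by fun_prop) (.subtype_mk (by fun_prop) _)) _) ?_ ?_
  · rintro ⟨⟨v, w⟩, hx⟩
    ext <;> simp
  · rintro ⟨⟨v, w⟩, hx⟩
    ext <;> simp [g, coneInterProj]

/-- The suspension square of a trivial bundle of nonzero vectors. -/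
def coneSquare (V : Type) [TopologicalSpace V] (M : Type) [NormedAddCommGroup M]
    [NormedSpace ℝ M] :
    MVSquare (coneInter (V := V) M) (coneSet V M 1) (coneSet V M (-1)) (V × Punctured (M × ℝ)) :=
  .ofOpens (isOpen_coneSet 1) (isOpen_coneSet (-1)) coneSet_cover

/-- The antipodal map between the two cones. -/
def negCone (s s' : ℝ) (h : s' = -s) : C(coneSet V M s, coneSet V M s') :=
  ⟨fun x => ⟨negP V (M × ℝ) x.1, by
    rcases x.2 with hx | hx
    · exact Or.inl (neg_ne_zero.2 hx)
    · exact Or.inr (by simpa [negP, h] using hx)⟩, by fun_prop⟩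

/-- The antipodal map on the common part of the two cones. -/
def negConeInter : C(coneInter (V := V) M, coneInter (V := V) M) :=
  ⟨fun x => ⟨negP V (M × ℝ) x.1, Or.inl (neg_ne_zero.2 (coneInter_fst_ne_zero x)),
    Or.inl (neg_ne_zero.2 (coneInter_fst_ne_zero x))⟩, by fun_prop⟩

lemma FibreHomology.succ [Nontrivial M] {r : ℕ} (h : FibreHomology V M (r + 1)) :
    FibreHomology V (M × ℝ) (r + 2) := by
  let S := coneSquare V M
  have hA : ∀ n, Function.Bijective (H.map n ((prP V (M × ℝ)).comp S.jA)) :=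
    bijective_coneSet (by norm_num)
  have hB : ∀ n, Function.Bijective (H.map n ((prP V (M × ℝ)).comp S.jB)) :=
    bijective_coneSet (by norm_num)
  have hI : ((prP V (M × ℝ)).comp S.jA).comp S.iA = (prP V M).comp (coneInterProj V M) := rfl
  have hq : ∀ n, Function.Surjective (H.map n (((prP V (M × ℝ)).comp S.jA).comp S.iA)) := by
    intro n
    rw [hI, H.map_comp]
    exact (prP_surjective n).comp (bijective_coneInterProj n).2
  have hker : ∀ n x, H.map n (((prP V (M × ℝ)).comp S.jA).comp S.iA) x = 0 ↔
      H.map n (prP V M) (H.map n (coneInterProj V M) x) = 0 := by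
    intro n x
    rw [hI, ← H.map_map]
  have hnegI : (negP V M).comp (coneInterProj V M) = (coneInterProj V M).comp negConeInter := rfl
  refine ⟨fun n x hx => ?_, fun n hn x hx => ?_, fun n k hnk => ?_⟩
  · cases n with
    | zero => rw [S.eq_zero_of_map_eq_zero hA hB hq hx]; simp
    | succ n =>
      rw [← sub_eq_zero]
      refine S.eq_zero_of_δ_eq_zero hA hB hq ?_ ?_
      · rw [map_sub, map_smul, hx, smul_zero, sub_zero, H.map_map]
        exact hx
      · have h1 := S.δ_map S.symm (fI := negConeInter) (fA := negCone 1 (-1) rfl)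
          (fB := negCone (-1) 1 (by simp)) (fX := negP V (M × ℝ)) rfl rfl rfl rfl x
        rw [S.δ_symm, neg_eq_iff_eq_neg] at h1
        rw [map_sub, h1, map_smul, sub_eq_zero]
        apply (bijective_coneInterProj n).1
        rw [map_neg, H.map_map, ← hnegI, ← H.map_map, h.neg n _ ((hker n _).1 (S.map_δ x)),
          map_smul, pow_succ _ (r + 1), mul_neg_one, neg_smul]
  · cases n with
    | zero => exact S.eq_zero_of_map_eq_zero hA hB hq hx
    | succ n =>
      refine S.eq_zero_of_δ_eq_zero hA hB hq hx ((bijective_coneInterProj n).1 ?_)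
      rw [h.low n (by omega) _ ((hker n _).1 (S.map_δ x)), map_zero]
  · obtain _ | n := n
    · omega
    obtain ⟨E⟩ := h.equiv n k (by omega)
    have e : LinearMap.ker (H.map n (((prP V (M × ℝ)).comp S.jA).comp S.iA)) ≃ₗ[ℚ]
        LinearMap.ker (H.map n (prP V M)) := LinearEquiv.ofBijective ((H.map n (coneInterProj V M)).restrict
      fun x hx => (hker n x).1 hx) <| by
        refine ⟨fun x y hxy => ?_, fun y => ?_⟩
        · exact Subtype.ext ((bijective_coneInterProj n).1 (congrArg Subtype.val hxy))
        · obtain ⟨x, hx⟩ := (bijective_coneInterProj n).2 y.1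
          exact ⟨⟨x, (hker n x).2 (by rw [hx]; exact y.2)⟩, Subtype.ext hx⟩
    exact ⟨((S.suspEquiv hA hB hq n).trans e).trans E⟩

/-- The half-lines of a trivial real line bundle. -/
def halfSet (V : Type) (s : ℝ) : Set (V × Punctured ℝ) := {x | 0 < s * x.2.1}

lemma isOpen_halfSet (s : ℝ) : IsOpen (halfSet V s) :=
  isOpen_lt (g := fun x : V × Punctured ℝ => s * x.2.1) continuous_const (by fun_prop)

lemma halfSet_cover (x : V × Punctured ℝ) : x ∈ halfSet V 1 ∨ x ∈ halfSet V (-1) := by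
  rcases x.2.2.lt_or_gt with h | h
  · exact Or.inr (by change 0 < -1 * x.2.1; linarith)
  · exact Or.inl (by change 0 < 1 * x.2.1; linarith)

/-- The points `±1` of the line. -/
def halfPt (s : ℝ) (hs : s * s = 1) : Punctured ℝ := ⟨s, by rintro rfl; simp at hs⟩

lemma halfPt_eq {s : ℝ} (hs : s * s = 1) {n : ℕ} (x : H n (halfSet V s)) :
    H.map n (secP (halfPt s hs)) (H.map n ((prP V ℝ).comp
      (⟨Subtype.val, continuous_subtype_val⟩ : C(halfSet V s, _))) x) =
      H.map n ⟨Subtype.val, continuous_subtype_val⟩ x := by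
  rw [H.map_map]
  have hne : ∀ y : unitInterval × halfSet V s, (1 - (y.1 : ℝ)) * s + y.1 * y.2.1.2.1 ≠ 0 := by
    rintro ⟨t, ⟨⟨v, w⟩, hx⟩⟩ h
    have hx' : 0 < s * w.1 := hx
    change (1 - (t : ℝ)) * s + t * w.1 = 0 at h
    have h0 := t.2.1
    have h1 := t.2.2
    have h2 : (1 - (t : ℝ)) + t * (s * w.1) = 0 := by
      linear_combination s * h - (1 - (t : ℝ)) * hs
    rcases h0.eq_or_lt with h0 | h0
    · rw [← h0] at h2; simp at h2
    · have := mul_pos h0 hx'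
      linarith
  refine LinearMap.congr_fun (H.map_congr_of_continuous (fun y : unitInterval × halfSet V s =>
    ((y.2.1.1, ⟨_, hne y⟩) : V × Punctured ℝ)) (.prodMk (by fun_prop) (.subtype_mk (by fun_prop) _)) ?_ ?_ n) x
  · rintro ⟨⟨v, w⟩, hx⟩
    ext <;> simp [secP, prP, halfPt]
  · rintro ⟨⟨v, w⟩, hx⟩
    ext <;> simp

lemma halfPt_split {n : ℕ} (z : H n (V × Punctured ℝ)) :
    ∃ x y, H.map n (secP (halfPt 1 (by norm_num))) x +
      H.map n (secP (halfPt (-1) (by norm_num))) y = z := by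
  let S := MVSquare.ofOpens (isOpen_halfSet (V := V) 1) (isOpen_halfSet (-1)) halfSet_cover
  have : IsEmpty (halfSet V 1 ∩ halfSet V (-1) : Set (V × Punctured ℝ)) := by
    refine ⟨fun x => ?_⟩
    have h1 : 0 < 1 * x.1.2.1 := x.2.1
    have h2 : 0 < -1 * x.1.2.1 := x.2.2
    linarith
  obtain ⟨x, y, h⟩ : ∃ x y, H.map n S.jA x + H.map n S.jB y = z := by
    cases n with
    | zero => exact S.exists_eq_add_zero z
    | succ n => exact S.exists_eq_add_of_δ_eq_zero (H.eq_zero_of_isEmpty _)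
  exact ⟨_, _, (congrArg₂ (· + ·) (halfPt_eq (by norm_num) x) (halfPt_eq (by norm_num) y)).trans h⟩

lemma eq_zero_of_halfPt_eq {n : ℕ} {x : H n V} (h : H.map n (secP (halfPt 1 (by norm_num))) x =
    H.map n (secP (halfPt (-1) (by norm_num))) x) : x = 0 := by
  let S := MVSquare.ofOpens (isOpen_halfSet (V := V) 1) (isOpen_halfSet (-1)) halfSet_cover
  have : IsEmpty (halfSet V 1 ∩ halfSet V (-1) : Set (V × Punctured ℝ)) := by
    refine ⟨fun x => ?_⟩
    have h1 : 0 < 1 * x.1.2.1 := x.2.1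
    have h2 : 0 < -1 * x.1.2.1 := x.2.2
    linarith
  let g (s : ℝ) (hs : s * s = 1) : C(V, halfSet V s) :=
    ⟨fun v => ⟨(v, halfPt s hs), by change 0 < s * s; rw [hs]; norm_num⟩, by fun_prop⟩
  obtain ⟨c, hc, -⟩ := S.exists_of_jA_eq_jB (n := n) (x := H.map n (g 1 (by norm_num)) x)
    (y := H.map n (g (-1) (by norm_num)) x) (by rw [H.map_map, H.map_map]; exact h)
  rw [H.eq_zero_of_isEmpty c, map_zero] at hc
  rw [← prP_secP (halfPt 1 (by norm_num)) x]
  have := congrArg (H.map n ((prP V ℝ).comp S.jA)) hc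
  rw [map_zero, H.map_map] at this
  rw [H.map_map]
  exact this.symm

lemma fibreHomology_real : FibreHomology V ℝ 1 := by
  have hneg : (negP V ℝ).comp (secP (halfPt 1 (by norm_num))) = secP (halfPt (-1) (by norm_num)) :=
    rfl
  have hneg' : (negP V ℝ).comp (secP (halfPt (-1) (by norm_num))) = secP (halfPt 1 (by norm_num)) :=
    ContinuousMap.ext fun v => Prod.ext rfl (Subtype.ext (neg_neg (1 : ℝ)))
  have key {n} (z) (hz : H.map n (prP V ℝ) z = 0) : ∃ x, z = H.map n (secP (halfPt 1 (by norm_num)))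
      x - H.map n (secP (halfPt (-1) (by norm_num))) x := by
    obtain ⟨x, y, rfl⟩ := halfPt_split z
    rw [map_add, prP_secP, prP_secP] at hz
    obtain rfl := eq_neg_of_add_eq_zero_right hz
    exact ⟨x, by rw [map_neg, sub_eq_add_neg]⟩
  refine ⟨fun n x hx => ?_, fun n hn => by omega, fun n k hnk => ?_⟩
  · obtain ⟨x, rfl⟩ := key x hx
    rw [map_sub, H.map_map, H.map_map, hneg, hneg']
    simp
  · obtain rfl : n = k := by omega
    refine ⟨(LinearEquiv.ofBijective (((H.map n (secP (halfPt 1 (by norm_num)))) -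
      (H.map n (secP (halfPt (-1) (by norm_num))))).codRestrict (LinearMap.ker (H.map n (prP V ℝ)))
        fun x => ?_) ⟨?_, ?_⟩).symm⟩
    · refine (injective_iff_map_eq_zero _).2 fun x hx => eq_zero_of_halfPt_eq (V := V) ?_
      exact sub_eq_zero.1 (congrArg Subtype.val hx)
    · rintro ⟨z, hz⟩
      obtain ⟨x, rfl⟩ := key z hz
      exact ⟨x, rfl⟩
    · rw [LinearMap.mem_ker, LinearMap.sub_apply, map_sub, prP_secP, prP_secP, sub_self]

theorem fibreHomology (V : Type) [TopologicalSpace V] {L : Type} [NormedAddCommGroup L] [NormedSpace ℝ L] [FiniteDimensional ℝ L]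
    {r : ℕ} (hr : Module.finrank ℝ L = r + 1) : FibreHomology V L (r + 1) := by
  induction r generalizing L with
  | zero =>
    exact fibreHomology_real.congr
      (ContinuousLinearEquiv.ofFinrankEq (by rw [hr, Module.finrank_self]))
  | succ r ih =>
    exact (ih (L := Fin (r + 1) → ℝ) (by simp)).succ.congr
      (ContinuousLinearEquiv.ofFinrankEq (by rw [hr]; simp))

end Line

end RatHomology

namespace RatHomology

open Topology

lemma eq_zero_of_eq_neg {M : Type*} [AddCommGroup M] [Module ℚ M] {x : M} (h : x = -x) :
    x = 0 := by
  have h2 : (2 : ℚ) • x = 0 := by rw [two_smul, ← eq_neg_iff_add_eq_zero]; exact h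
  exact (smul_eq_zero.1 h2).resolve_left two_ne_zero

/-- The square of the union of two open sets. -/
def MVSquare.ofUnion {X : Type} [TopologicalSpace X] {U W : Set X} (hU : IsOpen U)
    (hW : IsOpen W) : MVSquare (U ∩ W : Set X) U W (U ∪ W : Set X) where
  iA := ⟨fun x => ⟨x, x.2.1⟩, by fun_prop⟩
  iB := ⟨fun x => ⟨x, x.2.2⟩, by fun_prop⟩
  jA := ⟨fun x => ⟨x, Or.inl x.2⟩, by fun_prop⟩
  jB := ⟨fun x => ⟨x, Or.inr x.2⟩, by fun_prop⟩
  comm := rfl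
  openA := .inclusion Set.subset_union_left (hU.preimage continuous_subtype_val)
  openB := .inclusion Set.subset_union_right (hW.preimage continuous_subtype_val)
  embI := IsEmbedding.inclusion Set.inter_subset_left
  cover x := x.2.imp (fun hx => ⟨⟨x, hx⟩, rfl⟩) (fun hx => ⟨⟨x, hx⟩, rfl⟩)
  inter := by
    rintro ⟨a, ha⟩ ⟨b, hb⟩ h
    obtain rfl : a = b := congrArg Subtype.val h
    exact ⟨⟨a, ha, hb⟩, rfl⟩

section Bundle

variable {E G : Type} [TopologicalSpace E] [TopologicalSpace G]

/-- A map over a base together with a fibre-preserving involution. -/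
structure InvBundle (E G : Type) [TopologicalSpace E] [TopologicalSpace G] where
  p : C(E, G)
  a : C(E, E)
  p_a : ∀ x, p (a x) = p x
  a_a : ∀ x, a (a x) = x

namespace InvBundle

variable (b : InvBundle E G)

/-- The restriction of the projection to an open part of the base. -/
def pOn (U : Set G) : C(b.p ⁻¹' U, U) := ⟨fun x => ⟨b.p x, x.2⟩, by fun_prop⟩

/-- The restriction of the involution to an open part of the base. -/
def aOn (U : Set G) : C(b.p ⁻¹' U, b.p ⁻¹' U) :=
  ⟨fun x => ⟨b.a x, by rw [Set.mem_preimage, b.p_a]; exact x.2⟩, by fun_prop⟩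

lemma aOn_aOn (U : Set G) {n : ℕ} (x : H n (b.p ⁻¹' U)) :
    H.map n (b.aOn U) (H.map n (b.aOn U) x) = x := by
  have : (b.aOn U).comp (b.aOn U) = ContinuousMap.id _ :=
    ContinuousMap.ext fun x => Subtype.ext (b.a_a x)
  rw [H.map_map, this, H.map_id]
  rfl

lemma pOn_aOn (U : Set G) {n : ℕ} (x : H n (b.p ⁻¹' U)) :
    H.map n (b.pOn U) (H.map n (b.aOn U) x) = H.map n (b.pOn U) x := by
  have : (b.pOn U).comp (b.aOn U) = b.pOn U := ContinuousMap.ext fun x => Subtype.ext (b.p_a x)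
  rw [H.map_map, this]

/-- The projection is surjective in homology and the involution is `-1` on its kernel. -/
def OddOn (U : Set G) : Prop := ∀ n, Function.Surjective (H.map n (b.pOn U)) ∧
  ∀ x, H.map n (b.pOn U) x = 0 → H.map n (b.aOn U) x = -x

/-- The involution is trivial in homology. -/
def EvenOn (U : Set G) : Prop := ∀ n x, H.map n (b.aOn U) x = x

variable {b}

lemma OddOn.exists_fixed {U : Set G} (h : b.OddOn U) {n : ℕ} (y : H n U) :
    ∃ x, H.map n (b.pOn U) x = y ∧ H.map n (b.aOn U) x = x := by
  obtain ⟨x, rfl⟩ := (h n).1 y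
  refine ⟨(2⁻¹ : ℚ) • (x + H.map n (b.aOn U) x), ?_, ?_⟩
  · rw [map_smul, map_add, pOn_aOn, ← two_smul ℚ, smul_smul]; norm_num
  · rw [map_smul, map_add, aOn_aOn]; exact congrArg _ (add_comm _ _)

lemma OddOn.eq_zero {U : Set G} (h : b.OddOn U) {n : ℕ} {x : H n (b.p ⁻¹' U)}
    (hp : H.map n (b.pOn U) x = 0) (ha : H.map n (b.aOn U) x = x) : x = 0 := by
  have := (h n).2 x hp
  rw [ha] at this
  exact eq_zero_of_eq_neg this

variable (b)

/-- The Mayer-Vietoris square in the base. -/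
abbrev sqBase {U W : Set G} (hU : IsOpen U) (hW : IsOpen W) :
    MVSquare (U ∩ W : Set G) U W (U ∪ W : Set G) := .ofUnion hU hW

/-- The Mayer-Vietoris square in the total space. -/
abbrev sqTotal {U W : Set G} (hU : IsOpen U) (hW : IsOpen W) :
    MVSquare (b.p ⁻¹' (U ∩ W)) (b.p ⁻¹' U) (b.p ⁻¹' W) (b.p ⁻¹' (U ∪ W)) :=
  .ofUnion (hU.preimage b.p.continuous) (hW.preimage b.p.continuous)

section Cover

variable {b} {U W : Set G} (hU : IsOpen U) (hW : IsOpen W)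

include hU hW

lemma δ_pOn {n : ℕ} (x : H (n + 1) (b.p ⁻¹' (U ∪ W))) :
    (sqBase hU hW).δ n (H.map (n + 1) (b.pOn _) x) =
      H.map n (b.pOn _) ((b.sqTotal hU hW).δ n x) :=
  MVSquare.δ_map _ _ (fI := b.pOn (U ∩ W)) (fA := b.pOn U) (fB := b.pOn W) rfl rfl rfl rfl x

lemma δ_aOn {n : ℕ} (x : H (n + 1) (b.p ⁻¹' (U ∪ W))) :
    (b.sqTotal hU hW).δ n (H.map (n + 1) (b.aOn _) x) =
      H.map n (b.aOn _) ((b.sqTotal hU hW).δ n x) :=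
  MVSquare.δ_map _ _ (fI := b.aOn (U ∩ W)) (fA := b.aOn U) (fB := b.aOn W) rfl rfl rfl rfl x

lemma EvenOn.union (h : b.EvenOn U) (h' : b.EvenOn W) (hI : b.EvenOn (U ∩ W)) :
    b.EvenOn (U ∪ W) := by
  set S := b.sqTotal hU hW
  have hA : ∀ n x, H.map n (b.aOn _) (H.map n S.jA x) = H.map n S.jA (H.map n (b.aOn U) x) :=
    fun n x => by rw [H.map_map, H.map_map]; rfl
  have hB : ∀ n x, H.map n (b.aOn _) (H.map n S.jB x) = H.map n S.jB (H.map n (b.aOn W) x) :=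
    fun n x => by rw [H.map_map, H.map_map]; rfl
  have key : ∀ n x y, H.map n (b.aOn _) (H.map n S.jA x + H.map n S.jB y) =
      H.map n S.jA x + H.map n S.jB y := fun n x y => by
    rw [map_add, hA, hB, h, h']
  rintro (_ | n) x
  · obtain ⟨y, z, rfl⟩ := S.exists_eq_add_zero x
    exact key _ _ _
  · have h1 : S.δ n (H.map (n + 1) (b.aOn _) x - x) = 0 := by
      rw [map_sub, δ_aOn, hI, sub_self]
    obtain ⟨y, z, hyz⟩ := S.exists_eq_add_of_δ_eq_zero h1
    have h2 := key _ y z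
    rw [hyz, map_sub, aOn_aOn, ← neg_sub] at h2
    exact sub_eq_zero.1 (eq_zero_of_eq_neg h2.symm)

lemma OddOn.union (h : b.OddOn U) (h' : b.OddOn W) (hI : b.OddOn (U ∩ W)) :
    b.OddOn (U ∪ W) := by
  set S := b.sqTotal hU hW
  set T := sqBase hU hW
  have haA : ∀ n x, H.map n (b.aOn _) (H.map n S.jA x) = H.map n S.jA (H.map n (b.aOn U) x) :=
    fun n x => by rw [H.map_map, H.map_map]; rfl
  have haB : ∀ n x, H.map n (b.aOn _) (H.map n S.jB x) = H.map n S.jB (H.map n (b.aOn W) x) :=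
    fun n x => by rw [H.map_map, H.map_map]; rfl
  have hpA : ∀ n x, H.map n (b.pOn _) (H.map n S.jA x) = H.map n T.jA (H.map n (b.pOn U) x) :=
    fun n x => by rw [H.map_map, H.map_map]; rfl
  have hpB : ∀ n x, H.map n (b.pOn _) (H.map n S.jB x) = H.map n T.jB (H.map n (b.pOn W) x) :=
    fun n x => by rw [H.map_map, H.map_map]; rfl
  have hiA : ∀ n x, H.map n (b.pOn U) (H.map n S.iA x) = H.map n T.iA (H.map n (b.pOn _) x) :=
    fun n x => by rw [H.map_map, H.map_map]; rfl
  have hiB : ∀ n x, H.map n (b.pOn W) (H.map n S.iB x) = H.map n T.iB (H.map n (b.pOn _) x) :=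
    fun n x => by rw [H.map_map, H.map_map]; rfl
  have hciA : ∀ n x, H.map n (b.aOn U) (H.map n S.iA x) = H.map n S.iA (H.map n (b.aOn _) x) :=
    fun n x => by rw [H.map_map, H.map_map]; rfl
  have hciB : ∀ n x, H.map n (b.aOn W) (H.map n S.iB x) = H.map n S.iB (H.map n (b.aOn _) x) :=
    fun n x => by rw [H.map_map, H.map_map]; rfl
  have surj : ∀ n x y, ∃ z, H.map n (b.pOn _) z = H.map n T.jA x + H.map n T.jB y := by
    intro n x y
    obtain ⟨x, rfl⟩ := (h n).1 x
    obtain ⟨y, rfl⟩ := (h' n).1 y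
    exact ⟨H.map n S.jA x + H.map n S.jB y, by rw [map_add, hpA, hpB]⟩
  have inj : ∀ n z, (∃ x y, H.map n S.jA x + H.map n S.jB y = z) → H.map n (b.pOn _) z = 0 →
      H.map n (b.aOn _) z = z → z = 0 := by
    rintro n _ ⟨x, y, rfl⟩ hp ha
    set x' := (2⁻¹ : ℚ) • (x + H.map n (b.aOn _) x) with hx'
    set y' := (2⁻¹ : ℚ) • (y + H.map n (b.aOn _) y) with hy'
    have hx : H.map n (b.aOn _) x' = x' := by rw [hx', map_smul, map_add, aOn_aOn]; exact congrArg _ (add_comm _ _)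
    have hy : H.map n (b.aOn _) y' = y' := by rw [hy', map_smul, map_add, aOn_aOn]; exact congrArg _ (add_comm _ _)
    have hxy : H.map n S.jA x + H.map n S.jB y = H.map n S.jA x' + H.map n S.jB y' := by
      have h2 : H.map n S.jA x' + H.map n S.jB y' = (2⁻¹ : ℚ) •
          ((H.map n S.jA x + H.map n S.jB y) +
            H.map n (b.aOn _) (H.map n S.jA x + H.map n S.jB y)) := by
        rw [map_add (H.map n (b.aOn _)), haA, haB, hx', hy']
        simp only [map_smul, map_add, smul_add]
        abel
      rw [h2, ha, ← two_smul ℚ, smul_smul]; norm_num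
    rw [hxy] at hp ⊢
    rw [map_add, hpA, hpB, ← eq_neg_iff_add_eq_zero, ← map_neg] at hp
    obtain ⟨c, hcA, hcB⟩ := T.exists_of_jA_eq_jB hp
    obtain ⟨c, rfl, hc⟩ := hI.exists_fixed c
    have h3 : x' - H.map n S.iA c = 0 := h.eq_zero
      (by rw [map_sub, hiA, hcA, sub_self]) (by rw [map_sub, hx, hciA, hc])
    have h4 : y' + H.map n S.iB c = 0 := h'.eq_zero
      (by rw [map_add, hiB, hcB, add_neg_cancel]) (by rw [map_add, hy, hciB, hc])
    rw [sub_eq_zero.1 h3, eq_neg_of_add_eq_zero_left h4, map_neg, S.map_comm, add_neg_cancel]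
  have inj' : ∀ n (z : H n (b.p ⁻¹' (U ∪ W))), H.map n (b.pOn _) z = 0 →
      H.map n (b.aOn _) z = z → z = 0 := by
    rintro (_ | n) z hp ha
    · exact inj _ _ (S.exists_eq_add_zero z) hp ha
    · refine inj _ _ (S.exists_eq_add_of_δ_eq_zero (hI.eq_zero ?_ ?_)) hp ha
      · rw [← δ_pOn hU hW, hp, map_zero]
      · rw [← δ_aOn hU hW, ha]
  refine fun n => ⟨?_, fun x hx => ?_⟩
  · obtain _ | n := n
    · intro z
      obtain ⟨x, y, rfl⟩ := T.exists_eq_add_zero z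
      exact surj _ x y
    · intro z
      obtain ⟨c, hc, hca⟩ := hI.exists_fixed (T.δ n z)
      have hA : H.map n S.iA c = 0 :=
        h.eq_zero (by rw [hiA, hc, MVSquare.iA_δ]) (by rw [hciA, hca])
      have hB : H.map n S.iB c = 0 :=
        h'.eq_zero (by rw [hiB, hc, MVSquare.iB_δ]) (by rw [hciB, hca])
      obtain ⟨w, rfl⟩ := S.exists_δ_eq hA hB
      have h0 : T.δ n (z - H.map (n + 1) (b.pOn _) w) = 0 := by
        rw [map_sub, δ_pOn, hc, sub_self]
      obtain ⟨x, y, hxy⟩ := T.exists_eq_add_of_δ_eq_zero h0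
      obtain ⟨v, hv⟩ := surj _ x y
      exact ⟨v + w, by rw [map_add, hv, hxy, sub_add_cancel]⟩
  · have := inj' n (x + H.map n (b.aOn _) x) (by rw [map_add, pOn_aOn, hx, add_zero])
      (by rw [map_add, aOn_aOn]; exact add_comm _ _)
    exact eq_neg_of_add_eq_zero_right this

end Cover

variable {b}

variable (b) in
/-- Local triviality with fibre the nonzero vectors of `L`. -/
def LocTrivial (L : Type) [NormedAddCommGroup L] : Prop :=
  ∀ x, ∃ U, IsOpen U ∧ x ∈ U ∧ ∀ O ⊆ U, IsOpen O → ∃ e : (O × Punctured L) ≃ₜ (b.p ⁻¹' O),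
    (∀ z, b.p (e z) = z.1) ∧ ∀ z, b.a (e z) = e (negP O L z)

section Local

variable {L : Type} [NormedAddCommGroup L] [NormedSpace ℝ L] [FiniteDimensional ℝ L] {O : Set G}
  (e : (O × Punctured L) ≃ₜ (b.p ⁻¹' O)) (he : ∀ z, b.p (e z) = z.1)
  (hea : ∀ z, b.a (e z) = e (negP O L z))

include he hea

lemma oddOn_of_trivial {r : ℕ} (hr : Module.finrank ℝ L = r) (ho : Odd r) : b.OddOn O := by
  have hp : (b.pOn O).comp (e : C(_, _)) = prP O L := ContinuousMap.ext fun z => Subtype.ext (he z)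
  have ha : (b.aOn O).comp (e : C(_, _)) = (e : C(_, _)).comp (negP O L) :=
    ContinuousMap.ext fun z => Subtype.ext (hea z)
  have : Nontrivial L := Module.nontrivial_of_finrank_pos (R := ℝ) (by have := ho.pos; omega)
  obtain ⟨r, rfl⟩ : ∃ s, r = s + 1 := ⟨r - 1, by have := ho.pos; omega⟩
  refine fun n => ⟨fun y => ?_, fun x hx => ?_⟩
  · obtain ⟨x, rfl⟩ := prP_surjective (L := L) n y
    exact ⟨H.map n e x, by rw [H.map_map, hp]⟩
  · obtain ⟨x, rfl⟩ := (H.bijective_of_homeomorph e n).2 x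
    rw [H.map_map, hp] at hx
    rw [H.map_map, ha, ← H.map_map, (fibreHomology O hr).neg n x hx, ho.neg_one_pow, neg_one_smul,
      map_neg]

lemma evenOn_of_trivial {r : ℕ} (hr : Module.finrank ℝ L = r + 1) (ho : Even (r + 1)) :
    b.EvenOn O := by
  have ha : (b.aOn O).comp (e : C(_, _)) = (e : C(_, _)).comp (negP O L) :=
    ContinuousMap.ext fun z => Subtype.ext (hea z)
  refine fun n x => ?_
  obtain ⟨x, rfl⟩ := (H.bijective_of_homeomorph e n).2 x
  rw [H.map_map, ha, ← H.map_map]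
  congr 1
  have hneg : (negP O L).comp (negP O L) = ContinuousMap.id _ :=
    ContinuousMap.ext fun z => Prod.ext rfl (Subtype.ext (neg_neg _))
  have h1 := (fibreHomology O hr).neg n (H.map n (negP O L) x - x) (by
    rw [map_sub, H.map_map, sub_eq_zero]; rfl)
  rw [ho.neg_one_pow, one_smul, map_sub, H.map_map, hneg, H.map_id, LinearMap.id_apply,
    ← neg_sub] at h1
  exact sub_eq_zero.1 (eq_zero_of_eq_neg h1.symm)

end Local

lemma of_local {P : Set G → Prop} (h0 : P ∅)
    (hP : ∀ U W, IsOpen U → IsOpen W → P U → P W → P (U ∩ W) → P (U ∪ W)) [CompactSpace G]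
    (hloc : ∀ x, ∃ U, IsOpen U ∧ x ∈ U ∧ ∀ O ⊆ U, IsOpen O → P O) : P Set.univ := by
  have : ∃ U, Set.univ ⊆ U ∧ IsOpen U ∧ ∀ O ⊆ U, IsOpen O → P O := by
    refine (isCompact_univ (X := G)).induction_on (p := fun s => ∃ U, s ⊆ U ∧ IsOpen U ∧
      ∀ O ⊆ U, IsOpen O → P O) ⟨∅, subset_rfl, isOpen_empty, ?_⟩ ?_ ?_ ?_
    · rintro O hO -
      rwa [Set.subset_empty_iff.1 hO]
    · rintro s t hst ⟨U, hU, h⟩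
      exact ⟨U, hst.trans hU, h⟩
    · rintro s t ⟨U, hsU, hU, h⟩ ⟨W, htW, hW, h'⟩
      refine ⟨U ∪ W, Set.union_subset_union hsU htW, hU.union hW, fun O hO hO' => ?_⟩
      rw [show O = O ∩ U ∪ O ∩ W by rw [← Set.inter_union_distrib_left, Set.inter_eq_left.2 hO]]
      refine hP _ _ (hO'.inter hU) (hO'.inter hW) (h _ Set.inter_subset_right (hO'.inter hU))
        (h' _ Set.inter_subset_right (hO'.inter hW)) (h _ ?_ ((hO'.inter hU).inter (hO'.inter hW)))
      exact Set.inter_subset_left.trans Set.inter_subset_right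
    · intro x _
      obtain ⟨U, hU, hx, h⟩ := hloc x
      exact ⟨U, by rw [nhdsWithin_univ]; exact hU.mem_nhds hx, U, subset_rfl, hU, h⟩
  obtain ⟨U, hU, -, h⟩ := this
  exact h _ hU isOpen_univ

variable (b) in
lemma map_val_aOn {n : ℕ} (x : H n (b.p ⁻¹' Set.univ)) :
    H.map n b.a (H.map n (⟨Subtype.val, continuous_subtype_val⟩ : C(b.p ⁻¹' Set.univ, E)) x) =
      H.map n ⟨Subtype.val, continuous_subtype_val⟩ (H.map n (b.aOn _) x) := by
  rw [H.map_map, H.map_map]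
  rfl

variable (b) in
lemma map_val_pOn {n : ℕ} (x : H n (b.p ⁻¹' Set.univ)) :
    H.map n (⟨Subtype.val, continuous_subtype_val⟩ : C(Set.univ, G)) (H.map n (b.pOn _) x) =
      H.map n b.p
        (H.map n (⟨Subtype.val, continuous_subtype_val⟩ : C(b.p ⁻¹' Set.univ, E)) x) := by
  rw [H.map_map, H.map_map]
  rfl

variable {L : Type} [NormedAddCommGroup L] [NormedSpace ℝ L] [FiniteDimensional ℝ L]
  [CompactSpace G]

theorem map_a_of_even (h : b.LocTrivial L) {r : ℕ} (hr : Module.finrank ℝ L = r) (hr0 : 0 < r)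
    (he : Even r) (n : ℕ) (x : H n E) : H.map n b.a x = x := by
  obtain ⟨r, rfl⟩ : ∃ s, r = s + 1 := ⟨r - 1, by omega⟩
  have key : b.EvenOn Set.univ := by
    refine of_local (fun n x => ?_) (fun U W hU hW => EvenOn.union hU hW) fun x => ?_
    · have : IsEmpty (b.p ⁻¹' ∅) := by rw [Set.preimage_empty]; infer_instance
      rw [H.eq_zero_of_isEmpty x, map_zero]
    · obtain ⟨U, hU, hx, h⟩ := h x
      refine ⟨U, hU, hx, fun O hO hO' => ?_⟩
      obtain ⟨e, he1, he2⟩ := h O hO hO'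
      exact evenOn_of_trivial e he1 he2 hr he
  obtain ⟨x, rfl⟩ := (H.bijective_of_homeomorph (Homeomorph.Set.univ E) n).2 x
  exact (map_val_aOn b x).trans (congrArg _ (key n x))

theorem odd_of_odd (h : b.LocTrivial L) {r : ℕ} (hr : Module.finrank ℝ L = r)
    (he : Odd r) : b.OddOn Set.univ := by
  refine of_local (fun n => ⟨fun x => ⟨0, ?_⟩, fun x _ => ?_⟩)
    (fun U W hU hW => OddOn.union hU hW) fun x => ?_
  · rw [H.eq_zero_of_isEmpty x, map_zero]
  · have : IsEmpty (b.p ⁻¹' ∅) := by rw [Set.preimage_empty]; infer_instance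
    rw [H.eq_zero_of_isEmpty x, map_zero, neg_zero]
  · obtain ⟨U, hU, hx, h⟩ := h x
    refine ⟨U, hU, hx, fun O hO hO' => ?_⟩
    obtain ⟨e, he1, he2⟩ := h O hO hO'
    exact oddOn_of_trivial e he1 he2 hr he

theorem map_p_surjective_of_odd (h : b.LocTrivial L) {r : ℕ} (hr : Module.finrank ℝ L = r)
    (he : Odd r) (n : ℕ) : Function.Surjective (H.map n b.p) := by
  intro y
  obtain ⟨y, rfl⟩ := (H.bijective_of_homeomorph (Homeomorph.Set.univ G) n).2 y
  obtain ⟨x, rfl⟩ := (odd_of_odd h hr he n).1 y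
  exact ⟨H.map n ⟨Subtype.val, continuous_subtype_val⟩ x, by rw [H.map_map, H.map_map]; rfl⟩

theorem map_a_of_odd (h : b.LocTrivial L) {r : ℕ} (hr : Module.finrank ℝ L = r)
    (he : Odd r) (n : ℕ) (x : H n E) (hx : H.map n b.p x = 0) : H.map n b.a x = -x := by
  obtain ⟨x, rfl⟩ := (H.bijective_of_homeomorph (Homeomorph.Set.univ E) n).2 x
  refine (map_val_aOn b x).trans ?_
  have hx' : H.map n (b.aOn Set.univ) x = -x := by
    refine (odd_of_odd h hr he n).2 x ?_
    apply (H.bijective_of_homeomorph (Homeomorph.Set.univ G) n).1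
    exact (map_val_pOn b x).trans (hx.trans (map_zero _).symm)
  exact (congrArg _ hx').trans (map_neg _ _)

end InvBundle

end Bundle

end RatHomology

namespace RatHomology

open Topology InnerProductSpace

open scoped RealInnerProductSpace

section Projections

variable {E : Type} [NormedAddCommGroup E] [InnerProductSpace ℝ E]

/-- The orthogonal projection onto the line spanned by `u`. -/
noncomputable def pr (u : E) : E →L[ℝ] E := (‖u‖ ^ 2)⁻¹ • rankOne ℝ u u

lemma pr_apply (u x : E) : pr u x = ((‖u‖ ^ 2)⁻¹ * ⟪u, x⟫) • u := by
  simp [pr, smul_smul]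

lemma pr_self {u : E} (hu : u ≠ 0) : pr u u = u := by
  have : ‖u‖ ≠ 0 := norm_ne_zero_iff.2 hu
  rw [pr_apply, real_inner_self_eq_norm_sq, inv_mul_cancel₀ (by positivity), one_smul]

@[simp] lemma pr_neg (u : E) : pr (-u) = pr u := by
  ext x; simp [pr_apply]

@[simp] lemma pr_zero : pr (0 : E) = 0 := by
  ext x; simp [pr_apply]

lemma pr_smul {c : ℝ} (hc : c ≠ 0) (u : E) : pr (c • u) = pr u := by
  ext x
  rw [pr_apply, pr_apply, norm_smul, inner_smul_left, smul_smul, mul_pow, Real.norm_eq_abs, sq_abs]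
  congr 1
  simp only [conj_trivial]
  field_simp

lemma pr_idem (u x : E) : pr u (pr u x) = pr u x := by
  obtain rfl | hu := eq_or_ne u 0
  · simp
  · rw [pr_apply u x, map_smul, pr_self hu]

lemma pr_symm (u x y : E) : ⟪pr u x, y⟫ = ⟪x, pr u y⟫ := by
  rw [pr_apply, pr_apply, inner_smul_left, inner_smul_right, real_inner_comm u x]
  simp only [conj_trivial]
  ring

lemma pr_eq_zero {u x : E} (h : ⟪u, x⟫ = 0) : pr u x = 0 := by
  rw [pr_apply, h, mul_zero, zero_smul]

lemma pr_of_norm {u : E} (hu : ‖u‖ = 1) (x : E) : pr u x = ⟪u, x⟫ • u := by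
  simp [pr_apply, hu]

lemma pr_mem {S : Submodule ℝ E} {u : E} (hu : u ∈ S) (x : E) : pr u x ∈ S := by
  rw [pr_apply]; exact S.smul_mem _ hu

lemma _root_.Continuous.pr {X : Type*} [TopologicalSpace X] {f : X → E} (hf : Continuous f)
    (h0 : ∀ x, f x ≠ 0) : Continuous fun x => pr (f x) := by
  have h1 : Continuous fun x => (‖f x‖ ^ 2)⁻¹ := by
    refine Continuous.inv₀ (by fun_prop) fun x => ?_
    have := norm_pos_iff.2 (h0 x)
    positivity
  have h2 : Continuous fun x => rankOne ℝ (f x) (f x) :=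
    ((rankOne ℝ).continuous.comp hf).clm_apply hf
  exact h1.smul h2

lemma trace_pr [FiniteDimensional ℝ E] {u : E} (hu : u ≠ 0) :
    LinearMap.trace ℝ E (pr u : E →ₗ[ℝ] E) = 1 := by
  have : ‖u‖ ≠ 0 := norm_ne_zero_iff.2 hu
  rw [pr, ContinuousLinearMap.toLinearMap_smul, map_smul, trace_rankOne,
    real_inner_self_eq_norm_sq, smul_eq_mul, inv_mul_cancel₀ (by positivity)]

/-- The reflection in the hyperplane orthogonal to `u`. -/
noncomputable def refl (u : E) : E →L[ℝ] E := 1 - (2 : ℝ) • pr u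

lemma refl_apply (u x : E) : refl u x = x - (2 : ℝ) • pr u x := by simp [refl]

@[simp] lemma refl_refl (u x : E) : refl u (refl u x) = x := by
  simp only [refl_apply, map_sub, map_smul, pr_idem]
  module

lemma refl_symm (u x y : E) : ⟪refl u x, y⟫ = ⟪x, refl u y⟫ := by
  simp only [refl_apply, inner_sub_left, inner_sub_right, inner_smul_left, inner_smul_right,
    pr_symm, conj_trivial]

lemma inner_refl_refl (u x y : E) : ⟪refl u x, refl u y⟫ = ⟪x, y⟫ := by
  rw [refl_symm, refl_refl]

lemma refl_mem {S : Submodule ℝ E} {u : E} (hu : u ∈ S) {x : E} (hx : x ∈ S) : refl u x ∈ S := by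
  rw [refl_apply]; exact S.sub_mem hx (S.smul_mem _ (pr_mem hu x))

lemma refl_self (u : E) : refl u u = -u := by
  obtain rfl | hu := eq_or_ne u 0
  · simp
  · rw [refl_apply, pr_self hu]; module

lemma refl_eq_self {u x : E} (h : ⟪u, x⟫ = 0) : refl u x = x := by
  rw [refl_apply, pr_eq_zero h, smul_zero, sub_zero]

@[simp] lemma norm_refl (u x : E) : ‖refl u x‖ = ‖x‖ := by
  rw [@norm_eq_sqrt_real_inner E, inner_refl_refl, ← norm_eq_sqrt_real_inner]

lemma _root_.Continuous.refl {X : Type*} [TopologicalSpace X] {f : X → E} (hf : Continuous f)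
    (h0 : ∀ x, f x ≠ 0) : Continuous fun x => refl (f x) := by
  have := hf.pr h0
  unfold RatHomology.refl
  fun_prop

/-- The reflection exchanging two vectors of the same norm, up to sign. -/
lemma refl_add_apply {u v : E} (h : ‖u‖ = ‖v‖) : refl (u + v) u = -v := by
  obtain h0 | h0 := eq_or_ne (u + v) 0
  · rw [h0, eq_neg_of_add_eq_zero_left h0]; simp [refl_apply]
  have h1 : (2 : ℝ) • u = (u + v) + (u - v) := by module
  have h2 : ⟪u + v, u - v⟫ = 0 := by
    rw [inner_add_left, inner_sub_right, inner_sub_right, real_inner_self_eq_norm_sq,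
      real_inner_self_eq_norm_sq, h, real_inner_comm]
    ring
  have h3 : (2 : ℝ) • refl (u + v) u = (2 : ℝ) • (-v) := by
    rw [← map_smul, h1, map_add, refl_self, refl_eq_self h2]; module
  exact smul_right_injective E (two_ne_zero (α := ℝ)) h3

/-- Conjugating a reflection by a reflection. -/
lemma refl_conj (u v x : E) : refl u (refl v (refl u x)) = refl (refl u v) x := by
  have : pr (refl u v) x = refl u (pr v (refl u x)) := by
    rw [pr_apply, pr_apply, norm_refl, map_smul, refl_symm]
  rw [refl_apply v, refl_apply (refl u v), map_sub, refl_refl, map_smul, this]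

lemma refl_smul {c : ℝ} (hc : c ≠ 0) (u : E) : refl (c • u) = refl u := by
  rw [refl, pr_smul hc, refl]

@[simp] lemma refl_neg (u : E) : refl (-u) = refl u := by rw [refl, pr_neg, refl]

end Projections

section Gr

variable {E : Type} [NormedAddCommGroup E] [InnerProductSpace ℝ E]

/-- `P` is the orthogonal projection onto a `k`-dimensional subspace of `S`. -/
structure IsGr (S : Submodule ℝ E) (k : ℕ) (P : E →L[ℝ] E) : Prop where
  idem : ∀ x, P (P x) = P x
  symm : ∀ x y, ⟪P x, y⟫ = ⟪x, P y⟫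
  mem : ∀ x, P x ∈ S
  tr : LinearMap.trace ℝ E P = k

/-- `T` is an isometry preserving `S`, with adjoint `T'`. -/
structure IsOrth (S : Submodule ℝ E) (T T' : E →L[ℝ] E) : Prop where
  adj : ∀ x y, ⟪T x, y⟫ = ⟪x, T' y⟫
  inv : ∀ x, T' (T x) = x
  mem : ∀ x ∈ S, T x ∈ S

lemma isOrth_refl {S : Submodule ℝ E} {u : E} (hu : u ∈ S) : IsOrth S (refl u) (refl u) :=
  ⟨refl_symm u, refl_refl u, fun _ => refl_mem hu⟩

namespace IsGr

variable {S T : Submodule ℝ E} {k : ℕ} {P : E →L[ℝ] E}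

lemma mono (hP : IsGr S k P) (h : S ≤ T) : IsGr T k P :=
  ⟨hP.idem, hP.symm, fun x => h (hP.mem x), hP.tr⟩

lemma conj (hP : IsGr S k P) {R R' : E →L[ℝ] E} (h : IsOrth S R R') :
    IsGr S k (R ∘L P ∘L R') where
  idem x := by simp [h.inv, hP.idem]
  symm x y := by
    simp only [ContinuousLinearMap.comp_apply]
    rw [h.adj, hP.symm, real_inner_comm, ← h.adj, real_inner_comm]
  mem x := h.mem _ (hP.mem _)
  tr := by
    rw [← hP.tr]
    have h1 := LinearMap.trace_mul_comm ℝ (R : E →ₗ[ℝ] E) ((P : E →ₗ[ℝ] E) * (R' : E →ₗ[ℝ] E))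
    refine Eq.trans h1 (congrArg _ ?_)
    ext x
    simp [h.inv]

lemma pr_apply_of_mem {u : E} (hP : IsGr S k P) (h : P u = 0) (x : E) : pr u (P x) = 0 := by
  rw [pr_eq_zero]
  rw [← hP.symm, h, inner_zero_left]

lemma apply_pr {u : E} (h : P u = 0) (x : E) : P (pr u x) = 0 := by
  rw [pr_apply, map_smul, h, smul_zero]

variable [FiniteDimensional ℝ E]

lemma add_pr (hP : IsGr S k P) {u : E} (hu : u ∈ S) (h0 : u ≠ 0) (h : P u = 0) :
    IsGr S (k + 1) (P + pr u) where
  idem x := by simp [hP.idem, pr_idem, hP.pr_apply_of_mem h, apply_pr h]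
  symm x y := by simp [inner_add_left, inner_add_right, hP.symm, pr_symm]
  mem x := S.add_mem (hP.mem x) (pr_mem hu x)
  tr := by
    rw [ContinuousLinearMap.toLinearMap_add, map_add, hP.tr, trace_pr h0]; norm_num

lemma sub_pr (hP : IsGr S (k + 1) P) {u : E} (h0 : u ≠ 0) (h : P u = u) :
    IsGr S k (P - pr u) := by
  have h1 : ∀ x, P (pr u x) = pr u x := fun x => by rw [pr_apply, map_smul, h]
  have h2 : ∀ x, pr u (P x) = pr u x := fun x => by rw [pr_apply, ← hP.symm, h, ← pr_apply]
  refine ⟨fun x => ?_, fun x y => ?_, fun x => ?_, ?_⟩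
  · simp [hP.idem, h1, h2, pr_idem]
  · simp [inner_sub_left, inner_sub_right, hP.symm, pr_symm]
  · exact S.sub_mem (hP.mem x) (pr_mem (h ▸ hP.mem u) x)
  · rw [ContinuousLinearMap.toLinearMap_sub, map_sub, hP.tr, trace_pr h0]; simp

lemma proj_apply (hP : IsGr S k P) (x : E) : S.starProjection (P x) = P x :=
  Submodule.starProjection_eq_self_iff.2 (hP.mem x)

lemma apply_proj (hP : IsGr S k P) (x : E) : P (S.starProjection x) = P x := by
  refine ext_inner_right ℝ fun y => ?_
  rw [hP.symm, Submodule.inner_starProjection_left_eq_right, hP.proj_apply, hP.symm]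

end IsGr

section

variable [FiniteDimensional ℝ E] {S : Submodule ℝ E}

lemma trace_proj (S : Submodule ℝ E) :
    LinearMap.trace ℝ E (S.starProjection : E →ₗ[ℝ] E) = Module.finrank ℝ S :=
  LinearMap.IsProj.trace (p := S)
    ⟨S.starProjection_apply_mem, fun _ hx => Submodule.starProjection_eq_self_iff.2 hx⟩

lemma isGr_proj (S : Submodule ℝ E) : IsGr S (Module.finrank ℝ S) S.starProjection where
  idem x := Submodule.starProjection_eq_self_iff.2 (S.starProjection_apply_mem x)
  symm x y := Submodule.inner_starProjection_left_eq_right S x y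
  mem x := S.starProjection_apply_mem x
  tr := trace_proj S

lemma IsGr.compl {k l : ℕ} (hkl : k + l = Module.finrank ℝ S) {P : E →L[ℝ] E} (hP : IsGr S k P) :
    IsGr S l (S.starProjection - P) where
  idem x := by
    have := (isGr_proj S).idem x
    simp [hP.idem, hP.proj_apply, hP.apply_proj, this]
  symm x y := by simp [inner_sub_left, inner_sub_right, hP.symm,
    Submodule.inner_starProjection_left_eq_right]
  mem x := S.sub_mem (S.starProjection_apply_mem x) (hP.mem x)
  tr := by
    rw [ContinuousLinearMap.toLinearMap_sub, map_sub, hP.tr, trace_proj, ← hkl]; simp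

lemma IsGr.isProj {k : ℕ} {P : E →L[ℝ] E} (hP : IsGr S k P) :
    LinearMap.IsProj (P : E →ₗ[ℝ] E).range (P : E →ₗ[ℝ] E) :=
  ⟨fun x => ⟨x, rfl⟩, by rintro _ ⟨x, rfl⟩; exact hP.idem x⟩

lemma IsGr.finrank_range {k : ℕ} {P : E →L[ℝ] E} (hP : IsGr S k P) :
    Module.finrank ℝ (P : E →ₗ[ℝ] E).range = k := by
  have := hP.isProj.trace
  rw [hP.tr] at this
  exact_mod_cast this.symm

lemma IsGr.eq_zero {P : E →L[ℝ] E} (hP : IsGr S 0 P) : P = 0 := by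
  have := Submodule.finrank_eq_zero.1 hP.finrank_range
  ext x
  exact LinearMap.congr_fun (LinearMap.range_eq_bot.1 this) x

lemma isGr_zero (S : Submodule ℝ E) : IsGr S 0 0 := ⟨by simp, by simp, by simp, by simp⟩

lemma IsGr.eq_proj {k : ℕ} (hk : k = Module.finrank ℝ S) {P : E →L[ℝ] E} (hP : IsGr S k P) :
    P = S.starProjection :=
  (sub_eq_zero.1 (hP.compl (l := 0) (by omega)).eq_zero).symm

end

end Gr

end RatHomology

namespace RatHomology

open Topology InnerProductSpace

open scoped RealInnerProductSpace

variable {E : Type} [NormedAddCommGroup E] [InnerProductSpace ℝ E] [FiniteDimensional ℝ E]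

/-- `S'` is the orthogonal complement of the unit vector `e` in `S`. -/
structure IsCut (S : Submodule ℝ E) (e : E) (S' : Submodule ℝ E) : Prop where
  norm : ‖e‖ = 1
  mem : e ∈ S
  iff : ∀ x, x ∈ S' ↔ x ∈ S ∧ ⟪e, x⟫ = 0

namespace IsCut

variable {S S' S'' : Submodule ℝ E} {e f : E}

lemma le (h : IsCut S e S') : S' ≤ S := fun _ hx => ((h.iff _).1 hx).1

lemma inner_eq_zero (h : IsCut S e S') {x : E} (hx : x ∈ S') : ⟪e, x⟫ = 0 := ((h.iff _).1 hx).2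

lemma ne_zero (h : IsCut S e S') : e ≠ 0 := norm_ne_zero_iff.1 (by rw [h.norm]; exact one_ne_zero)

lemma inner_self (h : IsCut S e S') : ⟪e, e⟫ = 1 := by
  rw [real_inner_self_eq_norm_sq, h.norm, one_pow]

lemma sub_mem (h : IsCut S e S') {x : E} (hx : x ∈ S) : x - ⟪e, x⟫ • e ∈ S' := by
  refine (h.iff _).2 ⟨S.sub_mem hx (S.smul_mem _ h.mem), ?_⟩
  rw [inner_sub_right, inner_smul_right, h.inner_self, mul_one, sub_self]

lemma refl_mem (h : IsCut S e S') {x : E} (hx : x ∈ S') : refl e x = x :=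
  refl_eq_self (h.inner_eq_zero hx)

lemma swap (h : IsCut S e S') (h' : IsCut S' f S'') : ∃ T, IsCut S f T ∧ IsCut T e S'' := by
  refine ⟨S ⊓ (Submodule.span ℝ {f})ᗮ, ⟨h'.norm, h.le h'.mem, fun x => ?_⟩,
    ⟨h.norm, ⟨h.mem, ?_⟩, fun x => ?_⟩⟩
  · rw [Submodule.mem_inf, Submodule.mem_orthogonal_singleton_iff_inner_right]
  · rw [SetLike.mem_coe, Submodule.mem_orthogonal_singleton_iff_inner_right, real_inner_comm]
    exact h.inner_eq_zero h'.mem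
  · rw [h'.iff, h.iff, Submodule.mem_inf, Submodule.mem_orthogonal_singleton_iff_inner_right]
    tauto

lemma proj_apply_eq_zero (h : IsCut S e S') {k : ℕ} {P : E →L[ℝ] E} (hP : IsGr S' k P) :
    P e = 0 := by
  rw [← inner_self_eq_zero (𝕜 := ℝ), hP.symm, hP.idem, h.inner_eq_zero (hP.mem e)]

lemma isGr_up (h : IsCut S e S') {k : ℕ} {P : E →L[ℝ] E} (hP : IsGr S' k P) :
    IsGr S (k + 1) (P + pr e) :=
  (hP.mono h.le).add_pr h.mem h.ne_zero (h.proj_apply_eq_zero hP)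

lemma isGr_of_apply_eq_zero (h : IsCut S e S') {k : ℕ} {P : E →L[ℝ] E} (hP : IsGr S k P)
    (he : P e = 0) : IsGr S' k P where
  idem := hP.idem
  symm := hP.symm
  mem x := (h.iff _).2 ⟨hP.mem x, by rw [← hP.symm, he, inner_zero_left]⟩
  tr := hP.tr

lemma finrank (h : IsCut S e S') : Module.finrank ℝ S = Module.finrank ℝ S' + 1 := by
  have h1 := isGr_proj S'
  have h2 : LinearMap.IsProj S (S'.starProjection + pr e : E →ₗ[ℝ] E) := by
    refine ⟨fun x => (h.isGr_up h1).mem x, fun x hx => ?_⟩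
    have h3 := Submodule.starProjection_eq_self_iff.2 (h.sub_mem hx)
    rw [map_sub, map_smul, h.proj_apply_eq_zero h1, smul_zero, sub_zero] at h3
    simp [h3, pr_of_norm h.norm]
  have h4 := h2.trace
  have h5 := (h.isGr_up h1).tr
  rw [ContinuousLinearMap.toLinearMap_add, h4] at h5
  exact_mod_cast h5

lemma starProjection (h : IsCut S e S') : S.starProjection = S'.starProjection + pr e :=
  ((h.isGr_up (isGr_proj S')).eq_proj h.finrank.symm).symm

end IsCut

lemma exists_isCut {S : Submodule ℝ E} (h : 0 < Module.finrank ℝ S) : ∃ e S', IsCut S e S' := by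
  have : Nontrivial S := Module.nontrivial_of_finrank_pos h
  obtain ⟨x, hx⟩ := exists_ne (0 : S)
  have hx' : (x : E) ≠ 0 := by simpa using hx
  refine ⟨(‖(x : E)‖⁻¹ : ℝ) • (x : E), S ⊓ (Submodule.span ℝ {(‖(x : E)‖⁻¹ : ℝ) • (x : E)})ᗮ,
    norm_smul_inv_norm hx', S.smul_mem _ x.2, fun y => ?_⟩
  rw [← Submodule.mem_orthogonal_singleton_iff_inner_right, Submodule.mem_inf]

/-- The Grassmannian of `k`-dimensional subspaces of `S`. -/
abbrev Gr (S : Submodule ℝ E) (k : ℕ) : Type := {P : E →L[ℝ] E // IsGr S k P}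

/-- The space of pairs of a `k`-dimensional subspace of `S` and a nonzero vector of `S`
orthogonal to it. -/
abbrev Flag (S : Submodule ℝ E) (k : ℕ) : Type :=
  {q : (E →L[ℝ] E) × E // IsGr S k q.1 ∧ q.2 ∈ S ∧ q.1 q.2 = 0 ∧ q.2 ≠ 0}

variable {S S' T : Submodule ℝ E} {e : E} {k l : ℕ}

/-- The inclusion of Grassmannians. -/
def Gr.inc (k : ℕ) (h : S ≤ T) : C(Gr S k, Gr T k) :=
  ⟨fun P => ⟨P.1, P.2.mono h⟩, by fun_prop⟩

/-- Adding the vector `e` to a subspace. -/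
noncomputable def Gr.up (k : ℕ) (h : IsCut S e S') : C(Gr S' k, Gr S (k + 1)) :=
  ⟨fun P => ⟨P.1 + pr e, h.isGr_up P.2⟩, by fun_prop⟩

/-- The orthogonal complement. -/
noncomputable def Gr.dual (hkl : k + l = Module.finrank ℝ S) : C(Gr S k, Gr S l) :=
  ⟨fun P => ⟨S.starProjection - P.1, P.2.compl hkl⟩, by fun_prop⟩

/-- The action of isometries. -/
noncomputable def Gr.conj {R R' : E →L[ℝ] E} (h : IsOrth S R R') : C(Gr S k, Gr S k) :=
  ⟨fun P => ⟨R ∘L P.1 ∘L R', P.2.conj h⟩, by fun_prop⟩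

/-- The involution reversing the vector. -/
def Flag.neg (S : Submodule ℝ E) (k : ℕ) : C(Flag S k, Flag S k) :=
  ⟨fun q => ⟨(q.1.1, -q.1.2), q.2.1, S.neg_mem q.2.2.1, by rw [map_neg, q.2.2.2.1, neg_zero],
    neg_ne_zero.2 q.2.2.2.2⟩, by fun_prop⟩

/-- Forgetting the vector. -/
def Flag.fst (S : Submodule ℝ E) (k : ℕ) : C(Flag S k, Gr S k) :=
  ⟨fun q => ⟨q.1.1, q.2.1⟩, by fun_prop⟩

/-- The sum of the subspace and the line spanned by the vector. -/
noncomputable def Flag.sum (S : Submodule ℝ E) (k : ℕ) : C(Flag S k, Gr S (k + 1)) :=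
  ⟨fun q => ⟨q.1.1 + pr q.1.2, q.2.1.add_pr q.2.2.1 q.2.2.2.2 q.2.2.2.1⟩, by
    have : Continuous fun q : Flag S k => pr q.1.2 :=
      Continuous.pr (by fun_prop) fun q => q.2.2.2.2
    fun_prop⟩

lemma IsOrth.norm {R R' : E →L[ℝ] E} (h : IsOrth S R R') (x : E) : ‖R x‖ = ‖x‖ := by
  rw [@norm_eq_sqrt_real_inner E, h.adj, h.inv, ← norm_eq_sqrt_real_inner]

/-- The action of isometries on pairs. -/
noncomputable def Flag.conj {R R' : E →L[ℝ] E} (h : IsOrth S R R') : C(Flag S k, Flag S k) :=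
  ⟨fun q => ⟨(R ∘L q.1.1 ∘L R', R q.1.2), q.2.1.conj h, h.mem _ q.2.2.1, by
    simp [h.inv, q.2.2.2.1], fun h0 => q.2.2.2.2 <| by
      rw [← norm_eq_zero, ← h.norm]; exact norm_eq_zero.2 h0⟩, by fun_prop⟩

/-- The complement of the subspace and the line spanned by the vector. -/
noncomputable def Flag.dual (hkl : k + 1 + l = Module.finrank ℝ S) : C(Flag S k, Flag S l) :=
  ⟨fun q => ⟨(S.starProjection - (q.1.1 + pr q.1.2), q.1.2),
    (q.2.1.add_pr q.2.2.1 q.2.2.2.2 q.2.2.2.1).compl hkl, q.2.2.1, by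
      simp [Submodule.starProjection_eq_self_iff.2 q.2.2.1, q.2.2.2.1, pr_self q.2.2.2.2],
      q.2.2.2.2⟩, by
    have : Continuous fun q : Flag S k => pr q.1.2 :=
      Continuous.pr (by fun_prop) fun q => q.2.2.2.2
    fun_prop⟩

lemma Gr.dual_comp_dual (hkl : k + l = Module.finrank ℝ S) (hlk : l + k = Module.finrank ℝ S) :
    (Gr.dual hlk).comp (Gr.dual hkl) = ContinuousMap.id _ :=
  ContinuousMap.ext fun _ => Subtype.ext (sub_sub_cancel _ _)

lemma Gr.dual_bijective (hkl : k + l = Module.finrank ℝ S) (n : ℕ) :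
    Function.Bijective (H.map n (Gr.dual hkl)) := by
  refine H.bijective_of_homotopic (g := Gr.dual ((add_comm l k).trans hkl)) ?_ ?_ n
  · rw [Gr.dual_comp_dual]
  · rw [Gr.dual_comp_dual]

lemma Flag.dual_comp_dual (hkl : k + 1 + l = Module.finrank ℝ S)
    (hlk : l + 1 + k = Module.finrank ℝ S) :
    (Flag.dual hlk).comp (Flag.dual hkl) = ContinuousMap.id _ :=
  ContinuousMap.ext fun q => Subtype.ext <| Prod.ext (by
    simp only [Flag.dual, ContinuousMap.comp_apply, ContinuousMap.coe_mk, ContinuousMap.id_apply]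
    abel) rfl

lemma Flag.dual_bijective (hkl : k + 1 + l = Module.finrank ℝ S) (n : ℕ) :
    Function.Bijective (H.map n (Flag.dual hkl)) := by
  refine H.bijective_of_homotopic (g := Flag.dual (by omega)) ?_ ?_ n
  · rw [Flag.dual_comp_dual]
  · rw [Flag.dual_comp_dual]

/-- Duality exchanges the two maps from pairs to Grassmannians. -/
lemma Flag.sum_eq (hkl : k + 1 + l = Module.finrank ℝ S)
    (hlk : l + (k + 1) = Module.finrank ℝ S) :
    Flag.sum S k = (Gr.dual hlk).comp ((Flag.fst S l).comp (Flag.dual hkl)) :=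
  ContinuousMap.ext fun _ => Subtype.ext (sub_sub_cancel _ _).symm

lemma Gr.up_eq (h : IsCut S e S') (hk : k + l = Module.finrank ℝ S')
    (hk' : l + (k + 1) = Module.finrank ℝ S) :
    Gr.up k h = (Gr.dual hk').comp ((Gr.inc l h.le).comp (Gr.dual hk)) :=
  ContinuousMap.ext fun P => Subtype.ext <| by
    simp only [Gr.up, Gr.dual, Gr.inc, ContinuousMap.coe_mk, ContinuousMap.comp_apply,
      h.starProjection]
    abel

lemma Gr.isClosed (S : Submodule ℝ E) (k : ℕ) : IsClosed {P : E →L[ℝ] E | IsGr S k P} := by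
  have : {P : E →L[ℝ] E | IsGr S k P} = {P : E →L[ℝ] E | (∀ x, P (P x) = P x) ∧
      (∀ x y, ⟪P x, y⟫ = ⟪x, P y⟫) ∧ (∀ x, P x ∈ S) ∧ LinearMap.trace ℝ E P = k} :=
    Set.ext fun P => ⟨fun h => ⟨h.idem, h.symm, h.mem, h.tr⟩,
      fun h => ⟨h.1, h.2.1, h.2.2.1, h.2.2.2⟩⟩
  rw [this]
  have htr : Continuous fun P : E →L[ℝ] E => LinearMap.trace ℝ E P :=
    LinearMap.continuous_of_finiteDimensional
      ((LinearMap.trace ℝ E).comp (ContinuousLinearMap.coeLM ℝ))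
  simp only [Set.ofPred_and, Set.ofPred_forall]
  refine (isClosed_iInter fun x => isClosed_eq (by fun_prop) (by fun_prop)).inter
    ((isClosed_iInter fun x => isClosed_iInter fun y => isClosed_eq (by fun_prop)
      (by fun_prop)).inter ((isClosed_iInter fun x => ?_).inter (isClosed_eq htr (by fun_prop))))
  exact S.closed_of_finiteDimensional.preimage (f := fun P : E →L[ℝ] E => P x) (by fun_prop)

instance Gr.compactSpace (S : Submodule ℝ E) (k : ℕ) : CompactSpace (Gr S k) := by
  refine isCompact_iff_compactSpace.1 (Metric.isCompact_of_isClosed_isBounded (Gr.isClosed S k)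
    ((Metric.isBounded_closedBall (x := (0 : E →L[ℝ] E)) (r := 1)).subset fun P hP => ?_))
  rw [mem_closedBall_zero_iff]
  refine P.opNorm_le_bound zero_le_one fun x => ?_
  rw [one_mul]
  have h1 : ‖P x‖ ^ 2 ≤ ‖x‖ * ‖P x‖ := by
    rw [← real_inner_self_eq_norm_sq, hP.symm, hP.idem]
    exact real_inner_le_norm x (P x)
  nlinarith [norm_nonneg x, norm_nonneg (P x)]

lemma Gr.ext_zero (P Q : Gr S 0) : P = Q :=
  Subtype.ext (P.2.eq_zero.trans Q.2.eq_zero.symm)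

lemma Gr.ext_top (hk : k = Module.finrank ℝ S) (P Q : Gr S k) : P = Q :=
  Subtype.ext ((P.2.eq_proj hk).trans (Q.2.eq_proj hk).symm)

end RatHomology

namespace RatHomology

open Topology InnerProductSpace

open scoped RealInnerProductSpace

variable {E : Type} [NormedAddCommGroup E] [InnerProductSpace ℝ E] [FiniteDimensional ℝ E]
  {S S' T : Submodule ℝ E} {e : E} {k l : ℕ}

/-- The bundle of nonzero vectors orthogonal to a subspace. -/
def Flag.bundle (S : Submodule ℝ E) (k : ℕ) : InvBundle (Flag S k) (Gr S k) where
  p := Flag.fst S k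
  a := Flag.neg S k
  p_a _ := rfl
  a_a q := Subtype.ext (Prod.ext rfl (neg_neg q.1.2))

/-- An operator intertwining the projection `Q` with `P`. -/
noncomputable def intertwine (P Q : E →L[ℝ] E) : E →L[ℝ] E := P * Q + (1 - P) * (1 - Q)

lemma continuous_intertwine (Q : E →L[ℝ] E) : Continuous fun P => intertwine P Q := by
  unfold intertwine; fun_prop

lemma IsGr.mul_self {P : E →L[ℝ] E} (hP : IsGr S k P) : P * P = P :=
  ContinuousLinearMap.ext hP.idem

lemma IsGr.proj_mul {P : E →L[ℝ] E} (hP : IsGr S k P) : S.starProjection * P = P :=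
  ContinuousLinearMap.ext hP.proj_apply

lemma IsGr.mul_proj {P : E →L[ℝ] E} (hP : IsGr S k P) : P * S.starProjection = P :=
  ContinuousLinearMap.ext hP.apply_proj

section

variable {P Q : E →L[ℝ] E} (hP : IsGr S k P) (hQ : IsGr S k Q)

include hP hQ

lemma intertwine_self : intertwine Q Q = 1 := by
  rw [intertwine, sub_mul, mul_sub, mul_sub, hQ.mul_self]; noncomm_ring

lemma intertwine_mul : intertwine P Q * Q = P * intertwine P Q := by
  have h1 : intertwine P Q * Q = P * Q := by
    rw [intertwine, add_mul, mul_assoc, mul_assoc, sub_mul 1 Q Q, hQ.mul_self]; simp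
  have h2 : P * intertwine P Q = P * Q := by
    rw [intertwine, mul_add, ← mul_assoc, ← mul_assoc, mul_sub P 1 P, hP.mul_self]; simp
  rw [h1, h2]

lemma intertwine_mul_proj :
    intertwine P Q * S.starProjection = S.starProjection * intertwine P Q := by
  simp only [intertwine, add_mul, mul_add, mul_assoc, sub_mul, mul_sub, one_mul, mul_one,
    hQ.mul_proj]
  simp only [← mul_assoc, hP.proj_mul, hP.mul_proj, hQ.proj_mul]

lemma intertwine_apply {x : E} (hx : x ∈ S) (hQx : Q x = 0) :
    intertwine P Q x ∈ S ∧ P (intertwine P Q x) = 0 := by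
  have h1 := congrArg (fun T : E →L[ℝ] E => T x) (intertwine_mul_proj hP hQ)
  have h2 := congrArg (fun T : E →L[ℝ] E => T x) (intertwine_mul hP hQ)
  simp only [mul_apply_eq_comp, Submodule.starProjection_eq_self_iff.2 hx,
    hQx, map_zero] at h1 h2
  exact ⟨Submodule.starProjection_eq_self_iff.1 h1.symm, h2.symm⟩

lemma intertwine_inverse_apply (hu : IsUnit (intertwine P Q)) {x : E} (hx : x ∈ S)
    (hPx : P x = 0) : Ring.inverse (intertwine P Q) x ∈ S ∧
      Q (Ring.inverse (intertwine P Q) x) = 0 := by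
  set J := Ring.inverse (intertwine P Q) with hJ
  have hl : J * intertwine P Q = 1 := Ring.inverse_mul_cancel _ hu
  have hr : intertwine P Q * J = 1 := Ring.mul_inverse_cancel _ hu
  have h1 : S.starProjection * J = J * S.starProjection := by
    calc S.starProjection * J = J * intertwine P Q * S.starProjection * J := by rw [hl, one_mul]
      _ = J * (intertwine P Q * S.starProjection) * J := by simp only [mul_assoc]
      _ = J * S.starProjection * (intertwine P Q * J) := by
        rw [intertwine_mul_proj hP hQ]; simp only [mul_assoc]
      _ = J * S.starProjection := by rw [hr, mul_one]
  have h2 : Q * J = J * P := by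
    calc Q * J = J * intertwine P Q * Q * J := by rw [hl, one_mul]
      _ = J * (intertwine P Q * Q) * J := by simp only [mul_assoc]
      _ = J * P * (intertwine P Q * J) := by
        rw [intertwine_mul hP hQ]; simp only [mul_assoc]
      _ = J * P := by rw [hr, mul_one]
  have h3 := congrArg (fun T : E →L[ℝ] E => T x) h1
  have h4 := congrArg (fun T : E →L[ℝ] E => T x) h2
  simp only [mul_apply_eq_comp, Submodule.starProjection_eq_self_iff.2 hx,
    hPx, map_zero] at h3 h4
  exact ⟨Submodule.starProjection_eq_self_iff.1 h3, h4⟩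

end

lemma IsGr.finrank_inf_ker {P : E →L[ℝ] E} (hP : IsGr S k P) (hkl : k + l = Module.finrank ℝ S) :
    Module.finrank ℝ (S ⊓ (P : E →ₗ[ℝ] E).ker : Submodule ℝ E) = l := by
  have h1 := (hP.compl hkl)
  rw [← h1.finrank_range]
  suffices h : S ⊓ (P : E →ₗ[ℝ] E).ker = (S.starProjection - P : E →L[ℝ] E).range by rw [h]
  ext x
  constructor
  · rintro ⟨hx, hx'⟩
    exact ⟨x, by simpa [Submodule.starProjection_eq_self_iff.2 hx] using hx'⟩
  · rintro ⟨y, rfl⟩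
    refine ⟨h1.mem y, ?_⟩
    simp [hP.idem, hP.apply_proj]

/-- Linear coordinates on the orthogonal complement in `S` of a subspace. -/
lemma IsGr.exists_coord {P : E →L[ℝ] E} (hP : IsGr S k P) (hkl : k + l = Module.finrank ℝ S) :
    ∃ (f : EuclideanSpace ℝ (Fin l) →L[ℝ] E) (g : E →L[ℝ] EuclideanSpace ℝ (Fin l)),
      (∀ v, g (f v) = v) ∧ (∀ v, f v ∈ S ∧ P (f v) = 0) ∧
        ∀ x ∈ S, P x = 0 → f (g x) = x := by
  set K : Submodule ℝ E := S ⊓ (P : E →ₗ[ℝ] E).ker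
  have hK : Module.finrank ℝ (EuclideanSpace ℝ (Fin l)) = Module.finrank ℝ K := by
    rw [finrank_euclideanSpace_fin, hP.finrank_inf_ker hkl]
  let φ := ContinuousLinearEquiv.ofFinrankEq hK
  obtain ⟨q, hq⟩ := K.subtype.exists_leftInverse_of_injective K.ker_subtype
  have hq' : ∀ x (hx : x ∈ K), q x = ⟨x, hx⟩ := fun x hx => LinearMap.congr_fun hq ⟨x, hx⟩
  refine ⟨K.subtypeL ∘L (φ : _ →L[ℝ] _), (φ.symm : K →L[ℝ] _) ∘L q.toContinuousLinearMap,
    fun v => ?_, fun v => ?_, fun x hx hx' => ?_⟩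
  · simp [hq' _ (φ v).2]
  · exact (φ v).2
  · simp [hq' x ⟨hx, hx'⟩]

lemma Flag.locTrivial (hkl : k + l = Module.finrank ℝ S) :
    (Flag.bundle S k).LocTrivial (EuclideanSpace ℝ (Fin l)) := by
  intro Q
  obtain ⟨f, g, hgf, hf, hfg⟩ := Q.2.exists_coord hkl
  have hcont : Continuous fun P : Gr S k => intertwine P.1 Q.1 :=
    (continuous_intertwine Q.1).comp continuous_subtype_val
  refine ⟨{P | IsUnit (intertwine P.1 Q.1)}, Units.isOpen.preimage hcont, ?_, fun O hO hO' => ?_⟩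
  · change IsUnit (intertwine Q.1 Q.1)
    rw [intertwine_self Q.2 Q.2]
    exact isUnit_one
  have hinv : Continuous fun P : O => Ring.inverse (intertwine P.1.1 Q.1) := by
    refine continuous_iff_continuousAt.2 fun P => ?_
    obtain ⟨u, hu⟩ := hO P.2
    have h1 := NormedRing.inverse_continuousAt u
    rw [hu] at h1
    exact ContinuousAt.comp (f := fun P : O => intertwine P.1.1 Q.1) h1
      (hcont.comp continuous_subtype_val).continuousAt
  have hl : ∀ (P : O) x, Ring.inverse (intertwine P.1.1 Q.1) (intertwine P.1.1 Q.1 x) = x :=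
    fun P x => congrArg (fun T : E →L[ℝ] E => T x) (Ring.inverse_mul_cancel _ (hO P.2))
  have hr : ∀ (P : O) x, intertwine P.1.1 Q.1 (Ring.inverse (intertwine P.1.1 Q.1) x) = x :=
    fun P x => congrArg (fun T : E →L[ℝ] E => T x) (Ring.mul_inverse_cancel _ (hO P.2))
  refine ⟨{
    toFun := fun z => ⟨⟨(z.1.1.1, intertwine z.1.1.1 Q.1 (f z.2.1)), z.1.1.2,
      (intertwine_apply z.1.1.2 Q.2 (hf _).1 (hf _).2).1,
      (intertwine_apply z.1.1.2 Q.2 (hf _).1 (hf _).2).2, fun h0 => z.2.2 ?_⟩, z.1.2⟩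
    invFun := fun q => (⟨(Flag.bundle S k).p q.1, q.2⟩,
      ⟨g (Ring.inverse (intertwine q.1.1.1 Q.1) q.1.1.2), fun h0 => q.1.2.2.2.2 ?_⟩)
    left_inv := fun z => ?_
    right_inv := fun q => ?_
    continuous_toFun := ?_
    continuous_invFun := ?_ }, fun z => rfl, fun z => ?_⟩
  · rw [← hgf z.2.1, ← hl z.1 (f z.2.1)]
    exact (congrArg _ (congrArg _ h0)).trans (by simp)
  · have h1 := intertwine_inverse_apply q.1.2.1 Q.2 (hO q.2) q.1.2.2.1 q.1.2.2.2.1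
    rw [← hr ⟨(Flag.bundle S k).p q.1, q.2⟩ q.1.1.2]
    refine (congrArg _ (hfg _ h1.1 h1.2).symm).trans ?_
    rw [h0, map_zero, map_zero]
  · refine Prod.ext rfl (Subtype.ext ?_)
    exact (congrArg g (hl z.1 (f z.2.1))).trans (hgf _)
  · refine Subtype.ext (Subtype.ext (Prod.ext rfl ?_))
    have h1 := intertwine_inverse_apply q.1.2.1 Q.2 (hO q.2) q.1.2.2.1 q.1.2.2.2.1
    exact (congrArg _ (hfg _ h1.1 h1.2)).trans (hr ⟨(Flag.bundle S k).p q.1, q.2⟩ q.1.1.2)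
  · refine .subtype_mk (.subtype_mk (.prodMk (by fun_prop) ?_) _) _
    exact (hcont.comp (continuous_subtype_val.comp continuous_fst)).clm_apply (by fun_prop)
  · have h1 : Continuous fun q : (Flag.bundle S k).p ⁻¹' O =>
        Ring.inverse (intertwine q.1.1.1 Q.1) :=
      hinv.comp (f := fun q : (Flag.bundle S k).p ⁻¹' O => (⟨(Flag.bundle S k).p q.1, q.2⟩ : O))
        (by fun_prop)
    refine .prodMk (by fun_prop) (.subtype_mk ?_ _)
    exact g.continuous.comp (h1.clm_apply (by fun_prop))
  · refine Subtype.ext (Prod.ext rfl ?_)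
    change -(intertwine z.1.1.1 Q.1 (f z.2.1)) = intertwine z.1.1.1 Q.1 (f (-z.2.1))
    rw [map_neg, map_neg]

theorem Flag.neg_of_even (hkl : k + l = Module.finrank ℝ S) (h0 : 0 < l) (hl : Even l) (n : ℕ)
    (x : H n (Flag S k)) : H.map n (Flag.neg S k) x = x :=
  InvBundle.map_a_of_even (Flag.locTrivial hkl) finrank_euclideanSpace_fin h0 hl n x

theorem Flag.fst_surjective_of_odd (hkl : k + l = Module.finrank ℝ S) (hl : Odd l) (n : ℕ) :
    Function.Surjective (H.map n (Flag.fst S k)) :=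
  InvBundle.map_p_surjective_of_odd (Flag.locTrivial hkl) finrank_euclideanSpace_fin hl n

theorem Flag.neg_of_odd (hkl : k + l = Module.finrank ℝ S) (hl : Odd l) (n : ℕ)
    (x : H n (Flag S k)) (hx : H.map n (Flag.fst S k) x = 0) : H.map n (Flag.neg S k) x = -x :=
  InvBundle.map_a_of_odd (Flag.locTrivial hkl) finrank_euclideanSpace_fin hl n x hx

end RatHomology

namespace RatHomology

open Topology InnerProductSpace

open scoped RealInnerProductSpace

variable {E : Type} [NormedAddCommGroup E] [InnerProductSpace ℝ E] [FiniteDimensional ℝ E]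
  {S S' S'' T : Submodule ℝ E} {e f : E} {k l : ℕ}

lemma combo_ne_zero {u v : E} (hu : u ≠ 0) (hv : v ≠ 0) (h : ⟪u, v⟫ = 0) (t : ℝ) :
    (1 - t) • u + t • v ≠ 0 := by
  intro h0
  have h1 : ⟪u, (1 - t) • u + t • v⟫ = 0 := by rw [h0, inner_zero_right]
  have h2 : ⟪v, (1 - t) • u + t • v⟫ = 0 := by rw [h0, inner_zero_right]
  rw [inner_add_right, inner_smul_right, inner_smul_right, h, mul_zero, add_zero, mul_eq_zero,
    inner_self_eq_zero] at h1
  rw [inner_add_right, inner_smul_right, inner_smul_right, real_inner_comm, h, mul_zero, zero_add,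
    mul_eq_zero, inner_self_eq_zero] at h2
  have h3 := h1.resolve_right hu
  have h4 := h2.resolve_right hv
  linarith

lemma Flag.map_conj_refl {u v : E} (hu : u ∈ S) (hv : v ∈ S) (hu0 : u ≠ 0) (hv0 : v ≠ 0)
    (h : ⟪u, v⟫ = 0) (n : ℕ) :
    H.map n (Flag.conj (k := k) (isOrth_refl hu)) = H.map n (Flag.conj (isOrth_refl hv)) := by
  refine H.map_congr_of_continuous (fun p : unitInterval × Flag S k => Flag.conj (isOrth_refl
    (S.add_mem (S.smul_mem (1 - (p.1 : ℝ)) hu) (S.smul_mem (p.1 : ℝ) hv))) p.2) ?_ ?_ ?_ n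
  · have : Continuous fun p : unitInterval × Flag S k =>
        refl ((1 - (p.1 : ℝ)) • u + (p.1 : ℝ) • v) :=
      Continuous.refl (by fun_prop) fun p => combo_ne_zero hu0 hv0 h p.1
    exact .subtype_mk (by fun_prop) _
  · intro x
    simp [Flag.conj]
  · intro x
    simp [Flag.conj]

/-- The isometry which is `-1` on `T` and the identity on its complement. -/
noncomputable def negOn (T : Submodule ℝ E) : E →L[ℝ] E := 1 - (2 : ℝ) • T.starProjection

lemma negOn_apply (T : Submodule ℝ E) (x : E) :
    negOn T x = x - (2 : ℝ) • T.starProjection x := by simp [negOn]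

lemma isOrth_negOn (h : T ≤ S) : IsOrth S (negOn T) (negOn T) where
  adj x y := by
    simp [negOn_apply, inner_sub_left, inner_sub_right, inner_smul_left, inner_smul_right,
      Submodule.inner_starProjection_left_eq_right]
  inv x := by
    have := (isGr_proj T).idem x
    simp only [negOn_apply, map_sub, map_smul, this]
    module
  mem x hx := by
    rw [negOn_apply]
    exact S.sub_mem hx (S.smul_mem _ (h (T.starProjection_apply_mem x)))

lemma IsCut.negOn_eq (h : IsCut S e S') (x : E) : negOn S x = refl e (negOn S' x) := by
  have : pr e (S'.starProjection x) = 0 :=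
    pr_eq_zero (h.inner_eq_zero (S'.starProjection_apply_mem x))
  simp only [negOn_apply, refl_apply, h.starProjection, map_sub, map_smul, this,
    add_apply]
  module

lemma IsCut.refl_negOn (h : IsCut S e S') (x : E) : refl e (negOn S' x) = negOn S' (refl e x) := by
  have h1 : pr e (S'.starProjection x) = 0 :=
    pr_eq_zero (h.inner_eq_zero (S'.starProjection_apply_mem x))
  have h2 : S'.starProjection (pr e x) = 0 := by
    rw [pr_apply, map_smul, h.proj_apply_eq_zero (isGr_proj S'), smul_zero]
  simp only [negOn_apply, refl_apply, map_sub, map_smul, h1, h2]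
  module

lemma Flag.conj_negOn (h : IsCut T e S') (hT : T ≤ S) :
    Flag.conj (k := k) (isOrth_negOn hT) =
      (Flag.conj (isOrth_refl (hT h.mem))).comp (Flag.conj (isOrth_negOn (h.le.trans hT))) := by
  refine ContinuousMap.ext fun q => Subtype.ext (Prod.ext ?_ ?_)
  · ext x
    simp [Flag.conj, h.negOn_eq, h.refl_negOn]
  · simp [Flag.conj, h.negOn_eq]

lemma Flag.conj_conj_refl {u : E} (hu : u ∈ S) :
    (Flag.conj (k := k) (isOrth_refl hu)).comp (Flag.conj (isOrth_refl hu)) =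
      ContinuousMap.id _ := by
  refine ContinuousMap.ext fun q => Subtype.ext (Prod.ext ?_ ?_)
  · ext x
    simp [Flag.conj]
  · simp [Flag.conj]

lemma Flag.map_conj_negOn (p : ℕ) (hT : T ≤ S) (hp : Module.finrank ℝ T = 2 * p) (n : ℕ) :
    H.map n (Flag.conj (k := k) (isOrth_negOn hT)) = LinearMap.id := by
  induction p generalizing T with
  | zero =>
    obtain rfl : T = ⊥ := Submodule.finrank_eq_zero.1 (by simpa using hp)
    rw [← H.map_id]
    congr 1
    refine ContinuousMap.ext fun q => Subtype.ext (Prod.ext ?_ ?_)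
    · ext x
      simp [Flag.conj, negOn]
    · simp [Flag.conj, negOn]
  | succ p ih =>
    obtain ⟨u, T', hu⟩ := exists_isCut (S := T) (by omega)
    have h1 := hu.finrank
    obtain ⟨v, T'', hv⟩ := exists_isCut (S := T') (by omega)
    have h2 := hv.finrank
    have h3 := hT (hu.le hv.mem)
    rw [Flag.conj_negOn hu hT, Flag.conj_negOn hv (hu.le.trans hT), H.map_comp, H.map_comp,
      ih (hv.le.trans (hu.le.trans hT)) (by omega), LinearMap.comp_id,
      Flag.map_conj_refl (hT hu.mem)
      h3 hu.ne_zero hv.ne_zero (hu.inner_eq_zero hv.mem), ← H.map_comp,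
      Flag.conj_conj_refl h3, H.map_id]

lemma Flag.neg_eq_conj : Flag.neg S k = Flag.conj (isOrth_negOn le_rfl) := by
  refine ContinuousMap.ext fun q => Subtype.ext (Prod.ext ?_ ?_)
  · ext x
    simp [Flag.conj, Flag.neg, negOn_apply, q.2.1.apply_proj, q.2.1.proj_apply]
    module
  · simp only [Flag.conj, Flag.neg, ContinuousMap.coe_mk, negOn_apply,
      Submodule.starProjection_eq_self_iff.2 q.2.2.1]
    module

/-- In an even-dimensional space, reversing the vector acts trivially in homology. -/
theorem Flag.map_neg_of_even (hS : Even (Module.finrank ℝ S)) (n : ℕ) :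
    H.map n (Flag.neg S k) = LinearMap.id := by
  obtain ⟨p, hp⟩ := hS
  rw [Flag.neg_eq_conj, Flag.map_conj_negOn p le_rfl (by omega)]

/-- In an odd-dimensional space, reversing the vector acts as a reflection in homology. -/
theorem Flag.map_neg_of_odd (hS : Even (Module.finrank ℝ S')) (h : IsCut S e S') (n : ℕ) :
    H.map n (Flag.neg S k) = H.map n (Flag.conj (isOrth_refl h.mem)) := by
  obtain ⟨p, hp⟩ := hS
  rw [Flag.neg_eq_conj, Flag.conj_negOn h le_rfl, H.map_comp, Flag.map_conj_negOn p h.le (by omega),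
    LinearMap.comp_id]

end RatHomology

namespace RatHomology

section

variable {I A B X I' A' B' : Type} [TopologicalSpace I] [TopologicalSpace A] [TopologicalSpace B]
  [TopologicalSpace X] [TopologicalSpace I'] [TopologicalSpace A'] [TopologicalSpace B']

/-- A Mayer-Vietoris sequence in homology, attached to maps which need not be inclusions. -/
structure MVSeq (f : C(I, A)) (g : C(I, B)) (p : C(A, X)) (q : C(B, X)) where
  δ (n : ℕ) : H (n + 1) X →ₗ[ℚ] H n I
  comm {n : ℕ} (x : H n I) : H.map n p (H.map n f x) = H.map n q (H.map n g x)
  f_δ {n : ℕ} (x : H (n + 1) X) : H.map n f (δ n x) = 0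
  g_δ {n : ℕ} (x : H (n + 1) X) : H.map n g (δ n x) = 0
  δ_p {n : ℕ} (x : H (n + 1) A) : δ n (H.map (n + 1) p x) = 0
  δ_q {n : ℕ} (x : H (n + 1) B) : δ n (H.map (n + 1) q x) = 0
  exists_eq_add {n : ℕ} {z : H (n + 1) X} (h : δ n z = 0) :
    ∃ x y, H.map (n + 1) p x + H.map (n + 1) q y = z
  exists_eq_add_zero (z : H 0 X) : ∃ x y, H.map 0 p x + H.map 0 q y = z
  exists_δ_eq {n : ℕ} {c : H n I} (hf : H.map n f c = 0) (hg : H.map n g c = 0) : ∃ z, δ n z = c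
  exists_of_eq {n : ℕ} {x : H n A} {y : H n B} (h : H.map n p x = H.map n q y) :
    ∃ c, H.map n f c = x ∧ H.map n g c = y

/-- Transport of the Mayer-Vietoris sequence along homology isomorphisms. -/
noncomputable def MVSquare.toSeq (S : MVSquare I A B X) {ι : C(I', I)} {α : C(A', A)} {β : C(B', B)}
    (hι : ∀ n, Function.Bijective (H.map n ι)) (hα : ∀ n, Function.Bijective (H.map n α))
    (hβ : ∀ n, Function.Bijective (H.map n β)) {f : C(I', A')} {g : C(I', B')}
    (hf : ∀ n, H.map n (S.iA.comp ι) = H.map n (α.comp f))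
    (hg : ∀ n, H.map n (S.iB.comp ι) = H.map n (β.comp g))
    {p : C(A', X)} {q : C(B', X)} (hp : S.jA.comp α = p) (hq : S.jB.comp β = q) :
    MVSeq f g p q :=
  have hf' (n : ℕ) (x : H n I') : H.map n S.iA (H.map n ι x) = H.map n α (H.map n f x) := by
    rw [H.map_map, H.map_map, hf]
  have hg' (n : ℕ) (x : H n I') : H.map n S.iB (H.map n ι x) = H.map n β (H.map n g x) := by
    rw [H.map_map, H.map_map, hg]
  have hp' (n : ℕ) (x : H n A') : H.map n p x = H.map n S.jA (H.map n α x) := by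
    rw [H.map_map, hp]
  have hq' (n : ℕ) (x : H n B') : H.map n q x = H.map n S.jB (H.map n β x) := by
    rw [H.map_map, hq]
  have hδ (n : ℕ) (x : H (n + 1) X) :
      H.map n ι ((LinearEquiv.ofBijective (H.map n ι) (hι n)).symm (S.δ n x)) = S.δ n x :=
    (LinearEquiv.ofBijective (H.map n ι) (hι n)).apply_symm_apply _
  { δ := fun n => (LinearEquiv.ofBijective (H.map n ι) (hι n)).symm.toLinearMap.comp (S.δ n)
    comm := fun x => by rw [hp', hq', ← hf', ← hg', S.map_comm]
    f_δ := fun {n} x => (hα n).1 (by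
      rw [← hf', LinearMap.comp_apply, LinearEquiv.coe_coe, hδ, S.iA_δ, map_zero])
    g_δ := fun {n} x => (hβ n).1 (by
      rw [← hg', LinearMap.comp_apply, LinearEquiv.coe_coe, hδ, S.iB_δ, map_zero])
    δ_p := fun x => by rw [hp', LinearMap.comp_apply, S.δ_jA, map_zero]
    δ_q := fun x => by rw [hq', LinearMap.comp_apply, S.δ_jB, map_zero]
    exists_eq_add := fun {n z} h => by
      obtain ⟨x, y, hxy⟩ := S.exists_eq_add_of_δ_eq_zero
        ((hδ n z).symm.trans ((congrArg (H.map n ι) h).trans (map_zero _)))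
      obtain ⟨x, rfl⟩ := (hα _).2 x
      obtain ⟨y, rfl⟩ := (hβ _).2 y
      exact ⟨x, y, by rw [hp', hq', hxy]⟩
    exists_eq_add_zero := fun z => by
      obtain ⟨x, y, hxy⟩ := S.exists_eq_add_zero z
      obtain ⟨x, rfl⟩ := (hα _).2 x
      obtain ⟨y, rfl⟩ := (hβ _).2 y
      exact ⟨x, y, by rw [hp', hq', hxy]⟩
    exists_δ_eq := fun {n c} h h' => by
      obtain ⟨z, hz⟩ := S.exists_δ_eq (c := H.map n ι c) (by rw [hf', h, map_zero])
        (by rw [hg', h', map_zero])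
      exact ⟨z, (hι n).1 ((hδ n z).trans hz)⟩
    exists_of_eq := fun {n x y} h => by
      rw [hp', hq'] at h
      obtain ⟨c, hc, hc'⟩ := S.exists_of_jA_eq_jB h
      obtain ⟨c, rfl⟩ := (hι _).2 c
      rw [hf'] at hc
      rw [hg'] at hc'
      exact ⟨c, (hα n).1 hc, (hβ n).1 hc'⟩ }

lemma MVSquare.map_toSeq_δ (S : MVSquare I A B X) {ι : C(I', I)} {α : C(A', A)} {β : C(B', B)}
    (hι : ∀ n, Function.Bijective (H.map n ι)) (hα : ∀ n, Function.Bijective (H.map n α))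
    (hβ : ∀ n, Function.Bijective (H.map n β)) {f : C(I', A')} {g : C(I', B')}
    (hf : ∀ n, H.map n (S.iA.comp ι) = H.map n (α.comp f))
    (hg : ∀ n, H.map n (S.iB.comp ι) = H.map n (β.comp g))
    {p : C(A', X)} {q : C(B', X)} (hp : S.jA.comp α = p) (hq : S.jB.comp β = q) {n : ℕ}
    (x : H (n + 1) X) :
    H.map n ι ((S.toSeq hι hα hβ hf hg hp hq).δ n x) = S.δ n x :=
  (LinearEquiv.ofBijective (H.map n ι) (hι n)).apply_symm_apply _

namespace MVSeq

variable {f : C(I, A)} {g : C(I, B)} {p : C(A, X)} {q : C(B, X)}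

lemma bijective_p (D : MVSeq f g p q) (hg : ∀ n, Function.Bijective (H.map n g)) (n : ℕ) :
    Function.Bijective (H.map n p) := by
  refine ⟨(injective_iff_map_eq_zero _).2 fun x hx => ?_, fun z => ?_⟩
  · obtain ⟨c, rfl, hc⟩ := D.exists_of_eq (y := 0) (hx.trans (map_zero _).symm)
    rw [(map_eq_zero_iff _ (hg n).1).1 hc, map_zero]
  · have key : ∃ x y, H.map n p x + H.map n q y = z := by
      cases n with
      | zero => exact D.exists_eq_add_zero z
      | succ n =>
        exact D.exists_eq_add ((map_eq_zero_iff _ (hg n).1).1 (D.g_δ z))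
    obtain ⟨x, y, rfl⟩ := key
    obtain ⟨c, rfl⟩ := (hg n).2 y
    exact ⟨x + H.map n f c, by rw [map_add, D.comm]⟩

end MVSeq

end

end RatHomology

namespace RatHomology

open Topology InnerProductSpace

open scoped RealInnerProductSpace

variable {E : Type} [NormedAddCommGroup E] [InnerProductSpace ℝ E] [FiniteDimensional ℝ E]
  {S S' S'' T : Submodule ℝ E} {e f : E} {k l : ℕ}

lemma pr_apply_ne_zero {u x : E} (h : ⟪u, x⟫ ≠ 0) : pr u x ≠ 0 := by
  intro h0
  have : ⟪pr u x, u⟫ = 0 := by rw [h0, inner_zero_left]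
  obtain rfl | hu := eq_or_ne u 0
  · exact h (inner_zero_left _)
  · rw [pr_symm, pr_self hu, real_inner_comm] at this
    exact h this

lemma inner_ne_zero_left {u x : E} (h : ⟪u, x⟫ ≠ 0) : u ≠ 0 := by
  rintro rfl; exact h (inner_zero_left _)

namespace IsGr

variable {P : E →L[ℝ] E}

lemma inner_apply_self (hP : IsGr S k P) (x : E) : ⟪P x, x⟫ = ‖P x‖ ^ 2 := by
  rw [← real_inner_self_eq_norm_sq, hP.symm x (P x), hP.idem, hP.symm]

lemma inner_apply_self' (hP : IsGr S k P) (x : E) : ⟪x, P x⟫ = ‖P x‖ ^ 2 := by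
  rw [real_inner_comm, hP.inner_apply_self]

lemma norm_sub_sq (hP : IsGr S k P) (x : E) : ‖x - P x‖ ^ 2 = ‖x‖ ^ 2 - ‖P x‖ ^ 2 := by
  rw [norm_sub_sq_real, hP.inner_apply_self']; ring

/-- The part of `P` orthogonal to `P e`. -/
lemma reduce (hP : IsGr S (k + 1) P) (h : IsCut S e S') (he : P e ≠ 0) :
    IsGr S' k (P - pr (P e)) := by
  refine h.isGr_of_apply_eq_zero (hP.sub_pr he (hP.idem e)) ?_
  rw [sub_apply, pr_apply, hP.inner_apply_self,
    inv_mul_cancel₀ (pow_ne_zero 2 (norm_ne_zero_iff.2 he)), one_smul, sub_self]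

/-- The sum of `P` and `e`. -/
lemma enlarge (hP : IsGr S k P) (h : IsCut S e S') (he : P e ≠ e) :
    IsGr S (k + 1) (P + pr (e - P e)) :=
  hP.add_pr (S.sub_mem h.mem (hP.mem e)) (sub_ne_zero.2 he.symm) (by rw [map_sub, hP.idem, sub_self])

lemma enlarge_apply (hP : IsGr S k P) (he : P e ≠ e) (t : ℝ) :
    (P + pr (e - P e)) (e - t • P e) = e - t • P e := by
  have h1 : pr (e - P e) (P e) = 0 := hP.pr_apply_of_mem (by rw [map_sub, hP.idem, sub_self]) e
  have h2 : pr (e - P e) e = e - P e := by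
    have := pr_self (sub_ne_zero.2 he.symm)
    rwa [map_sub, h1, sub_zero] at this
  rw [add_apply, map_sub, map_smul, hP.idem, map_sub, map_smul, h1, h2]
  module

lemma norm_apply_lt (hP : IsGr S k P) (h : IsCut S e S') (he : P e ≠ e) : ‖P e‖ ^ 2 < 1 := by
  have h1 := hP.norm_sub_sq e
  have h2 : 0 < ‖e - P e‖ ^ 2 := by have := norm_pos_iff.2 (sub_ne_zero.2 he.symm); positivity
  rw [h.norm] at h1
  linarith

lemma inner_sub_pos (hP : IsGr S k P) (h : IsCut S e S') (he : P e ≠ e) (t : unitInterval) :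
    0 < ⟪e - (t : ℝ) • P e, e⟫ := by
  rw [inner_sub_left, inner_smul_left, hP.inner_apply_self, h.inner_self, conj_trivial]
  have := hP.norm_apply_lt h he
  nlinarith [t.2.1, t.2.2, sq_nonneg ‖P e‖]

lemma retract (hP : IsGr S (k + 1) P) (h : IsCut S e S') (he : P e ≠ e) (t : unitInterval) :
    IsGr S (k + 1) (P + pr (e - P e) - pr (e - (t : ℝ) • P e)) :=
  (hP.enlarge h he).sub_pr (inner_ne_zero_left (hP.inner_sub_pos h he t).ne')
    (hP.enlarge_apply he _)

lemma retract_apply (hP : IsGr S (k + 1) P) (h : IsCut S e S') (he : P e ≠ e) (t : unitInterval) :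
    (P + pr (e - P e) - pr (e - (t : ℝ) • P e)) e ≠ e := by
  have h1 := hP.enlarge_apply he 0
  rw [zero_smul, sub_zero] at h1
  rw [sub_apply, h1, Ne, sub_eq_self]
  exact pr_apply_ne_zero (hP.inner_sub_pos h he t).ne'

end IsGr

namespace Gr

/-- The subspaces not containing `e`. -/
def avoid (S : Submodule ℝ E) (k : ℕ) (e : E) : Set (Gr S k) := {P | P.1 e ≠ e}

/-- The subspaces not orthogonal to `e`. -/
def meet (S : Submodule ℝ E) (k : ℕ) (e : E) : Set (Gr S k) := {P | P.1 e ≠ 0}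

lemma isOpen_avoid (e : E) : IsOpen (avoid S k e) := isOpen_ne_fun (by fun_prop) (by fun_prop)

lemma isOpen_meet (e : E) : IsOpen (meet S k e) := isOpen_ne_fun (by fun_prop) (by fun_prop)

variable (h : IsCut S e S')

include h in
lemma avoid_or_meet (P : Gr S k) : P ∈ avoid S k e ∨ P ∈ meet S k e := by
  by_contra! h'
  obtain ⟨h1, h2⟩ := h'
  rw [avoid, Set.mem_ofPred_eq, not_not] at h1
  rw [meet, Set.mem_ofPred_eq, not_not] at h2
  exact h.ne_zero (h1.symm.trans h2)

include h in
lemma combo_isGr {A : E →L[ℝ] E} (hA : IsGr S' k A) {w : E} (hw : w ∈ S') (hAw : A w = 0)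
    {v : E} {s t : ℝ} (hv : v = s • e + t • w) (h0 : v ≠ 0) : IsGr S (k + 1) (A + pr v) := by
  subst hv
  refine (hA.mono h.le).add_pr ?_ h0 ?_
  · exact S.add_mem (S.smul_mem _ h.mem) (S.smul_mem _ (h.le hw))
  · rw [map_add, map_smul, map_smul, hAw, h.proj_apply_eq_zero hA, smul_zero, smul_zero, add_zero]

include h in
lemma inner_combo {w : E} (hw : w ∈ S') (s t : ℝ) : ⟪s • e + t • w, e⟫ = s := by
  rw [inner_add_left, inner_smul_left, inner_smul_left, h.inner_self, real_inner_comm,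
    h.inner_eq_zero hw]
  simp

include h in
lemma inner_combo' {w : E} (hw : w ∈ S') (s t : ℝ) : ⟪s • e + t • w, w⟫ = t * ‖w‖ ^ 2 := by
  rw [inner_add_left, inner_smul_left, inner_smul_left, h.inner_eq_zero hw,
    real_inner_self_eq_norm_sq]
  simp

include h in
lemma pr_combo_ne {w : E} (hw : w ∈ S') (h0 : w ≠ 0) (s t : ℝ) (ht : t ≠ 0) :
    pr (s • e + t • w) e ≠ e := by
  intro h1
  have h2 : ⟪pr (s • e + t • w) e, w⟫ = 0 := by rw [h1, h.inner_eq_zero hw]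
  have h3 := norm_ne_zero_iff.2 h0
  have h4 : s • e + t • w ≠ 0 := inner_ne_zero_left (x := w) (by rw [inner_combo' h hw]; positivity)
  have h5 := norm_ne_zero_iff.2 h4
  rw [pr_apply, inner_smul_left, inner_combo' h hw, inner_combo h hw] at h2
  obtain rfl : s = 0 := by
    simpa [h3, ht, h5] using h2
  rw [pr_apply, inner_combo h hw, mul_zero, zero_smul] at h1
  exact h.ne_zero h1.symm

/-- The subspaces spanned by a subspace of `S'` and a vector neither in `S'` nor a multiple of
`e`. -/
noncomputable def ofFlag (k : ℕ) (h : IsCut S e S') :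
    C(Flag S' k, (avoid S (k + 1) e ∩ meet S (k + 1) e : Set _)) :=
  have h0 (q : Flag S' k) : ⟪(1 : ℝ) • e + (1 : ℝ) • q.1.2, e⟫ ≠ 0 := by
    rw [inner_combo h q.2.2.1]; exact one_ne_zero
  have hA (q : Flag S' k) : (q.1.1 + pr ((1 : ℝ) • e + (1 : ℝ) • q.1.2)) e =
      pr ((1 : ℝ) • e + (1 : ℝ) • q.1.2) e := by
    rw [add_apply, h.proj_apply_eq_zero q.2.1, zero_add]
  ⟨fun q => ⟨⟨q.1.1 + pr ((1 : ℝ) • e + (1 : ℝ) • q.1.2),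
    combo_isGr h q.2.1 q.2.2.1 q.2.2.2.1 rfl (inner_ne_zero_left (h0 q))⟩,
    (hA q).trans_ne (pr_combo_ne h q.2.2.1 q.2.2.2.2 1 1 one_ne_zero),
    (hA q).trans_ne (pr_apply_ne_zero (h0 q))⟩, by
    have : Continuous fun q : Flag S' k => pr ((1 : ℝ) • e + (1 : ℝ) • q.1.2) :=
      Continuous.pr (by fun_prop) fun q => inner_ne_zero_left (h0 q)
    exact .subtype_mk (.subtype_mk (by fun_prop) _) _⟩

/-- The inverse of `ofFlag`. -/
noncomputable def toFlag (k : ℕ) (h : IsCut S e S') :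
    C((avoid S (k + 1) e ∩ meet S (k + 1) e : Set _), Flag S' k) :=
  have hP (P : (avoid S (k + 1) e ∩ meet S (k + 1) e : Set _)) : ‖P.1.1 e‖ ^ 2 ≠ 0 :=
    pow_ne_zero 2 (norm_ne_zero_iff.2 P.2.2)
  ⟨fun P => ⟨(P.1.1 - pr (P.1.1 e), (‖P.1.1 e‖ ^ 2)⁻¹ • P.1.1 e - e), P.1.2.reduce h P.2.2, by
      refine (h.iff _).2 ⟨S.sub_mem (S.smul_mem _ (P.1.2.mem e)) h.mem, ?_⟩
      rw [inner_sub_right, inner_smul_right, P.1.2.inner_apply_self', inv_mul_cancel₀ (hP P),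
        h.inner_self, sub_self], by
      have h1 := h.proj_apply_eq_zero (P.1.2.reduce h P.2.2)
      rw [map_sub, map_smul, h1, sub_zero, sub_apply, P.1.2.idem, pr_self P.2.2, sub_self,
        smul_zero], by
      intro h0
      have h2 := congrArg P.1.1 (sub_eq_zero.1 h0)
      rw [map_smul, P.1.2.idem] at h2
      exact P.2.1 (h2.symm.trans (sub_eq_zero.1 h0))⟩, by
    have h1 : Continuous fun P : (avoid S (k + 1) e ∩ meet S (k + 1) e : Set _) => P.1.1 e := by
      fun_prop
    have h2 := h1.pr fun P => P.2.2
    have h3 := Continuous.inv₀ (h1.norm.pow 2) hP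
    exact .subtype_mk (by fun_prop) _⟩

lemma ofFlag_toFlag : (ofFlag k h).comp (toFlag k h) = ContinuousMap.id _ := by
  refine ContinuousMap.ext fun P => Subtype.ext (Subtype.ext ?_)
  have h1 : (‖P.1.1 e‖ ^ 2)⁻¹ ≠ 0 := inv_ne_zero (pow_ne_zero 2 (norm_ne_zero_iff.2 P.2.2))
  simp only [ofFlag, toFlag, ContinuousMap.comp_apply, ContinuousMap.coe_mk, one_smul,
    add_sub_cancel, pr_smul h1, sub_add_cancel, ContinuousMap.id_apply]

lemma toFlag_ofFlag : (toFlag k h).comp (ofFlag k h) = ContinuousMap.id _ := by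
  refine ContinuousMap.ext fun q => Subtype.ext ?_
  have h0 := inner_combo h q.2.2.1 1 1
  have h2 : ((1 : ℝ) • e + (1 : ℝ) • q.1.2) ≠ 0 := inner_ne_zero_left (h0.trans_ne one_ne_zero)
  simp only [one_smul] at h0 h2
  have h3 : (‖e + q.1.2‖ ^ 2)⁻¹ ≠ 0 := inv_ne_zero (pow_ne_zero 2 (norm_ne_zero_iff.2 h2))
  have h4 := norm_ne_zero_iff.2 h2
  have h1 : (q.1.1 + pr (e + q.1.2)) e = (‖e + q.1.2‖ ^ 2)⁻¹ • (e + q.1.2) := by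
    rw [add_apply, h.proj_apply_eq_zero q.2.1, zero_add, pr_apply, h0, mul_one]
  simp only [ofFlag, toFlag, ContinuousMap.comp_apply, ContinuousMap.coe_mk, one_smul,
    ContinuousMap.id_apply, h1, pr_smul h3, add_sub_cancel_right]
  refine Prod.ext rfl ?_
  have h5 : ((‖(‖e + q.1.2‖ ^ 2)⁻¹ • (e + q.1.2)‖ ^ 2)⁻¹ * (‖e + q.1.2‖ ^ 2)⁻¹) = 1 := by
    rw [norm_smul, Real.norm_of_nonneg (by positivity)]
    field_simp
  simp only [smul_smul, h5, one_smul, add_sub_cancel_left]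

/-- Subspaces of `S'` do not contain `e`. -/
noncomputable def toAvoid (k : ℕ) (h : IsCut S e S') : C(Gr S' k, avoid S k e) :=
  ⟨fun P => ⟨Gr.inc k h.le P, fun h0 => h.ne_zero (h0.symm.trans (h.proj_apply_eq_zero P.2))⟩,
    by fun_prop⟩

noncomputable def ofAvoid (k : ℕ) (h : IsCut S e S') : C(avoid S (k + 1) e, Gr S' (k + 1)) :=
  ⟨fun P => ⟨P.1.1 + pr (e - P.1.1 e) - pr e, h.isGr_of_apply_eq_zero
    (by simpa using P.1.2.retract h P.2 0) (by
      have := P.1.2.enlarge_apply P.2 0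
      rw [zero_smul, sub_zero] at this
      rw [sub_apply, this, pr_self h.ne_zero, sub_self])⟩, by
    have : Continuous fun P : avoid S (k + 1) e => pr (e - P.1.1 e) :=
      Continuous.pr (by fun_prop) fun P => sub_ne_zero.2 (Ne.symm P.2)
    fun_prop⟩

lemma toAvoid_bijective (n : ℕ) : Function.Bijective (H.map n (toAvoid (k + 1) h)) := by
  refine H.bijective_of_homotopic (g := ofAvoid k h) ?_ ?_ n
  · have : (ofAvoid k h).comp (toAvoid (k + 1) h) = ContinuousMap.id _ :=
      ContinuousMap.ext fun P => Subtype.ext <| by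
        simp [ofAvoid, toAvoid, Gr.inc, h.proj_apply_eq_zero P.2]
    rw [this]
  · refine homotopic_of_continuous (fun p => ⟨⟨_, p.2.1.2.retract h p.2.2 p.1⟩,
      p.2.1.2.retract_apply h p.2.2 p.1⟩) ?_ ?_ ?_
    · have h1 : Continuous fun p : unitInterval × avoid S (k + 1) e => pr (e - p.2.1.1 e) :=
        Continuous.pr (by fun_prop) fun P => sub_ne_zero.2 (Ne.symm P.2.2)
      have h2 : Continuous fun p : unitInterval × avoid S (k + 1) e =>
          pr (e - (p.1 : ℝ) • p.2.1.1 e) :=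
        Continuous.pr (by fun_prop) fun p =>
          inner_ne_zero_left (p.2.1.2.inner_sub_pos h p.2.2 p.1).ne'
      exact .subtype_mk (.subtype_mk (by fun_prop) _) _
    · intro P
      refine Subtype.ext (Subtype.ext ?_)
      simp [ofAvoid, toAvoid, Gr.inc]
    · intro P
      refine Subtype.ext (Subtype.ext ?_)
      simp

/-- Adding `e` gives subspaces not orthogonal to `e`. -/
noncomputable def toMeet (k : ℕ) (h : IsCut S e S') : C(Gr S' k, meet S (k + 1) e) :=
  ⟨fun P => ⟨Gr.up k h P, by
    rw [meet, Set.mem_ofPred_eq]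
    simpa [Gr.up, h.proj_apply_eq_zero P.2, pr_self h.ne_zero] using h.ne_zero⟩, by fun_prop⟩

noncomputable def ofMeet (k : ℕ) (h : IsCut S e S') : C(meet S (k + 1) e, Gr S' k) :=
  ⟨fun P => ⟨P.1.1 - pr (P.1.1 e), P.1.2.reduce h P.2⟩, by
    have : Continuous fun P : meet S (k + 1) e => pr (P.1.1 e) :=
      Continuous.pr (by fun_prop) fun P => P.2
    fun_prop⟩

lemma toMeet_bijective (n : ℕ) : Function.Bijective (H.map n (toMeet k h)) := by
  refine H.bijective_of_homotopic (g := ofMeet k h) ?_ ?_ n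
  · have : (ofMeet k h).comp (toMeet k h) = ContinuousMap.id _ :=
      ContinuousMap.ext fun P => Subtype.ext <| by
        simp [ofMeet, toMeet, Gr.up, h.proj_apply_eq_zero P.2, pr_self h.ne_zero]
    rw [this]
  · have h1 (P : meet S (k + 1) e) (t : unitInterval) :
        ⟪(1 - (t : ℝ)) • e + (t : ℝ) • P.1.1 e, P.1.1 e⟫ ≠ 0 := by
      have := norm_ne_zero_iff.2 P.2
      rw [inner_add_left, inner_smul_left, inner_smul_left, P.1.2.inner_apply_self',
        real_inner_self_eq_norm_sq, conj_trivial, conj_trivial, ← add_mul, sub_add_cancel, one_mul]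
      positivity
    have h2 (P : meet S (k + 1) e) (t : unitInterval) :
        ⟪(1 - (t : ℝ)) • e + (t : ℝ) • P.1.1 e, e⟫ ≠ 0 := by
      have := norm_pos_iff.2 P.2
      rw [inner_add_left, inner_smul_left, inner_smul_left, P.1.2.inner_apply_self,
        h.inner_self, conj_trivial, conj_trivial, mul_one]
      obtain h0 | h0 := t.2.1.eq_or_lt
      · rw [← h0]; simp
      · have := mul_pos h0 (pow_pos this 2)
        have := t.2.2
        linarith
    have h3 (P : meet S (k + 1) e) (t : unitInterval) :
        (P.1.1 - pr (P.1.1 e)) ((1 - (t : ℝ)) • e + (t : ℝ) • P.1.1 e) = 0 := by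
      rw [map_add, map_smul, map_smul, h.proj_apply_eq_zero (P.1.2.reduce h P.2), sub_apply,
        P.1.2.idem, pr_self P.2, sub_self, smul_zero, smul_zero, add_zero]
    refine homotopic_of_continuous (fun p => ⟨⟨(p.2.1.1 - pr (p.2.1.1 e)) +
      pr ((1 - (p.1 : ℝ)) • e + (p.1 : ℝ) • p.2.1.1 e),
      ((p.2.1.2.reduce h p.2.2).mono h.le).add_pr (S.add_mem (S.smul_mem _ h.mem)
        (S.smul_mem _ (p.2.1.2.mem e))) (inner_ne_zero_left (h1 p.2 p.1)) (h3 p.2 p.1)⟩, ?_⟩)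
      ?_ ?_ ?_
    · refine Eq.trans_ne ?_ (pr_apply_ne_zero (h2 p.2 p.1))
      exact (add_apply _ _ _).trans (by
        rw [h.proj_apply_eq_zero (p.2.1.2.reduce h p.2.2), zero_add])
    · have h4 : Continuous fun p : unitInterval × meet S (k + 1) e => pr (p.2.1.1 e) :=
        Continuous.pr (by fun_prop) fun P => P.2.2
      have h5 : Continuous fun p : unitInterval × meet S (k + 1) e =>
          pr ((1 - (p.1 : ℝ)) • e + (p.1 : ℝ) • p.2.1.1 e) :=
        Continuous.pr (by fun_prop) fun p => inner_ne_zero_left (h1 p.2 p.1)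
      exact .subtype_mk (.subtype_mk (by fun_prop) _) _
    · intro P
      refine Subtype.ext (Subtype.ext ?_)
      simp [ofMeet, toMeet, Gr.up]
    · intro P
      refine Subtype.ext (Subtype.ext ?_)
      simp

/-- The Mayer-Vietoris sequence of a Grassmannian, for the subspaces not containing `e` and the
subspaces not orthogonal to `e`. -/
noncomputable def mvSeq (k : ℕ) (h : IsCut S e S') :
    MVSeq (Flag.sum S' k) (Flag.fst S' k) (Gr.inc (k + 1) h.le) (Gr.up k h) := by
  have hA (p : unitInterval × Flag S' k) :
      (1 - (p.1 : ℝ)) • e + (1 : ℝ) • p.2.1.2 ≠ 0 :=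
    inner_ne_zero_left (x := p.2.1.2) (by
      rw [inner_combo' h p.2.2.2.1, one_mul]
      exact pow_ne_zero 2 (norm_ne_zero_iff.2 p.2.2.2.2.2))
  have hB (p : unitInterval × Flag S' k) :
      ⟪(1 : ℝ) • e + (1 - (p.1 : ℝ)) • p.2.1.2, e⟫ ≠ 0 :=
    (inner_combo h p.2.2.2.1 _ _).trans_ne one_ne_zero
  have hadd (q : Flag S' k) (u : E) : (q.1.1 + pr u) e = pr u e := by
    rw [add_apply, h.proj_apply_eq_zero q.2.1, zero_add]
  refine (MVSquare.ofOpens (isOpen_avoid e) (isOpen_meet e) (avoid_or_meet h)).toSeq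
    (ι := ofFlag k h) (α := toAvoid (k + 1) h) (β := toMeet k h)
    (H.bijective_of_homotopic (g := toFlag k h) ?_ ?_) (toAvoid_bijective h) (toMeet_bijective h)
    (H.map_congr_of_continuous (fun p => ⟨⟨p.2.1.1 + pr ((1 - (p.1 : ℝ)) • e + (1 : ℝ) • p.2.1.2),
      combo_isGr h p.2.2.1 p.2.2.2.1 p.2.2.2.2.1 rfl (hA p)⟩,
      (hadd p.2 _).trans_ne (pr_combo_ne h p.2.2.2.1 p.2.2.2.2.2 _ _ one_ne_zero)⟩) ?_ ?_ ?_)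
    (H.map_congr_of_continuous (fun p => ⟨⟨p.2.1.1 + pr ((1 : ℝ) • e + (1 - (p.1 : ℝ)) • p.2.1.2),
      combo_isGr h p.2.2.1 p.2.2.2.1 p.2.2.2.2.1 rfl (inner_ne_zero_left (hB p))⟩,
      (hadd p.2 _).trans_ne (pr_apply_ne_zero (hB p))⟩) ?_ ?_ ?_)
    rfl rfl
  · rw [toFlag_ofFlag]
  · rw [ofFlag_toFlag]
  · have : Continuous fun p : unitInterval × Flag S' k =>
        pr ((1 - (p.1 : ℝ)) • e + (1 : ℝ) • p.2.1.2) := Continuous.pr (by fun_prop) hA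
    exact .subtype_mk (.subtype_mk (by fun_prop) _) _
  · exact fun q => Subtype.ext (Subtype.ext (by simp [ofFlag, MVSquare.ofOpens]))
  · exact fun q => Subtype.ext (Subtype.ext (by simp [toAvoid, Gr.inc, Flag.sum]))
  · have : Continuous fun p : unitInterval × Flag S' k =>
        pr ((1 : ℝ) • e + (1 - (p.1 : ℝ)) • p.2.1.2) :=
      Continuous.pr (by fun_prop) fun p => inner_ne_zero_left (hB p)
    exact .subtype_mk (.subtype_mk (by fun_prop) _) _
  · exact fun q => Subtype.ext (Subtype.ext (by simp [ofFlag, MVSquare.ofOpens]))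
  · exact fun q => Subtype.ext (Subtype.ext (by simp [toMeet, Gr.up, Flag.fst]))

end Gr

end RatHomology

namespace RatHomology

open Topology InnerProductSpace

open scoped RealInnerProductSpace

variable {E : Type} [NormedAddCommGroup E] [InnerProductSpace ℝ E] [FiniteDimensional ℝ E]
  {S S' S'' T : Submodule ℝ E} {e f : E} {k l : ℕ}

lemma IsCut.neg (h : IsCut S e S') : IsCut S (-e) S' :=
  ⟨by rw [norm_neg, h.norm], S.neg_mem h.mem, fun x => by rw [h.iff, inner_neg_left, neg_eq_zero]⟩

/-- The vectors of `S` which are not nonpositive multiples of the unit vector `e`. -/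
abbrev Cone (S : Submodule ℝ E) (e : E) : Type := {v : E // v ∈ S ∧ v + ‖v‖ • e ≠ 0}

lemma Cone.ne_zero (v : Cone S e) : (v : E) ≠ 0 := by
  intro h
  apply v.2.2
  rw [h, norm_zero, zero_smul, add_zero]

lemma IsCut.refl_apply_cone (h : IsCut S e S') (v : E) : refl (v + ‖v‖ • e) v = -(‖v‖ • e) := by
  refine refl_add_apply ?_
  rw [norm_smul, h.norm, norm_norm, mul_one]

lemma IsCut.refl_apply_cone' (h : IsCut S e S') (v : Cone S e) :
    refl (v.1 + ‖v.1‖ • e) e = -(‖v.1‖⁻¹ • v.1) := by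
  have h1 := congrArg (refl (v.1 + ‖v.1‖ • e)) (h.refl_apply_cone v)
  rw [refl_refl, map_neg, map_smul] at h1
  have h2 := congrArg (‖v.1‖⁻¹ • ·) h1
  simp only [smul_neg, inv_smul_smul₀ (norm_ne_zero_iff.2 v.ne_zero)] at h2
  rw [h2, neg_neg]

lemma IsCut.refl_comp_comp (h : IsCut S e S') {P : E →L[ℝ] E} (hP : IsGr S' k P) :
    refl e ∘L P ∘L refl e = P := by
  ext x
  simp [refl_apply e x, IsGr.apply_pr (h.proj_apply_eq_zero hP), h.refl_mem (hP.mem x)]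

lemma IsCut.isCone_self (h : IsCut S e S') : e ∈ S ∧ e + ‖e‖ • e ≠ 0 :=
  ⟨h.mem, by rw [h.norm, one_smul, ← two_smul ℝ]; exact smul_ne_zero two_ne_zero h.ne_zero⟩

lemma IsCut.isCone_segment (h : IsCut S e S') (v : Cone S e) (t : unitInterval) :
    ((1 - (t : ℝ)) • v.1 + (t : ℝ) • e) ∈ S ∧ ((1 - (t : ℝ)) • v.1 + (t : ℝ) • e) +
      ‖(1 - (t : ℝ)) • v.1 + (t : ℝ) • e‖ • e ≠ 0 := by
  refine ⟨S.add_mem (S.smul_mem _ v.2.1) (S.smul_mem _ h.mem), fun h0 => ?_⟩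
  generalize hc : ‖(1 - (t : ℝ)) • v.1 + (t : ℝ) • e‖ = c at h0
  have hc0 : 0 ≤ c := hc ▸ norm_nonneg _
  obtain ht | ht := t.2.2.eq_or_lt
  · rw [ht, sub_self, zero_smul, zero_add, ← add_smul] at h0
    exact (smul_ne_zero (by positivity) h.ne_zero) h0
  · have ht' : 0 < 1 - (t : ℝ) := sub_pos.2 ht
    have h1 : v.1 = -(((1 - (t : ℝ))⁻¹ * (t + c)) • e) := by
      rw [eq_neg_iff_add_eq_zero]
      have := congrArg ((1 - (t : ℝ))⁻¹ • ·) h0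
      simp only [smul_add, smul_smul, inv_mul_cancel₀ ht'.ne', one_smul, smul_zero] at this
      refine Eq.trans ?_ this
      module
    have h2 : 0 ≤ (1 - (t : ℝ))⁻¹ * (t + c) := mul_nonneg (inv_nonneg.2 ht'.le)
      (add_nonneg t.2.1 hc0)
    apply v.2.2
    rw [h1, norm_neg, norm_smul, h.norm, mul_one, Real.norm_of_nonneg h2, neg_add_cancel]

namespace Flag

/-- The pairs whose vector is not a nonpositive multiple of `e`. -/
def off (S : Submodule ℝ E) (k : ℕ) (e : E) : Set (Flag S k) := {q | q.1.2 + ‖q.1.2‖ • e ≠ 0}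

lemma isOpen_off (e : E) : IsOpen (off S k e) := isOpen_ne_fun (by fun_prop) (by fun_prop)

lemma off_or_off (e : E) (q : Flag S k) : q ∈ off S k e ∨ q ∈ off S k (-e) := by
  by_contra! h
  obtain ⟨h1, h2⟩ := h
  rw [off, Set.mem_ofPred_eq, not_not] at h1 h2
  apply q.2.2.2.2
  have : (2 : ℝ) • q.1.2 = (q.1.2 + ‖q.1.2‖ • e) + (q.1.2 + ‖q.1.2‖ • -e) := by module
  rw [h1, h2, add_zero] at this
  exact (smul_eq_zero.1 this).resolve_left two_ne_zero

/-- Rotating subspaces of `S'` so that they become orthogonal to a given vector. -/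
noncomputable def lift (k : ℕ) (h : IsCut S e S') : C(Gr S' k × Cone S e, off S k e) :=
  ⟨fun p => ⟨⟨(refl (p.2.1 + ‖p.2.1‖ • e) ∘L p.1.1 ∘L refl (p.2.1 + ‖p.2.1‖ • e), p.2.1),
    (p.1.2.mono h.le).conj (isOrth_refl (S.add_mem p.2.2.1 (S.smul_mem _ h.mem))), p.2.2.1, by
      simp [h.refl_apply_cone, h.proj_apply_eq_zero p.1.2], p.2.ne_zero⟩, p.2.2.2⟩, by
    have : Continuous fun p : Gr S' k × Cone S e => refl (p.2.1 + ‖p.2.1‖ • e) :=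
      Continuous.refl (by fun_prop) fun p => p.2.2.2
    exact .subtype_mk (.subtype_mk (by fun_prop) _) _⟩

/-- The inverse rotation. -/
noncomputable def unlift (k : ℕ) (h : IsCut S e S') : C(off S k e, Gr S' k) :=
  ⟨fun q => ⟨refl (q.1.1.2 + ‖q.1.1.2‖ • e) ∘L q.1.1.1 ∘L refl (q.1.1.2 + ‖q.1.1.2‖ • e),
    h.isGr_of_apply_eq_zero (q.1.2.1.conj (isOrth_refl (S.add_mem q.1.2.2.1 (S.smul_mem _ h.mem))))
      (by
        have := h.refl_apply_cone' ⟨q.1.1.2, q.1.2.2.1, q.2⟩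
        simp only at this
        simp [this, q.1.2.2.2.1])⟩, by
    have : Continuous fun q : off S k e => refl (q.1.1.2 + ‖q.1.1.2‖ • e) :=
      Continuous.refl (by fun_prop) fun q => q.2
    exact .subtype_mk (by fun_prop) _⟩

variable (h : IsCut S e S')

lemma lift_unlift (q : off S k e) : lift k h (unlift k h q, ⟨q.1.1.2, q.1.2.2.1, q.2⟩) = q := by
  refine Subtype.ext (Subtype.ext (Prod.ext ?_ rfl))
  ext x
  simp [lift, unlift]

lemma unlift_lift (p : Gr S' k × Cone S e) : unlift k h (lift k h p) = p.1 := by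
  refine Subtype.ext ?_
  ext x
  simp [lift, unlift]

lemma lift_self (P : Gr S' k) : (lift k h (P, ⟨e, h.isCone_self⟩)).1.1 = (P.1, e) := by
  refine Prod.ext ?_ rfl
  have : refl (e + ‖e‖ • e) = refl e := by
    rw [h.norm, one_smul, ← two_smul ℝ, refl_smul two_ne_zero]
  simp only [lift, ContinuousMap.coe_mk, this, h.refl_comp_comp P.2]

/-- Pairs with constant vector `e`. -/
def const (k : ℕ) (h : IsCut S e S') : C(Gr S' k, Flag S k) :=
  ⟨fun P => ⟨(P.1, e), P.2.mono h.le, h.mem, h.proj_apply_eq_zero P.2, h.ne_zero⟩, by fun_prop⟩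

noncomputable def constOff (k : ℕ) (h : IsCut S e S') : C(Gr S' k, off S k e) :=
  ⟨fun P => ⟨const k h P, h.isCone_self.2⟩, by fun_prop⟩

lemma constOff_eq (P : Gr S' k) : constOff k h P = lift k h (P, ⟨e, h.isCone_self⟩) :=
  Subtype.ext (Subtype.ext (lift_self h P).symm)

lemma constOff_bijective (n : ℕ) : Function.Bijective (H.map n (constOff k h)) := by
  refine H.bijective_of_homotopic (g := unlift k h) ?_ ?_ n
  · have : (unlift k h).comp (constOff k h) = ContinuousMap.id _ :=
      ContinuousMap.ext fun P => by
        rw [ContinuousMap.comp_apply, constOff_eq, unlift_lift]; rfl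
    rw [this]
  · refine ContinuousMap.Homotopic.symm (homotopic_of_continuous (fun p => lift k h
      (unlift k h p.2, ⟨_, h.isCone_segment ⟨p.2.1.1.2, p.2.1.2.2.1, p.2.2⟩ p.1⟩)) ?_ ?_ ?_)
    · exact (lift k h).continuous.comp (.prodMk (by fun_prop) (.subtype_mk (by fun_prop) _))
    · intro q
      simpa using lift_unlift h q
    · intro q
      simp [constOff_eq]

include h in
lemma add_smul_ne_zero' {z : E} (hz : z ∈ S') (h0 : z ≠ 0) (c : ℝ) : z + c • e ≠ 0 := by
  intro h1
  have h2 : ⟪z + c • e, z⟫ = 0 := by rw [h1, inner_zero_left]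
  rw [inner_add_left, inner_smul_left, h.inner_eq_zero hz, mul_zero, add_zero,
    inner_self_eq_zero] at h2
  exact h0 h2

include h in
lemma add_smul_ne_zero {w : E} (h1 : w + ‖w‖ • e ≠ 0) (h2 : w + ‖w‖ • -e ≠ 0) (c : ℝ) :
    w + c • e ≠ 0 := by
  intro h0
  have hw : ‖w‖ = |c| := by
    rw [eq_neg_of_add_eq_zero_left h0, norm_neg, norm_smul, h.norm, mul_one, Real.norm_eq_abs]
  obtain hc | hc := abs_choice c
  · rw [hw, hc] at h1
    exact h1 h0
  · rw [hw, hc, smul_neg, neg_smul, neg_neg] at h2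
    exact h2 h0

lemma punctured_ne (z : Punctured S') : (z.1 : E) ≠ 0 := fun h0 => z.2 (Subtype.ext h0)

/-- Pairs whose vector is not a multiple of `e`, up to homotopy. -/
noncomputable def ofPunctured (k : ℕ) (h : IsCut S e S') :
    C(Gr S' k × Punctured S', (off S k e ∩ off S k (-e) : Set _)) :=
  ⟨fun p => ⟨lift k h (p.1, ⟨p.2.1, h.le p.2.1.2,
      add_smul_ne_zero' h p.2.1.2 (punctured_ne p.2) _⟩), Subtype.coe_prop _,
    add_smul_ne_zero' h.neg p.2.1.2 (punctured_ne p.2) _⟩, by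
    refine .subtype_mk (continuous_subtype_val.comp ((lift k h).continuous.comp
      (.prodMk (by fun_prop) (.subtype_mk ?_ _)))) _
    exact continuous_subtype_val.comp (continuous_subtype_val.comp continuous_snd)⟩

noncomputable def toPunctured (k : ℕ) (h : IsCut S e S') :
    C((off S k e ∩ off S k (-e) : Set _), Gr S' k × Punctured S') :=
  ⟨fun q => (unlift k h ⟨q.1, q.2.1⟩, ⟨⟨q.1.1.2 - ⟪e, q.1.1.2⟫ • e, h.sub_mem q.1.2.2.1⟩, by
      rw [Ne, Submodule.mk_eq_zero, sub_eq_add_neg, ← neg_smul]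
      exact add_smul_ne_zero h q.2.1 q.2.2 _⟩), by
    refine .prodMk ((unlift k h).continuous.comp (by fun_prop)) ?_
    exact .subtype_mk (.subtype_mk (by fun_prop) _) _⟩

lemma toPunctured_ofPunctured :
    (toPunctured k h).comp (ofPunctured k h) = ContinuousMap.id _ := by
  refine ContinuousMap.ext fun p => Prod.ext ?_ (Subtype.ext (Subtype.ext ?_))
  · exact unlift_lift h _
  · have : ⟪e, (p.2.1 : E)⟫ = 0 := h.inner_eq_zero p.2.1.2
    simp [toPunctured, ofPunctured, lift, this]

lemma ofPunctured_toPunctured :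
    ((ofPunctured k h).comp (toPunctured k h)).Homotopic (ContinuousMap.id _) := by
  have key (q : (off S k e ∩ off S k (-e) : Set _)) (t c : ℝ) :
      (q.1.1.2 - ((1 - t) * ⟪e, q.1.1.2⟫) • e) + c • e ≠ 0 := by
    have := add_smul_ne_zero h q.2.1 q.2.2 (c - (1 - t) * ⟪e, q.1.1.2⟫)
    rw [sub_smul] at this
    rwa [sub_add_eq_add_sub, add_sub_assoc]
  refine homotopic_of_continuous (fun p => ⟨lift k h (unlift k h ⟨p.2.1, p.2.2.1⟩,
    ⟨p.2.1.1.2 - ((1 - (p.1 : ℝ)) * ⟪e, p.2.1.1.2⟫) • e,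
      S.sub_mem p.2.1.2.2.1 (S.smul_mem _ h.mem), key _ _ _⟩), Subtype.coe_prop _, ?_⟩) ?_ ?_ ?_
  · have := key p.2 p.1 (-‖p.2.1.1.2 - ((1 - (p.1 : ℝ)) * ⟪e, p.2.1.1.2⟫) • e‖)
    rwa [neg_smul, ← smul_neg] at this
  · refine .subtype_mk (continuous_subtype_val.comp ((lift k h).continuous.comp
      (.prodMk ((unlift k h).continuous.comp (by fun_prop)) (.subtype_mk (by fun_prop) _)))) _
  · intro q
    refine Subtype.ext ?_
    simp [ofPunctured, toPunctured]
  · intro q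
    refine Subtype.ext ?_
    simpa using congrArg Subtype.val (lift_unlift h ⟨q.1, q.2.1⟩)

lemma ofPunctured_bijective (n : ℕ) : Function.Bijective (H.map n (ofPunctured k h)) :=
  H.bijective_of_homotopic (by rw [toPunctured_ofPunctured]) (ofPunctured_toPunctured h) n

/-- Reflecting a subspace in a vector. -/
noncomputable def turn (S' : Submodule ℝ E) (k : ℕ) : C(Gr S' k × Punctured S', Gr S' k) :=
  ⟨fun p => ⟨refl (p.2.1 : E) ∘L p.1.1 ∘L refl (p.2.1 : E), p.1.2.conj (isOrth_refl p.2.1.2)⟩, by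
    have : Continuous fun p : Gr S' k × Punctured S' => refl (p.2.1 : E) :=
      Continuous.refl (continuous_subtype_val.comp (continuous_subtype_val.comp continuous_snd))
        fun p => punctured_ne p.2
    exact .subtype_mk (by fun_prop) _⟩

/-- The open cover of the space of pairs by the pairs whose vector is not a nonpositive, respectively
nonnegative, multiple of `e`. -/
noncomputable abbrev square (S : Submodule ℝ E) (k : ℕ) (e : E) :
    MVSquare (off S k e ∩ off S k (-e) : Set _) (off S k e) (off S k (-e)) (Flag S k) :=
  MVSquare.ofOpens (isOpen_off e) (isOpen_off (-e)) (off_or_off e)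

lemma isCone_of_punctured (z : Punctured S') (h : IsCut S e S') :
    (z.1 : E) ∈ S ∧ (z.1 : E) + ‖(z.1 : E)‖ • e ≠ 0 :=
  ⟨h.le z.1.2, add_smul_ne_zero' h z.1.2 (punctured_ne z) _⟩

lemma map_iA_ofPunctured (n : ℕ) : H.map n ((square S k e).iA.comp (ofPunctured k h)) =
    H.map n ((constOff k h).comp (prP (Gr S' k) S')) := by
  refine H.map_congr_of_continuous (fun p => lift k h
    (p.2.1, ⟨_, h.isCone_segment ⟨p.2.2.1, isCone_of_punctured p.2.2 h⟩ p.1⟩)) ?_ ?_ ?_ n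
  · refine (lift k h).continuous.comp (.prodMk (by fun_prop) (.subtype_mk ?_ _))
    have : Continuous fun p : unitInterval × Gr S' k × Punctured S' => (p.2.2.1 : E) :=
      continuous_subtype_val.comp (continuous_subtype_val.comp
        (continuous_snd.comp continuous_snd))
    fun_prop
  · intro q
    refine Subtype.ext ?_
    simp [ofPunctured, MVSquare.ofOpens]
  · intro q
    simp [constOff_eq, prP]

include h in
lemma refl_turn (z : Punctured S') (x : E) :
    refl ((z.1 : E) + ‖(z.1 : E)‖ • -e) (refl (z.1 : E) x) =
      refl ((z.1 : E) + ‖(z.1 : E)‖ • e) (refl e x) := by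
  have hz : ‖(z.1 : E)‖ ≠ 0 := norm_ne_zero_iff.2 (punctured_ne z)
  have h1 : refl (z.1 : E) ((z.1 : E) + ‖(z.1 : E)‖ • e) =
      -((z.1 : E) + ‖(z.1 : E)‖ • -e) := by
    rw [map_add, refl_self, map_smul, refl_eq_self (u := (z.1 : E)) (x := e) (by
      rw [real_inner_comm, h.inner_eq_zero z.1.2])]
    module
  have h2 := refl_conj (z.1 : E) ((z.1 : E) + ‖(z.1 : E)‖ • e) (refl (z.1 : E) x)
  rw [h1, refl_neg, refl_refl] at h2
  have h3 := congrArg (refl ((z.1 : E) + ‖(z.1 : E)‖ • e))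
    (refl_conj ((z.1 : E) + ‖(z.1 : E)‖ • e) (z.1 : E) x)
  rw [h.refl_apply_cone, refl_neg, refl_smul hz, refl_refl] at h3
  rw [← h2, h3]

include h in
lemma refl_turn' (z : Punctured S') (x : E) :
    refl (z.1 : E) (refl ((z.1 : E) + ‖(z.1 : E)‖ • -e) x) =
      refl e (refl ((z.1 : E) + ‖(z.1 : E)‖ • e) x) := by
  have h1 := refl_turn h z (refl e (refl ((z.1 : E) + ‖(z.1 : E)‖ • e) x))
  rw [refl_refl, refl_refl] at h1
  have h2 := congrArg (fun y => refl (z.1 : E) (refl ((z.1 : E) + ‖(z.1 : E)‖ • -e) y)) h1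
  simp only [refl_refl] at h2
  exact h2.symm

lemma lift_turn (p : Gr S' k × Punctured S') :
    (lift k h.neg (turn S' k p, ⟨p.2.1, isCone_of_punctured p.2 h.neg⟩)).1 =
      (ofPunctured k h p).1 := by
  refine Subtype.ext (Prod.ext ?_ rfl)
  ext x
  have h1 := DFunLike.congr_fun (h.refl_comp_comp p.1.2)
    (refl ((p.2.1 : E) + ‖(p.2.1 : E)‖ • e) x)
  simp only [ContinuousLinearMap.comp_apply] at h1
  simp only [lift, turn, ofPunctured, ContinuousMap.coe_mk, ContinuousLinearMap.comp_apply,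
    refl_turn h, refl_turn' h, h1]

lemma map_iB_ofPunctured (n : ℕ) : H.map n ((square S k e).iB.comp (ofPunctured k h)) =
    H.map n ((constOff k h.neg).comp (turn S' k)) := by
  refine H.map_congr_of_continuous (fun p => lift k h.neg
    (turn S' k p.2, ⟨_, h.neg.isCone_segment ⟨p.2.2.1, isCone_of_punctured p.2.2 h.neg⟩ p.1⟩))
    ?_ ?_ ?_ n
  · refine (lift k h.neg).continuous.comp (.prodMk (by fun_prop) (.subtype_mk ?_ _))
    have : Continuous fun p : unitInterval × Gr S' k × Punctured S' => (p.2.2.1 : E) :=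
      continuous_subtype_val.comp (continuous_subtype_val.comp
        (continuous_snd.comp continuous_snd))
    fun_prop
  · intro q
    refine Subtype.ext ?_
    have := lift_turn h q
    simpa [MVSquare.ofOpens] using this
  · intro q
    simp [constOff_eq]

/-- The Mayer-Vietoris sequence of the space of pairs. -/
noncomputable def mvSeq (k : ℕ) (h : IsCut S e S') :
    MVSeq (prP (Gr S' k) S') (turn S' k) (const k h) (const k h.neg) :=
  (square S k e).toSeq (ofPunctured_bijective h) (constOff_bijective h) (constOff_bijective h.neg)
    (map_iA_ofPunctured h) (map_iB_ofPunctured h) rfl rfl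

lemma map_ofPunctured_δ {n : ℕ} (x : H (n + 1) (Flag S k)) :
    H.map n (ofPunctured k h) ((mvSeq k h).δ n x) = (square S k e).δ n x :=
  MVSquare.map_toSeq_δ (square S k e) (ofPunctured_bijective h) (constOff_bijective h)
    (constOff_bijective h.neg) (map_iA_ofPunctured h) (map_iB_ofPunctured h) rfl rfl x

/-- The isometry `-refl e`, which fixes `e`. -/
noncomputable def flip (k : ℕ) (h : IsCut S e S') : C(Flag S k, Flag S k) :=
  (Flag.neg S k).comp (Flag.conj (isOrth_refl h.mem))

lemma flip_mem_off (q : Flag S k) (he : q ∈ off S k e) : flip k h q ∈ off S k e := by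
  intro h0
  apply he
  have h1 : refl e (q.1.2 + ‖q.1.2‖ • e) = 0 := by
    rw [map_add, map_smul, refl_self]
    refine neg_eq_zero.1 (Eq.trans ?_ h0)
    simp [flip, Flag.neg, Flag.conj, add_comm]
  rw [← refl_refl e (q.1.2 + ‖q.1.2‖ • e), h1, map_zero]

lemma flip_mem_off' (q : Flag S k) (he : q ∈ off S k (-e)) : flip k h q ∈ off S k (-e) := by
  intro h0
  apply he
  have h1 : refl e (q.1.2 + ‖q.1.2‖ • -e) = 0 := by
    rw [map_add, map_smul, map_neg, refl_self]
    refine neg_eq_zero.1 (Eq.trans ?_ h0)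
    simp [flip, Flag.neg, Flag.conj, add_comm]
  rw [← refl_refl e (q.1.2 + ‖q.1.2‖ • -e), h1, map_zero]

/-- The connecting homomorphism intertwines the isometry fixing `e` with the antipodal map. -/
lemma mvSeq_δ_flip {n : ℕ} (x : H (n + 1) (Flag S k)) :
    (mvSeq k h).δ n (H.map (n + 1) (flip k h) x) =
      H.map n (negP (Gr S' k) S') ((mvSeq k h).δ n x) := by
  apply (ofPunctured_bijective h n).1
  rw [map_ofPunctured_δ, H.map_map]
  let fA : C(off S k e, off S k e) :=
    ⟨fun q => ⟨flip k h q.1, flip_mem_off h _ q.2⟩, by fun_prop⟩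
  let fB : C(off S k (-e), off S k (-e)) :=
    ⟨fun q => ⟨flip k h q.1, flip_mem_off' h _ q.2⟩, by fun_prop⟩
  let fI : C((off S k e ∩ off S k (-e) : Set _), (off S k e ∩ off S k (-e) : Set _)) :=
    ⟨fun q => ⟨flip k h q.1, flip_mem_off h _ q.2.1, flip_mem_off' h _ q.2.2⟩, by fun_prop⟩
  rw [MVSquare.δ_map (square S k e) (square S k e) (fI := fI) (fA := fA) (fB := fB) rfl rfl rfl rfl,
    ← map_ofPunctured_δ h, H.map_map]
  congr 2
  refine ContinuousMap.ext fun p => Subtype.ext (Subtype.ext (Prod.ext ?_ ?_))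
  · ext x
    have hp : -(p.2.1 : E) + ‖(p.2.1 : E)‖ • e = -refl e ((p.2.1 : E) + ‖(p.2.1 : E)‖ • e) := by
      rw [map_add, map_smul, refl_self, h.refl_mem p.2.1.2]
      module
    have h1 := DFunLike.congr_fun (h.refl_comp_comp p.1.2)
      (refl ((p.2.1 : E) + ‖(p.2.1 : E)‖ • e) (refl e x))
    simp only [ContinuousLinearMap.comp_apply] at h1
    change refl e (refl ((p.2.1 : E) + ‖(p.2.1 : E)‖ • e) (p.1.1 (refl ((p.2.1 : E) + ‖(p.2.1 : E)‖ • e)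
      (refl e x)))) = refl (-(p.2.1 : E) + ‖-(p.2.1 : E)‖ • e)
        (p.1.1 (refl (-(p.2.1 : E) + ‖-(p.2.1 : E)‖ • e) x))
    rw [norm_neg, hp, refl_neg, ← refl_conj, ← refl_conj, h1]
  · have : refl e (p.2.1 : E) = p.2.1 := h.refl_mem p.2.1.2
    simp [fI, ofPunctured, lift, flip, Flag.neg, Flag.conj, negP, this]

end Flag

end RatHomology

namespace RatHomology
open Module
def HasDim (M : Type) [AddCommGroup M] [Module ℚ M] (d : ℤ) : Prop :=
  Module.Finite ℚ M ∧ (finrank ℚ M : ℤ) = d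

namespace HasDim
variable {M N P : Type} [AddCommGroup M] [Module ℚ M] [AddCommGroup N] [Module ℚ N]
  [AddCommGroup P] [Module ℚ P] {a b : ℤ}

lemma congr (h : HasDim M a) (e : M ≃ₗ[ℚ] N) : HasDim N a := by
  have := h.1
  exact ⟨Module.Finite.equiv e, by rw [← e.finrank_eq, h.2]⟩

lemma of_bijective (h : HasDim M a) {f : M →ₗ[ℚ] N} (hf : Function.Bijective f) : HasDim N a :=
  h.congr (LinearEquiv.ofBijective f hf)

lemma of_bijective' (h : HasDim N a) {f : M →ₗ[ℚ] N} (hf : Function.Bijective f) : HasDim M a :=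
  h.congr (LinearEquiv.ofBijective f hf).symm

lemma zero (h : ∀ x : M, x = 0) : HasDim M 0 := by
  have : Subsingleton M := ⟨fun x y => by rw [h x, h y]⟩
  exact ⟨inferInstance, by simp [finrank_zero_of_subsingleton]⟩

lemma eq_zero (h : HasDim M 0) (x : M) : x = 0 := by
  have := h.1
  have h2 : finrank ℚ M = 0 := by exact_mod_cast h.2
  have := finrank_zero_iff.1 h2
  exact Subsingleton.elim _ _

lemma prod (h : HasDim M a) (h' : HasDim N b) : HasDim (M × N) (a + b) := by
  have := h.1; have := h'.1
  exact ⟨inferInstance, by rw [finrank_prod, Nat.cast_add, h.2, h'.2]⟩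

lemma middle (h : HasDim M a) (h' : HasDim P b) {f : M →ₗ[ℚ] N} {g : N →ₗ[ℚ] P}
    (hf : Function.Injective f) (hg : Function.Surjective g) (hfg : ∀ y, g y = 0 ↔ ∃ x, f x = y) :
    HasDim N (a + b) := by
  have := h.1; have := h'.1
  have hex : Function.Exact f g := fun y => hfg y
  have h1 : LinearMap.ker g = LinearMap.range f := hex.linearMap_ker_eq
  have : Module.Finite ℚ N := by
    refine ⟨Submodule.fg_of_fg_map_of_fg_inf_ker g ?_ ?_⟩
    · rw [Submodule.map_top]; exact Module.Finite.iff_fg.1 inferInstance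
    · rw [top_inf_eq, h1]; exact Module.Finite.iff_fg.1 inferInstance
  refine ⟨inferInstance, ?_⟩
  rw [← g.finrank_range_add_finrank_ker, h1, LinearMap.finrank_range_of_inj hf,
    LinearMap.range_eq_top.2 hg, finrank_top, Nat.cast_add, h.2, h'.2, add_comm]

lemma range (h : HasDim M a) (h' : HasDim N b) {f : M →ₗ[ℚ] N} {g : N →ₗ[ℚ] P}
    (hf : Function.Injective f) (hfg : ∀ y, g y = 0 ↔ ∃ x, f x = y) :
    HasDim (LinearMap.range g) (b - a) := by
  have := h.1; have := h'.1
  have h1 : LinearMap.ker g = LinearMap.range f := Function.Exact.linearMap_ker_eq fun y => hfg y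
  refine ⟨inferInstance, ?_⟩
  rw [← h'.2, ← g.finrank_range_add_finrank_ker, h1, LinearMap.finrank_range_of_inj hf, ← h.2]
  push_cast; ring

lemma injective_of_surjective (h : HasDim M a) (h' : HasDim N a) {f : M →ₗ[ℚ] N}
    (hf : Function.Surjective f) : Function.Injective f := by
  have := h.1; have := h'.1
  exact (LinearMap.injective_iff_surjective_of_finrank_eq_finrank
    (by exact_mod_cast h.2.trans h'.2.symm)).2 hf
end HasDim

section Point

variable {X : Type} [TopologicalSpace X] [Subsingleton X]

lemma bdry_single_of_subsingleton (n : ℕ) (σ : Sing (n + 1) X) (τ : Sing n X) (a : ℚ) :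
    bdry n X (Finsupp.single σ a) = if Even n then 0 else Finsupp.single τ a := by
  have h (i : Fin (n + 2)) : σ.comp (simpMap i.succAbove) = τ :=
    ContinuousMap.ext fun _ => Subsingleton.elim _ _
  simp only [bdry_single, h]
  rw [← Finset.sum_smul, Fin.sum_univ_eq_sum_range (fun i => (-1 : ℚ) ^ i), neg_one_geom_sum]
  by_cases hn : Even n <;> simp [Nat.even_add, hn]

lemma exists_eq_single {n : ℕ} (σ : Sing n X) (c : Chain n X) : ∃ a, c = Finsupp.single σ a := by
  have : Subsingleton (Sing n X) := ⟨fun _ _ => ContinuousMap.ext fun _ => Subsingleton.elim _ _⟩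
  exact ⟨c σ, by ext τ; rw [Subsingleton.elim τ σ, Finsupp.single_eq_same]⟩

lemma hasDim_of_subsingleton [Nonempty X] (n : ℕ) : HasDim (H n X) (if n = 0 then 1 else 0) := by
  obtain ⟨x⟩ := ‹Nonempty X›
  obtain _ | n := n
  · have h0 : (Finsupp.single (ContinuousMap.const _ x) 1 : Chain 0 X) ∈ cycles 0 X :=
      Submodule.mem_top
    have hv : H.mk _ h0 ≠ 0 := by
      rw [Ne, H.mk_eq_zero]
      rintro ⟨c, hc⟩
      obtain ⟨a, rfl⟩ := exists_eq_single (ContinuousMap.const _ x) c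
      rw [bdry_single_of_subsingleton _ _ (ContinuousMap.const _ x), if_pos Even.zero] at hc
      exact Finsupp.single_ne_zero.2 one_ne_zero hc.symm
    have h1 : finrank ℚ (H 0 X) = 1 := by
      refine finrank_eq_one _ hv fun w => ?_
      induction w using H.ind with
      | _ c hc =>
        obtain ⟨a, rfl⟩ := exists_eq_single (ContinuousMap.const _ x) c
        refine ⟨a, ?_⟩
        rw [← mul_one a, ← smul_eq_mul, ← Finsupp.smul_single]
        simp only [smul_eq_mul, mul_one]
        rfl
    exact ⟨Module.finite_of_finrank_eq_succ h1, by simp [h1]⟩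
  · refine HasDim.zero fun w => ?_
    induction w using H.ind with
    | _ c hc =>
      obtain ⟨a, rfl⟩ := exists_eq_single (ContinuousMap.const _ x) c
      rw [H.mk_eq_zero]
      rw [mem_cycles_succ, bdry_single_of_subsingleton _ _ (ContinuousMap.const _ x)] at hc
      by_cases hn : Even n
      · refine ⟨Finsupp.single (ContinuousMap.const _ x) a, ?_⟩
        rw [bdry_single_of_subsingleton _ _ (ContinuousMap.const _ x),
          if_neg (by simpa [Nat.even_add_one] using hn)]
      · rw [if_neg hn, Finsupp.single_eq_zero] at hc
        exact ⟨0, by rw [hc, map_zero, Finsupp.single_zero]⟩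

lemma bijective_of_subsingleton {Y : Type} [TopologicalSpace Y] [Subsingleton Y] [Nonempty Y]
    [Nonempty X] (f : C(X, Y)) (n : ℕ) : Function.Bijective (H.map n f) := by
  obtain ⟨x⟩ := ‹Nonempty X›
  refine H.bijective_of_homotopic (g := ContinuousMap.const _ x) ?_ ?_ n
  · convert ContinuousMap.Homotopic.refl _ using 1
    exact ContinuousMap.ext fun _ => Subsingleton.elim _ _
  · convert ContinuousMap.Homotopic.refl _ using 1
    exact ContinuousMap.ext fun _ => Subsingleton.elim _ _

end Point
end RatHomology

namespace RatHomology

open Module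

variable {E : Type} [NormedAddCommGroup E] [InnerProductSpace ℝ E] [FiniteDimensional ℝ E]
  {S S' S'' T : Submodule ℝ E} {e f : E} {k l : ℕ}

instance : Subsingleton (Gr S 0) := ⟨Gr.ext_zero⟩

instance : Nonempty (Gr S 0) := ⟨⟨0, isGr_zero S⟩⟩

lemma Gr.subsingleton_of_eq (h : k = finrank ℝ S) : Subsingleton (Gr S k) := ⟨Gr.ext_top h⟩

lemma Gr.nonempty_of_eq (h : k = finrank ℝ S) : Nonempty (Gr S k) :=
  ⟨⟨S.starProjection, h ▸ isGr_proj S⟩⟩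

lemma Flag.fst_bijective (hS : Even (finrank ℝ S)) (hkl : k + l = finrank ℝ S) (hl : Odd l) (n : ℕ) :
    Function.Bijective (H.map n (Flag.fst S k)) := by
  refine ⟨(injective_iff_map_eq_zero _).2 fun x hx => eq_zero_of_eq_neg ?_,
    Flag.fst_surjective_of_odd hkl hl n⟩
  have := Flag.neg_of_odd hkl hl n x hx
  rwa [Flag.map_neg_of_even hS] at this

lemma Gr.inc_bijective (hS : Even (finrank ℝ S')) (h : IsCut S e S') (hk : Even k)
    (hkS : k ≤ finrank ℝ S') (n : ℕ) : Function.Bijective (H.map n (Gr.inc k h.le)) := by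
  obtain _ | k := k
  · exact bijective_of_subsingleton _ n
  · obtain ⟨l, hl⟩ := Nat.exists_eq_add_of_le hkS
    refine (Gr.mvSeq k h).bijective_p (fun n => Flag.fst_bijective (l := l + 1) hS (by omega) ?_ n) n
    rw [hl, Nat.even_add, iff_true_left hk] at hS
    exact hS.add_one

lemma Gr.up_bijective (hS : Even (finrank ℝ S')) (h : IsCut S e S') (hk : Even k)
    (hkS : k ≤ finrank ℝ S') (n : ℕ) : Function.Bijective (H.map n (Gr.up k h)) := by
  obtain ⟨l, hl⟩ := Nat.exists_eq_add_of_le hkS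
  have hl' : Even l := by rwa [hl, Nat.even_add, iff_true_left hk] at hS
  have hf := h.finrank
  have h1 : H.map n (Gr.up k h) = H.map n (Gr.dual (S := S) (k := l) (l := k + 1) (by omega)) ∘ₗ
      H.map n (Gr.inc l h.le) ∘ₗ H.map n (Gr.dual (S := S') (k := k) (l := l) hl.symm) := by
    rw [Gr.up_eq h hl.symm (by omega), H.map_comp, H.map_comp]
  rw [h1]
  exact (Gr.dual_bijective _ n).comp
    ((Gr.inc_bijective hS h hl' (by omega) n).comp (Gr.dual_bijective _ n))

lemma Flag.sum_bijective (hS : Even (finrank ℝ S)) (hk : Even k) (hkS : k + 1 ≤ finrank ℝ S) (n : ℕ) :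
    Function.Bijective (H.map n (Flag.sum S k)) := by
  obtain ⟨l, hl⟩ := Nat.exists_eq_add_of_le hkS
  have h1 : H.map n (Flag.sum S k) = H.map n (Gr.dual (S := S) (k := l) (l := k + 1) (by omega)) ∘ₗ
      H.map n (Flag.fst S l) ∘ₗ H.map n (Flag.dual (S := S) (k := k) (l := l) hl.symm) := by
    rw [Flag.sum_eq hl.symm (by omega), H.map_comp, H.map_comp]
  rw [h1]
  exact (Gr.dual_bijective _ n).comp
    ((Flag.fst_bijective hS (by omega) hk.add_one n).comp (Flag.dual_bijective _ n))

lemma Gr.conj_bijective {u : E} (hu : u ∈ S) (n : ℕ) :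
    Function.Bijective (H.map n (Gr.conj (k := k) (isOrth_refl hu))) := by
  have h : (Gr.conj (k := k) (isOrth_refl hu)).comp (Gr.conj (isOrth_refl hu)) =
      ContinuousMap.id (Gr S k) :=
    ContinuousMap.ext fun P => Subtype.ext <| ContinuousLinearMap.ext fun x => by
      simp [Gr.conj, refl_refl]
  exact H.bijective_of_homotopic (g := Gr.conj (isOrth_refl hu)) (by rw [h]) (by rw [h]) n

namespace Flag

lemma turn_comp_negP (S : Submodule ℝ E) (k : ℕ) :
    (turn S k).comp (negP (Gr S k) S) = turn S k :=
  ContinuousMap.ext fun p => Subtype.ext <| by simp [turn, negP]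

lemma turn_secP_bijective (w : Punctured S) (n : ℕ) :
    Function.Bijective (fun x => H.map n (turn S k) (H.map n (secP w) x)) := by
  have h : (fun x => H.map n (turn S k) (H.map n (secP w) x)) =
      H.map n (Gr.conj (k := k) (isOrth_refl w.1.2)) := by
    funext x
    rw [H.map_map]
    rfl
  rw [h]
  exact Gr.conj_bijective w.1.2 n

variable (h : IsCut S e S') (w : Punctured S')

include w in
lemma exists_map_const {n : ℕ} (y : H n (Gr S' k)) :
    ∃ x, H.map n (const k h) x = H.map n (const k h.neg) y := by
  obtain ⟨y, rfl⟩ := (turn_secP_bijective w n).2 y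
  exact ⟨_, (mvSeq k h).comm (H.map n (secP w) y)⟩

include w in
lemma exists_map_const_eq {n : ℕ} {z : H (n + 1) (Flag S k)} (hz : (mvSeq k h).δ n z = 0) :
    ∃ x, H.map (n + 1) (const k h) x = z := by
  obtain ⟨x, y, rfl⟩ := (mvSeq k h).exists_eq_add hz
  obtain ⟨x', hx'⟩ := exists_map_const h w y
  exact ⟨x + x', by rw [map_add, hx']⟩

include w in
lemma exists_map_const_eq_zero (z : H 0 (Flag S k)) : ∃ x, H.map 0 (const k h) x = z := by
  obtain ⟨x, y, rfl⟩ := (mvSeq k h).exists_eq_add_zero z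
  obtain ⟨x', hx'⟩ := exists_map_const h w y
  exact ⟨x + x', by rw [map_add, hx']⟩

include w in
/-- If `turn` vanishes on the fibre homology, then `const` is injective. -/
lemma const_injective {n : ℕ}
    (ht : ∀ c, H.map n (prP (Gr S' k) S') c = 0 → H.map n (turn S' k) c = 0) :
    Function.Injective (H.map n (const k h)) := by
  refine (injective_iff_map_eq_zero _).2 fun x hx => ?_
  obtain ⟨c, rfl, hc⟩ := (mvSeq k h).exists_of_eq (y := 0) (by rw [hx, map_zero])
  have h1 := ht (c - H.map n (secP w) (H.map n (prP _ _) c)) (by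
    rw [map_sub, prP_secP, sub_self])
  rw [map_sub, hc, zero_sub, neg_eq_zero] at h1
  exact (turn_secP_bijective w n).1 (by simpa using h1)

lemma turn_eq_zero {r : ℕ} (hS : finrank ℝ S' = r + 1) (hr : Even r) {n : ℕ}
    {c : H n (Gr S' k × Punctured S')} (hc : H.map n (prP (Gr S' k) S') c = 0) :
    H.map n (turn S' k) c = 0 := by
  refine eq_zero_of_eq_neg ?_
  conv_lhs => rw [← turn_comp_negP, ← H.map_map, (fibreHomology (Gr S' k) hS).neg n c hc]
  rw [hr.add_one.neg_one_pow, neg_one_smul, map_neg]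

lemma sum_comp_const (k : ℕ) (h : IsCut S e S') : (Flag.sum S k).comp (const k h) = Gr.up k h :=
  rfl

lemma sum_conj {u : E} (hu : u ∈ S) :
    (Flag.sum S k).comp (Flag.conj (isOrth_refl hu)) =
      (Gr.conj (isOrth_refl hu)).comp (Flag.sum S k) :=
  ContinuousMap.ext fun q => Subtype.ext <| ContinuousLinearMap.ext fun x => by
    have h1 := refl_conj u q.1.2 x
    rw [refl_apply q.1.2, refl_apply (refl u q.1.2), map_sub, refl_refl, map_smul, sub_right_inj] at h1
    have h2 := smul_right_injective E (two_ne_zero (α := ℝ)) h1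
    simp [Gr.conj, Flag.sum, Flag.conj, h2]

lemma const_conj {u : E} (hu : u ∈ S') (h : IsCut S e S') :
    (const k h).comp (Gr.conj (isOrth_refl hu)) =
      (Flag.conj (isOrth_refl (h.le hu))).comp (const k h) :=
  ContinuousMap.ext fun P => Subtype.ext <| Prod.ext (by rfl) <| by
    have : inner ℝ u e = 0 := by rw [real_inner_comm, h.inner_eq_zero hu]
    simp [const, Flag.conj, refl_eq_self this]

end Flag

namespace Gr

variable {r : ℕ}

/-- The connecting homomorphism of the long exact sequence of `Gr.up`. -/
noncomputable def connecting (hS : Even (finrank ℝ S)) (hk : Even k) (hkS : k + 1 ≤ finrank ℝ S)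
    (h : IsCut S e S') (n : ℕ) :
    H (n + 1) (Gr S (k + 1)) →ₗ[ℚ] H n (Gr S' k × Punctured S') :=
  (Flag.mvSeq k h).δ n ∘ₗ
    ((LinearEquiv.ofBijective _ (Flag.sum_bijective hS hk hkS (n + 1))).symm : _ →ₗ[ℚ] _)

variable (hS : Even (finrank ℝ S)) (hk : Even k) (hkS : k + 1 ≤ finrank ℝ S) (h : IsCut S e S')

lemma connecting_sum {n : ℕ} (x : H (n + 1) (Flag S k)) :
    connecting hS hk hkS h n (H.map (n + 1) (Flag.sum S k) x) = (Flag.mvSeq k h).δ n x :=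
  congrArg ((Flag.mvSeq k h).δ n)
    ((LinearEquiv.ofBijective _ (Flag.sum_bijective hS hk hkS (n + 1))).symm_apply_apply x)

lemma prP_connecting {n : ℕ} (x : H (n + 1) (Gr S (k + 1))) :
    H.map n (prP (Gr S' k) S') (connecting hS hk hkS h n x) = 0 :=
  (Flag.mvSeq k h).f_δ _

include hS in
lemma _root_.RatHomology.IsCut.exists_finrank_eq (h : IsCut S e S') :
    ∃ r, Even r ∧ finrank ℝ S' = r + 1 := by
  have := h.finrank
  rw [this] at hS
  obtain ⟨r, hr⟩ := Nat.not_even_iff_odd.1 (Nat.even_add_one.1 hS)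
  exact ⟨2 * r, by simp, hr⟩

lemma _root_.RatHomology.exists_punctured (hS : 0 < finrank ℝ S) : Nonempty (Punctured S) := by
  have := finrank_pos_iff.1 hS
  obtain ⟨w, hw⟩ := exists_ne (0 : S)
  exact ⟨⟨w, hw⟩⟩

include hS hk in
lemma up_injective (n : ℕ) (hkS : k + 1 ≤ finrank ℝ S) : Function.Injective (H.map n (Gr.up k h)) := by
  obtain ⟨r, hr, hr'⟩ := h.exists_finrank_eq hS
  obtain ⟨w⟩ := exists_punctured (S := S') (by omega)
  rw [← Flag.sum_comp_const, H.map_comp]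
  exact (Flag.sum_bijective hS hk hkS n).1.comp
    (Flag.const_injective h w fun c hc => Flag.turn_eq_zero hr' hr hc)

include hS hk hkS in
lemma up_surjective_zero : Function.Surjective (H.map 0 (Gr.up k h)) := by
  obtain ⟨r, hr, hr'⟩ := h.exists_finrank_eq hS
  obtain ⟨w⟩ := exists_punctured (S := S') (by omega)
  rw [← Flag.sum_comp_const, H.map_comp]
  exact (Flag.sum_bijective hS hk hkS 0).2.comp (Flag.exists_map_const_eq_zero h w)

lemma connecting_up {n : ℕ} (x : H (n + 1) (Gr S' k)) :
    connecting hS hk hkS h n (H.map (n + 1) (Gr.up k h) x) = 0 := by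
  rw [← Flag.sum_comp_const, ← H.map_map, connecting_sum]
  exact (Flag.mvSeq k h).δ_p x

lemma exists_up_eq {n : ℕ} {x : H (n + 1) (Gr S (k + 1))} (hx : connecting hS hk hkS h n x = 0) :
    ∃ y, H.map (n + 1) (Gr.up k h) y = x := by
  obtain ⟨r, hr, hr'⟩ := h.exists_finrank_eq hS
  obtain ⟨w⟩ := exists_punctured (S := S') (by omega)
  obtain ⟨x, rfl⟩ := (Flag.sum_bijective hS hk hkS (n + 1)).2 x
  rw [connecting_sum] at hx
  obtain ⟨y, rfl⟩ := Flag.exists_map_const_eq h w hx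
  exact ⟨y, by rw [← Flag.sum_comp_const, ← H.map_map]⟩

lemma exists_connecting_eq {n : ℕ} {c : H n (Gr S' k × Punctured S')}
    (hc : H.map n (prP (Gr S' k) S') c = 0) : ∃ x, connecting hS hk hkS h n x = c := by
  obtain ⟨r, hr, hr'⟩ := h.exists_finrank_eq hS
  obtain ⟨z, hz⟩ := (Flag.mvSeq k h).exists_δ_eq hc (Flag.turn_eq_zero hr' hr hc)
  exact ⟨_, (connecting_sum hS hk hkS h z).trans hz⟩

lemma connecting_conj {n : ℕ} (x : H (n + 1) (Gr S (k + 1))) :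
    connecting hS hk hkS h n (H.map (n + 1) (Gr.conj (isOrth_refl h.mem)) x) =
      -connecting hS hk hkS h n x := by
  obtain ⟨r, hr, hr'⟩ := h.exists_finrank_eq hS
  obtain ⟨x, rfl⟩ := (Flag.sum_bijective hS hk hkS (n + 1)).2 x
  have h1 : H.map (n + 1) (Flag.conj (isOrth_refl h.mem)) x = H.map (n + 1) (Flag.flip k h) x := by
    rw [Flag.flip, ← H.map_map, Flag.map_neg_of_even hS, LinearMap.id_apply]
  rw [H.map_map, ← Flag.sum_conj h.mem, ← H.map_map, connecting_sum, connecting_sum, h1,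
    Flag.mvSeq_δ_flip, (fibreHomology (Gr S' k) hr').neg n _ ((Flag.mvSeq k h).f_δ _),
    hr.add_one.neg_one_pow, neg_one_smul]

end Gr

end RatHomology

namespace RatHomology

open Module

variable {E : Type} [NormedAddCommGroup E] [InnerProductSpace ℝ E] [FiniteDimensional ℝ E]
  {S S' S'' T : Submodule ℝ E} {e f : E} {k l : ℕ}

/-- The inductive statement on the homology of the Grassmannians of even-dimensional subspaces of
spaces of dimension `2 * m`. -/
structure EvenGr (E : Type) [NormedAddCommGroup E] [InnerProductSpace ℝ E] [FiniteDimensional ℝ E]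
    (c : ℕ → ℕ → ℤ) (m : ℕ) : Prop where
  odd : ∀ j n, Odd n → c j n = 0
  hasDim : ∀ S : Submodule ℝ E, finrank ℝ S = 2 * m → ∀ j ≤ m, ∀ n,
    HasDim (H n (Gr S (2 * j))) (c j n)
  inc_injective : ∀ {S S' S'' : Submodule ℝ E} {e f : E} (h : IsCut S e S') (h' : IsCut S' f S''),
    finrank ℝ S = 2 * m → ∀ j, j + 1 ≤ m → ∀ n,
      Function.Injective (H.map n (Gr.inc (2 * j) (h'.le.trans h.le)))
  up_injective : ∀ {S S' S'' : Submodule ℝ E} {e f : E} (h : IsCut S e S') (h' : IsCut S' f S''),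
    finrank ℝ S = 2 * m → ∀ j, j + 1 ≤ m → ∀ n,
      Function.Injective (H.map n ((Gr.up (2 * j + 1) h).comp (Gr.up (2 * j) h')))

lemma FibreHomology.hasDim {V L : Type} [TopologicalSpace V] [NormedAddCommGroup L]
    [NormedSpace ℝ L] {r : ℕ} (F : FibreHomology V L (r + 1)) {d : ℕ → ℤ}
    (hd : ∀ n, HasDim (H n V) (d n)) (n : ℕ) :
    HasDim (H.map n (prP V L)).ker (if r ≤ n then d (n - r) else 0) := by
  split_ifs with h
  · obtain ⟨φ⟩ := F.equiv n (n - r) (by omega)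
    exact (hd _).congr φ.symm
  · exact HasDim.zero fun x => Subtype.ext (F.low n (by omega) x.1 x.2)

namespace EvenGr

variable {c : ℕ → ℕ → ℤ} {p j : ℕ} (I : EvenGr E c p)

include I

lemma hasDim_cut (hS : finrank ℝ S' = 2 * p + 1) (hj : j ≤ p) (n : ℕ) :
    HasDim (H n (Gr S' (2 * j))) (c j n) := by
  obtain ⟨f, S'', h⟩ := exists_isCut (S := S') (by omega)
  have hf := h.finrank
  exact (I.hasDim S'' (by omega) j hj n).of_bijective
    (Gr.inc_bijective ⟨p, by omega⟩ h (even_two_mul j) (by omega) n)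

lemma hasDim_ker (hS : finrank ℝ S' = 2 * p + 1) (hj : j ≤ p) (n : ℕ) :
    HasDim (H.map n (prP (Gr S' (2 * j)) S')).ker (if 2 * p ≤ n then c j (n - 2 * p) else 0) :=
  (fibreHomology _ hS).hasDim (I.hasDim_cut hS hj) n

lemma up_bijective_of_even (h : IsCut S e S') (hS : finrank ℝ S = 2 * p + 2) (hj : j ≤ p) {n : ℕ}
    (hn : Even n) : Function.Bijective (H.map n (Gr.up (2 * j) h)) := by
  have hf := h.finrank
  have hS' : Even (finrank ℝ S) := ⟨p + 1, by omega⟩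
  refine ⟨Gr.up_injective hS' (even_two_mul j) h n (by omega), ?_⟩
  obtain _ | n := n
  · exact Gr.up_surjective_zero hS' (even_two_mul j) (by omega) h
  · refine fun x => Gr.exists_up_eq hS' (even_two_mul j) (by omega) h ?_
    have h0 : HasDim (H.map n (prP (Gr S' (2 * j)) S')).ker 0 := by
      convert I.hasDim_ker (S' := S') (by omega) hj n using 1
      split_ifs with hn'
      · rw [I.odd]
        rw [Nat.odd_sub hn']
        simpa [Nat.even_add_one] using hn
      · rfl
    exact congrArg Subtype.val (h0.eq_zero ⟨_, Gr.prP_connecting hS' (even_two_mul j) (by omega) h x⟩)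

lemma hasDim_odd (hS : finrank ℝ S = 2 * p + 2) (hj : j ≤ p) (n : ℕ) :
    HasDim (H n (Gr S (2 * j + 1)))
      (c j n + if 2 * p + 1 ≤ n then c j (n - (2 * p + 1)) else 0) := by
  obtain ⟨e, S', h⟩ := exists_isCut (S := S) (by omega)
  have hf := h.finrank
  have hd := I.hasDim_cut (S' := S') (by omega) hj
  obtain _ | n := n
  · simpa using (hd 0).of_bijective (I.up_bijective_of_even h hS hj Even.zero)
  · have hS' : Even (finrank ℝ S) := ⟨p + 1, by omega⟩
    have hk : 2 * j + 1 ≤ finrank ℝ S := by omega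
    refine (hd (n + 1)).middle (g := LinearMap.codRestrict _ (Gr.connecting hS' (even_two_mul j) hk h n)
      (Gr.prP_connecting hS' (even_two_mul j) hk h)) (P := (H.map n (prP (Gr S' (2 * j)) S')).ker) ?_
      (Gr.up_injective hS' (even_two_mul j) h (n + 1) hk) ?_ fun y => ⟨fun hy => ?_, ?_⟩
    · convert I.hasDim_ker (S' := S') (by omega) hj n using 2
      · simp
      · congr 1; omega
    · rintro ⟨c, hc⟩
      obtain ⟨x, hx⟩ := Gr.exists_connecting_eq hS' (even_two_mul j) hk h hc
      exact ⟨x, Subtype.ext hx⟩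
    · exact Gr.exists_up_eq hS' (even_two_mul j) hk h (congrArg Subtype.val hy)
    · rintro ⟨x, rfl⟩
      exact Subtype.ext (Gr.connecting_up hS' (even_two_mul j) hk h x)

lemma conj_eq_neg (h : IsCut S e S') (hS : finrank ℝ S = 2 * p + 2) (hj : j ≤ p) {n : ℕ}
    (hn : Odd n) (x : H n (Gr S (2 * j + 1))) :
    H.map n (Gr.conj (isOrth_refl h.mem)) x = -x := by
  have hf := h.finrank
  have hS' : Even (finrank ℝ S) := ⟨p + 1, by omega⟩
  have hk : 2 * j + 1 ≤ finrank ℝ S := by omega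
  obtain _ | n := n
  · simp at hn
  rw [← add_eq_zero_iff_eq_neg]
  obtain ⟨y, hy⟩ := Gr.exists_up_eq hS' (even_two_mul j) hk h
    (x := H.map (n + 1) (Gr.conj (isOrth_refl h.mem)) x + x) (by
      rw [map_add, Gr.connecting_conj, neg_add_cancel])
  have hd := I.hasDim_cut (S' := S') (by omega) hj (n + 1)
  rw [I.odd _ _ hn] at hd
  rw [← hy, hd.eq_zero y, map_zero]

end EvenGr

end RatHomology

namespace RatHomology

open Module

variable {E : Type} [NormedAddCommGroup E] [InnerProductSpace ℝ E] [FiniteDimensional ℝ E]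
  {S S' S'' S₃ T : Submodule ℝ E} {e f u : E} {k l : ℕ}

lemma injective_of_comp_injective {X Y Z : Type} [TopologicalSpace X] [TopologicalSpace Y]
    [TopologicalSpace Z] {a : C(X, Y)} {b : C(Y, Z)} {n : ℕ}
    (ha : ∀ z, ∃ y, H.map n a y = z) (hb : Function.Injective (H.map n (b.comp a))) :
    Function.Injective (H.map n b) := by
  rw [H.map_comp] at hb
  exact Function.Injective.of_comp_right hb ha

namespace EvenGr

variable {c₀ c₁ : ℕ → ℕ → ℤ} {p i : ℕ}

section Const

variable (I : EvenGr E c₀ p) (h : IsCut S' e S'') (hS : finrank ℝ S' = 2 * p + 3) (hi : i ≤ p)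

include I h hS hi

lemma const_eq_zero {n : ℕ} (hn : Odd n) (x : H n (Gr S'' (2 * i + 1))) :
    H.map n (Flag.const (2 * i + 1) h) x = 0 := by
  have hf := h.finrank
  obtain ⟨u, S₃, h₃⟩ := exists_isCut (S := S'') (by omega)
  obtain ⟨T, hT, hT'⟩ := h.swap h₃
  have hfT := hT.finrank
  refine eq_zero_of_eq_neg ?_
  rw [← map_neg, ← I.conj_eq_neg h₃ (by omega) hi hn, H.map_map, Flag.const_conj h₃.mem, ← H.map_map]
  have h1 := Flag.map_neg_of_odd (k := 2 * i + 1) ⟨p + 1, by omega⟩ hT n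
  have h2 := Flag.neg_of_even (S := S') (k := 2 * i + 1) (l := 2 * (p - i) + 2) (by omega) (by omega)
    ((even_two_mul _).add even_two) n (H.map n (Flag.const (2 * i + 1) h) x)
  rw [h1] at h2
  exact h2.symm

lemma hasDim_fibre (n : ℕ) :
    HasDim (H.map n (prP (Gr S'' (2 * i + 1)) S'')).ker (if 2 * p + 1 ≤ n then
      c₀ i (n - (2 * p + 1)) + (if 2 * p + 1 ≤ n - (2 * p + 1) then
        c₀ i (n - (2 * p + 1) - (2 * p + 1)) else 0) else 0) := by
  have hf := h.finrank
  exact (fibreHomology _ (r := 2 * p + 1) (by omega)).hasDim (I.hasDim_odd (S := S'') (by omega) hi) n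

lemma eq_zero_of_turn_eq_zero {n : ℕ} (hn : Odd n) {c : H n (Gr S'' (2 * i + 1) × Punctured S'')}
    (hc : H.map n (prP (Gr S'' (2 * i + 1)) S'') c = 0)
    (hc' : H.map n (Flag.turn S'' (2 * i + 1)) c = 0) : c = 0 := by
  have hf := h.finrank
  have h1 : HasDim (H n (Gr S'' (2 * i + 1))) (if 2 * p + 1 ≤ n then c₀ i (n - (2 * p + 1)) else 0) := by
    convert I.hasDim_odd (S := S'') (by omega) hi n using 1
    rw [I.odd i n hn, zero_add]
  have h2 : HasDim (H.map n (prP (Gr S'' (2 * i + 1)) S'')).ker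
      (if 2 * p + 1 ≤ n then c₀ i (n - (2 * p + 1)) else 0) := by
    convert I.hasDim_fibre h hS hi n using 1
    split_ifs with h3 h4
    · rw [I.odd i (n - (2 * p + 1) - (2 * p + 1)), add_zero]
      grind
    · rw [add_zero]
    · rfl
  have h3 := h2.injective_of_surjective h1 (f := H.map n (Flag.turn S'' (2 * i + 1)) ∘ₗ
    (H.map n (prP (Gr S'' (2 * i + 1)) S'')).ker.subtype) fun y => by
      obtain ⟨c, hc, hc'⟩ := (Flag.mvSeq (2 * i + 1) h).exists_of_eq (x := 0) (y := y) (by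
        rw [map_zero, I.const_eq_zero h.neg hS hi hn])
      exact ⟨⟨c, hc⟩, hc'⟩
  exact congrArg Subtype.val (h3 (a₁ := ⟨c, hc⟩) (a₂ := 0) (by simpa using hc'))

lemma exists_const_up_eq (h₃ : IsCut S'' f S₃) {n : ℕ} (hn : Even n)
    (z : H n (Flag S' (2 * i + 1))) :
    ∃ y, H.map n ((Flag.const (2 * i + 1) h).comp (Gr.up (2 * i) h₃)) y = z := by
  have hf := h.finrank
  obtain ⟨w⟩ := exists_punctured (S := S'') (by omega)
  have h1 : ∃ x, H.map n (Flag.const (2 * i + 1) h) x = z := by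
    obtain _ | n := n
    · exact Flag.exists_map_const_eq_zero h w z
    · refine Flag.exists_map_const_eq h w ?_
      exact I.eq_zero_of_turn_eq_zero h hS hi (by simpa [Nat.even_add_one] using hn)
        ((Flag.mvSeq _ h).f_δ z) ((Flag.mvSeq _ h).g_δ z)
  obtain ⟨x, rfl⟩ := h1
  obtain ⟨y, rfl⟩ := (I.up_bijective_of_even h₃ (by omega) hi hn).2 x
  exact ⟨y, by rw [H.map_map]⟩

end Const

section Step

variable (I₁ : EvenGr E c₁ (p + 1)) (h : IsCut S' e S'') (h₃ : IsCut S'' f S₃)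
  (hS : finrank ℝ S' = 2 * p + 3) (hi : i ≤ p)

include I₁ hS hi

lemma fst_const_up_injective (n : ℕ) : Function.Injective (H.map n
    ((Flag.fst S' (2 * i + 1)).comp ((Flag.const (2 * i + 1) h).comp (Gr.up (2 * i) h₃)))) := by
  have hf := h.finrank
  have hf₃ := h₃.finrank
  obtain ⟨v, S₄, h₄⟩ := exists_isCut (S := S₃) (by omega)
  have hf₄ := h₄.finrank
  obtain ⟨T, hT, hT'⟩ := h.swap h₃
  have hfT := hT.finrank
  have h1 : (Flag.fst S' (2 * i + 1)).comp ((Flag.const (2 * i + 1) h).comp (Gr.up (2 * i) h₃)) =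
      (Gr.up (2 * i) hT).comp (Gr.inc (2 * i) hT'.le) := rfl
  rw [h1, H.map_comp]
  refine (Gr.up_bijective ⟨p + 1, by omega⟩ hT (even_two_mul i) (by omega) n).1.comp ?_
  have h2 := I₁.inc_injective hT' h₄ (by omega) i (by omega) n
  refine Function.Injective.of_comp_right (g := H.map n (Gr.inc (2 * i) h₄.le)) ?_
    (Gr.inc_bijective ⟨p, by omega⟩ h₄ (even_two_mul i) (by omega) n).2
  rw [← LinearMap.coe_comp, ← H.map_comp]
  exact h2

lemma sum_const_up_injective (n : ℕ) : Function.Injective (H.map n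
    ((Flag.sum S' (2 * i + 1)).comp ((Flag.const (2 * i + 1) h).comp (Gr.up (2 * i) h₃)))) := by
  have hf := h.finrank
  have hf₃ := h₃.finrank
  obtain ⟨v, S₄, h₄⟩ := exists_isCut (S := S₃) (by omega)
  have hf₄ := h₄.finrank
  obtain ⟨T, hT, hT'⟩ := h₃.swap h₄
  obtain ⟨U, hU, hU'⟩ := h.swap hT
  have hfU := hU.finrank
  refine Function.Injective.of_comp_right (g := H.map n (Gr.inc (2 * i) h₄.le)) ?_
    (Gr.inc_bijective ⟨p, by omega⟩ h₄ (even_two_mul i) (by omega) n).2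
  rw [← LinearMap.coe_comp, ← H.map_comp]
  have h1 : ((Flag.sum S' (2 * i + 1)).comp ((Flag.const (2 * i + 1) h).comp
      (Gr.up (2 * i) h₃))).comp (Gr.inc (2 * i) h₄.le) =
      (Gr.inc (2 * i + 1 + 1) hU.le).comp ((Gr.up (2 * i + 1) hU').comp (Gr.up (2 * i) hT')) := rfl
  rw [h1, H.map_comp]
  exact (Gr.inc_bijective ⟨p + 1, by omega⟩ hU ⟨i + 1, by omega⟩ (by omega) n).1.comp
    (I₁.up_injective hU' hT' (by omega) i (by omega) n)

end Step

section Flag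

variable (I₀ : EvenGr E c₀ p) (I₁ : EvenGr E c₁ (p + 1)) (hS : finrank ℝ S' = 2 * p + 3) (hi : i ≤ p)

include I₀ I₁ hS hi

lemma fst_injective {n : ℕ} (hn : Even n) : Function.Injective (H.map n (Flag.fst S' (2 * i + 1))) := by
  obtain ⟨e, S'', h⟩ := exists_isCut (S := S') (by omega)
  have hf := h.finrank
  obtain ⟨f, S₃, h₃⟩ := exists_isCut (S := S'') (by omega)
  exact injective_of_comp_injective (I₀.exists_const_up_eq h hS hi h₃ hn)
    (I₁.fst_const_up_injective h h₃ hS hi n)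

lemma sum_injective {n : ℕ} (hn : Even n) : Function.Injective (H.map n (Flag.sum S' (2 * i + 1))) := by
  obtain ⟨e, S'', h⟩ := exists_isCut (S := S') (by omega)
  have hf := h.finrank
  obtain ⟨f, S₃, h₃⟩ := exists_isCut (S := S'') (by omega)
  exact injective_of_comp_injective (I₀.exists_const_up_eq h hS hi h₃ hn)
    (I₁.sum_const_up_injective h h₃ hS hi n)

lemma hasDim_flag_even {n : ℕ} (hn : Even n) : HasDim (H n (Flag S' (2 * i + 1))) (c₀ i n) := by
  obtain ⟨e, S'', h⟩ := exists_isCut (S := S') (by omega)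
  have hf := h.finrank
  obtain ⟨f, S₃, h₃⟩ := exists_isCut (S := S'') (by omega)
  have hf₃ := h₃.finrank
  have h1 := I₁.fst_const_up_injective h h₃ hS hi n
  rw [H.map_comp] at h1
  exact (I₀.hasDim_cut (S' := S₃) (by omega) hi n).of_bijective
    ⟨Function.Injective.of_comp h1, I₀.exists_const_up_eq h hS hi h₃ hn⟩

lemma hasDim_flag_odd {n : ℕ} (hn : Even n) : HasDim (H (n + 1) (Flag S' (2 * i + 1)))
    (if 4 * p + 2 ≤ n then c₀ i (n - (4 * p + 2)) else 0) := by
  obtain ⟨e, S'', h⟩ := exists_isCut (S := S') (by omega)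
  have hf := h.finrank
  obtain ⟨f, S₃, h₃⟩ := exists_isCut (S := S'') (by omega)
  obtain ⟨w⟩ := exists_punctured (S := S'') (by omega)
  have hc : Function.Injective (H.map n (Flag.const (2 * i + 1) h.neg)) := by
    have h1 := I₁.fst_const_up_injective h.neg h₃ hS hi n
    rw [H.map_comp] at h1
    have h2 : Function.Injective (H.map n ((Flag.const (2 * i + 1) h.neg).comp (Gr.up (2 * i) h₃))) :=
      .of_comp h1
    rw [H.map_comp] at h2
    exact Function.Injective.of_comp_right h2 (I₀.up_bijective_of_even h₃ (by omega) hi hn).2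
  have ht {c : H n (Gr S'' (2 * i + 1) × Punctured S'')}
      (h0 : H.map n (prP (Gr S'' (2 * i + 1)) S'') c = 0) :
      H.map n (Flag.turn S'' (2 * i + 1)) c = 0 := by
    refine hc ?_
    rw [← (Flag.mvSeq (2 * i + 1) h).comm, h0, map_zero, map_zero]
  have hK : HasDim (H.map n (prP (Gr S'' (2 * i + 1)) S'')).ker
      (if 4 * p + 2 ≤ n then c₀ i (n - (4 * p + 2)) else 0) := by
    convert I₀.hasDim_fibre h hS hi n using 1
    by_cases h1 : 2 * p + 1 ≤ n
    · rw [if_pos h1, I₀.odd i (n - (2 * p + 1)) (by grind), zero_add]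
      have : (4 * p + 2 ≤ n) = (2 * p + 1 ≤ n - (2 * p + 1)) := propext (by omega)
      simp only [this]
      congr 2
      omega
    · rw [if_neg h1, if_neg (by omega)]
  refine hK.of_bijective' (f := LinearMap.codRestrict _ ((Flag.mvSeq (2 * i + 1) h).δ n)
    (Flag.mvSeq (2 * i + 1) h).f_δ) ⟨(injective_iff_map_eq_zero _).2 fun z hz => ?_, fun c => ?_⟩
  · obtain ⟨x, rfl⟩ := Flag.exists_map_const_eq h w (congrArg Subtype.val hz)
    exact I₀.const_eq_zero h hS hi hn.add_one x
  · obtain ⟨z, hz⟩ := (Flag.mvSeq (2 * i + 1) h).exists_δ_eq c.2 (ht c.2)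
    exact ⟨z, Subtype.ext hz⟩

end Flag

end EvenGr

end RatHomology

namespace RatHomology

open Module

variable {E : Type} [NormedAddCommGroup E] [InnerProductSpace ℝ E] [FiniteDimensional ℝ E]
  {S S' S'' : Submodule ℝ E} {e f : E} {k l : ℕ}

lemma Gr.hasDim_zero (S : Submodule ℝ E) (n : ℕ) : HasDim (H n (Gr S 0)) (if n = 0 then 1 else 0) :=
  hasDim_of_subsingleton n

lemma Gr.hasDim_of_eq (h : k = finrank ℝ S) (n : ℕ) :
    HasDim (H n (Gr S k)) (if n = 0 then 1 else 0) := by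
  have := Gr.subsingleton_of_eq h
  have := Gr.nonempty_of_eq h
  exact hasDim_of_subsingleton n

lemma Gr.inc_zero_injective (hk : k = 0) (h : S' ≤ S) (n : ℕ) :
    Function.Injective (H.map n (Gr.inc k h)) := by
  subst hk
  exact (bijective_of_subsingleton _ n).1

lemma Gr.up_up_injective (h : IsCut S e S') (h' : IsCut S' f S'') (hk : k = finrank ℝ S'') (n : ℕ) :
    Function.Injective (H.map n ((Gr.up (k + 1) h).comp (Gr.up k h'))) := by
  have h1 := h.finrank
  have h2 := h'.finrank
  have h3 : k + 1 + 1 = finrank ℝ S := by omega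
  have := Gr.subsingleton_of_eq hk
  have := Gr.nonempty_of_eq hk
  have := Gr.subsingleton_of_eq h3
  have := Gr.nonempty_of_eq h3
  exact (bijective_of_subsingleton _ n).1

namespace EvenGr

variable {c₀ c₁ c₂ : ℕ → ℕ → ℤ} {p i : ℕ}

section Middle

variable (I₀ : EvenGr E c₀ p) (I₁ : EvenGr E c₁ (p + 1)) (h : IsCut S e S')
  (hS : finrank ℝ S = 2 * p + 4) (hi : i ≤ p)

include I₁ h hS hi

lemma hasDim_cut_odd (n : ℕ) : HasDim (H n (Gr S' (2 * i + 1))) (c₁ i n) := by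
  have hf := h.finrank
  obtain ⟨f, S'', h'⟩ := exists_isCut (S := S') (by omega)
  have hf' := h'.finrank
  exact (I₁.hasDim S'' (by omega) i (by omega) n).of_bijective
    (Gr.up_bijective ⟨p + 1, by omega⟩ h' (even_two_mul i) (by omega) n)

lemma hasDim_cut_even (n : ℕ) : HasDim (H n (Gr S' (2 * i + 1 + 1))) (c₁ (i + 1) n) := by
  have hf := h.finrank
  exact I₁.hasDim_cut (j := i + 1) (by omega) (by omega) n

lemma eq_zero_of_odd {n : ℕ} (hn : Odd n) (x : H n (Gr S' (2 * i + 1))) : x = 0 := by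
  have := I₁.hasDim_cut_odd h hS hi n
  rw [I₁.odd i n hn] at this
  exact this.eq_zero x

lemma eq_zero_of_odd' {n : ℕ} (hn : Odd n) (x : H n (Gr S' (2 * i + 1 + 1))) : x = 0 := by
  have := I₁.hasDim_cut_even h hS hi n
  rw [I₁.odd _ n hn] at this
  exact this.eq_zero x

include I₀

lemma middle_eq_zero {n : ℕ} (hn : Odd n) (z : H n (Gr S (2 * i + 1 + 1))) : z = 0 := by
  have hf := h.finrank
  obtain _ | n := n
  · simp at hn
  have h1 : (Gr.mvSeq (2 * i + 1) h).δ n z = 0 :=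
    I₀.sum_injective I₁ (by omega) hi (by simpa [Nat.odd_add_one] using hn)
      (((Gr.mvSeq (2 * i + 1) h).f_δ z).trans (map_zero _).symm)
  obtain ⟨x, y, rfl⟩ := (Gr.mvSeq (2 * i + 1) h).exists_eq_add h1
  rw [I₁.eq_zero_of_odd h hS hi hn y, I₁.eq_zero_of_odd' h hS hi hn x, map_zero, map_zero, add_zero]

lemma middle_inc_injective (n : ℕ) : Function.Injective (H.map n (Gr.inc (2 * i + 1 + 1) h.le)) := by
  have hf := h.finrank
  refine (injective_iff_map_eq_zero _).2 fun x hx => ?_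
  obtain hn | hn := n.even_or_odd
  · obtain ⟨c, rfl, hc⟩ := (Gr.mvSeq (2 * i + 1) h).exists_of_eq (y := 0) (by rw [hx, map_zero])
    rw [I₀.fst_injective I₁ (by omega) hi hn (hc.trans (map_zero _).symm), map_zero]
  · exact I₁.eq_zero_of_odd' h hS hi hn x

lemma middle_up_injective (n : ℕ) : Function.Injective (H.map n (Gr.up (2 * i + 1) h)) := by
  have hf := h.finrank
  refine (injective_iff_map_eq_zero _).2 fun x hx => ?_
  obtain hn | hn := n.even_or_odd
  · obtain ⟨c, hc, rfl⟩ := (Gr.mvSeq (2 * i + 1) h).exists_of_eq (x := 0) (by rw [hx, map_zero])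
    rw [I₀.sum_injective I₁ (by omega) hi hn (hc.trans (map_zero _).symm), map_zero]
  · exact I₁.eq_zero_of_odd h hS hi hn x

lemma hasDim_middle {n : ℕ} (hn : Even n) : HasDim (H n (Gr S (2 * i + 1 + 1)))
    (c₁ (i + 1) n + c₁ i n - c₀ i n + if 4 * p + 4 ≤ n then c₀ i (n - (4 * p + 4)) else 0) := by
  have hf := h.finrank
  let D := Gr.mvSeq (2 * i + 1) h
  let g : H n (Gr S' (2 * i + 1 + 1)) × H n (Gr S' (2 * i + 1)) →ₗ[ℚ] H n (Gr S (2 * i + 1 + 1)) :=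
    (H.map n (Gr.inc (2 * i + 1 + 1) h.le)).coprod (H.map n (Gr.up (2 * i + 1) h))
  let a : H n (Flag S' (2 * i + 1)) →ₗ[ℚ] H n (Gr S' (2 * i + 1 + 1)) × H n (Gr S' (2 * i + 1)) :=
    (H.map n (Flag.sum S' (2 * i + 1))).prod (-H.map n (Flag.fst S' (2 * i + 1)))
  have hg : HasDim (LinearMap.range g) (c₁ (i + 1) n + c₁ i n - c₀ i n) := by
    refine (I₀.hasDim_flag_even I₁ (by omega) hi hn).range (f := a)
      ((I₁.hasDim_cut_even h hS hi n).prod (I₁.hasDim_cut_odd h hS hi n)) ?_ fun y => ?_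
    · exact fun x y hxy => I₀.sum_injective I₁ (by omega) hi hn (congrArg Prod.fst hxy)
    · constructor
      · intro hy
        obtain ⟨c, hc, hc'⟩ := D.exists_of_eq (x := y.1) (y := -y.2) (by
          rw [map_neg, ← add_eq_zero_iff_eq_neg]; exact hy)
        exact ⟨c, Prod.ext hc (by simp [a, hc'])⟩
      · rintro ⟨x, rfl⟩
        have := D.comm x
        simp [g, a, this]
  have hg0 {y} : y ∈ LinearMap.range g ↔ ∃ x x', H.map n (Gr.inc (2 * i + 1 + 1) h.le) x +
      H.map n (Gr.up (2 * i + 1) h) x' = y := by simp [g]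
  obtain _ | _ | n := n
  · rw [if_neg (by omega), add_zero]
    refine hg.of_bijective (f := (LinearMap.range g).subtype) ⟨Subtype.val_injective, fun y => ?_⟩
    exact ⟨⟨y, hg0.2 (D.exists_eq_add_zero y)⟩, rfl⟩
  · simp at hn
  · have hn' : Even n := by simpa [Nat.even_add_one] using hn
    have hm := hg.middle (I₀.hasDim_flag_odd I₁ (S' := S') (by omega) hi hn')
      (f := (LinearMap.range g).subtype) (g := D.δ (n + 1)) Subtype.val_injective
      (fun c => D.exists_δ_eq (I₁.eq_zero_of_odd' h hS hi hn'.add_one _)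
        (I₁.eq_zero_of_odd h hS hi hn'.add_one _))
      (fun y => ⟨fun hy => ⟨⟨y, hg0.2 (D.exists_eq_add hy)⟩, rfl⟩, by
        rintro ⟨⟨y, hy⟩, rfl⟩
        obtain ⟨x, x', rfl⟩ := hg0.1 hy
        simp only [Submodule.subtype_apply, map_add]
        rw [D.δ_p, D.δ_q, add_zero]⟩)
    convert hm using 2
    have : (4 * p + 4 ≤ n + 1 + 1) = (4 * p + 2 ≤ n) := propext (by omega)
    simp only [this]
    congr 2
    omega

end Middle

theorem step (I₀ : EvenGr E c₀ p) (I₁ : EvenGr E c₁ (p + 1)) (hodd : ∀ j n, Odd n → c₂ j n = 0)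
    (hzero : ∀ n, c₂ 0 n = if n = 0 then 1 else 0) (htop : ∀ n, c₂ (p + 2) n = if n = 0 then 1 else 0)
    (hrec : ∀ i ≤ p, ∀ n, Even n → c₂ (i + 1) n = c₁ (i + 1) n + c₁ i n - c₀ i n +
      if 4 * p + 4 ≤ n then c₀ i (n - (4 * p + 4)) else 0) : EvenGr E c₂ (p + 2) where
  odd := hodd
  hasDim S hS j hj n := by
    obtain _ | i := j
    · rw [hzero]; exact Gr.hasDim_zero S n
    obtain hi | hi := Nat.lt_or_eq_of_le hj
    · obtain ⟨e, S', h⟩ := exists_isCut (S := S) (by omega)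
      obtain hn | hn := n.even_or_odd
      · rw [hrec i (by omega) n hn]
        exact I₀.hasDim_middle I₁ h (by omega) (by omega) hn
      · rw [hodd _ n hn]
        exact HasDim.zero (I₀.middle_eq_zero I₁ h (by omega) (by omega) hn)
    · rw [hi, htop]
      exact Gr.hasDim_of_eq hS.symm n
  inc_injective {S S' S''} e f h h' hS j hj n := by
    obtain _ | i := j
    · exact Gr.inc_zero_injective rfl _ n
    have hf := h.finrank
    have hf' := h'.finrank
    have h1 : Gr.inc (2 * (i + 1)) (h'.le.trans h.le) =
      (Gr.inc (2 * i + 1 + 1) h.le).comp (Gr.inc (2 * i + 1 + 1) h'.le) := rfl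
    rw [h1, H.map_comp]
    exact (I₀.middle_inc_injective I₁ h (by omega) (by omega) n).comp
      (Gr.inc_bijective ⟨p + 1, by omega⟩ h' ⟨i + 1, by omega⟩ (by omega) n).1
  up_injective {S S' S''} e f h h' hS j hj n := by
    have hf := h.finrank
    have hf' := h'.finrank
    obtain hi | hi := Nat.lt_or_eq_of_le hj
    · rw [H.map_comp]
      exact (I₀.middle_up_injective I₁ h (by omega) (by omega) n).comp
        (Gr.up_bijective ⟨p + 1, by omega⟩ h' (even_two_mul j) (by omega) n).1
    · exact Gr.up_up_injective h h' (by omega) n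

theorem base (hp : p ≤ 1) (hodd : ∀ j n, Odd n → c₀ j n = 0)
    (hzero : ∀ n, c₀ 0 n = if n = 0 then 1 else 0) (htop : ∀ n, c₀ p n = if n = 0 then 1 else 0) :
    EvenGr E c₀ p where
  odd := hodd
  hasDim S hS j hj n := by
    obtain _ | i := j
    · rw [hzero]; exact Gr.hasDim_zero S n
    · obtain rfl : i + 1 = p := by omega
      rw [htop]
      exact Gr.hasDim_of_eq hS.symm n
  inc_injective {S S' S''} e f h h' hS j hj n := by
    obtain rfl : j = 0 := by omega
    exact Gr.inc_zero_injective rfl _ n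
  up_injective {S S' S''} e f h h' hS j hj n := by
    have hf := h.finrank
    have hf' := h'.finrank
    exact Gr.up_up_injective h h' (by omega) n

end EvenGr

end RatHomology

namespace RatHomology

open Module

lemma qInt_add (a b : ℕ) : qInt (a + b) = qInt a + X ^ a * qInt b := by
  simp only [qInt, Finset.sum_range_add, Finset.mul_sum, pow_add]

lemma one_sub_X_mul_qInt (a : ℕ) : (1 - X) * qInt a = 1 - X ^ a := by
  simpa [qInt] using mul_neg_geom_sum (X : ℤ[X]) a

lemma qInt_ne_zero (a : ℕ) : qInt (a + 1) ≠ 0 := by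
  intro h
  have := one_sub_X_mul_qInt (a + 1)
  rw [h, mul_zero, eq_comm, sub_eq_zero] at this
  simpa using congrArg (Polynomial.eval 0) this

lemma qFact_ne_zero : ∀ a : ℕ, qFact a ≠ 0
  | 0 => one_ne_zero
  | a + 1 => mul_ne_zero (qInt_ne_zero a) (qFact_ne_zero a)

lemma qInt_eq (i a : ℕ) : qInt (i + a + 2) =
    qInt (a + 1) + qInt (i + 1) - (1 - X) * (qInt (i + 1) * qInt (a + 1)) := by
  rw [show i + a + 2 = (i + 1) + (a + 1) by omega, qInt_add]
  linear_combination (qInt (a + 1)) * one_sub_X_mul_qInt (i + 1)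

section Binomial

variable {B : ℕ → ℕ → Polynomial ℤ}
  (hB : ∀ a b : ℕ, b ≤ a → B a b * (qFact b * qFact (a - b)) = qFact a)

include hB

lemma gauss_zero (a : ℕ) : B a 0 = 1 := by
  have := hB a 0 (Nat.zero_le _)
  rw [qFact, one_mul, Nat.sub_zero] at this
  exact mul_right_cancel₀ (qFact_ne_zero a) (this.trans (one_mul _).symm)

lemma gauss_self (a : ℕ) : B a a = 1 := by
  have := hB a a le_rfl
  rw [Nat.sub_self, qFact, mul_one] at this
  exact mul_right_cancel₀ (qFact_ne_zero a) (this.trans (one_mul _).symm)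

lemma gauss_rec {p i : ℕ} (hi : i ≤ p) :
    B (p + 2) (i + 1) = B (p + 1) (i + 1) + B (p + 1) i - B p i + X ^ (p + 1) * B p i := by
  obtain ⟨a, rfl⟩ := Nat.exists_eq_add_of_le hi
  have h0 := hB (i + a) i (by omega)
  have h1 := hB (i + a + 1) i (by omega)
  have h2 := hB (i + a + 1) (i + 1) (by omega)
  have h3 := hB (i + a + 2) (i + 1) (by omega)
  rw [show i + a - i = a by omega] at h0
  rw [show i + a + 1 - i = a + 1 by omega] at h1
  rw [show i + a + 1 - (i + 1) = a by omega] at h2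
  rw [show i + a + 2 - (i + 1) = a + 1 by omega] at h3
  refine mul_right_cancel₀ (mul_ne_zero (qFact_ne_zero (i + 1)) (qFact_ne_zero (a + 1))) ?_
  have hq := one_sub_X_mul_qInt (i + a + 1)
  have hr := qInt_eq i a
  simp only [qFact] at *
  linear_combination h3 - qInt (a + 1) * h2 - qInt (i + 1) * h1 +
    (1 - X ^ (i + a + 1)) * qInt (i + 1) * qInt (a + 1) * h0 +
    qInt (i + a + 1) * qFact (i + a) * hr -
    qInt (i + 1) * qInt (a + 1) * qFact (i + a) * hq

theorem evenGr {E : Type} [NormedAddCommGroup E] [InnerProductSpace ℝ E] [FiniteDimensional ℝ E]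
    (m : ℕ) : EvenGr E (fun j n => ((B m j).comp (X ^ 4)).coeff n) m := by
  have hodd : ∀ m j n, Odd n → ((B m j).comp (X ^ 4)).coeff n = 0 := by
    intro m j n hn
    rw [← expand_eq_comp_X_pow, coeff_expand (by norm_num), if_neg]
    exact fun h => Nat.not_even_iff_odd.2 hn (even_iff_two_dvd.2 (dvd_trans (by norm_num) h))
  have hone : ∀ n, ((1 : ℤ[X]).comp (X ^ 4)).coeff n = if n = 0 then 1 else 0 := fun n => by
    rw [one_comp, coeff_one]
  induction m using Nat.strong_induction_on with
  | _ m ih =>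
    obtain hm | ⟨p, rfl⟩ : m ≤ 1 ∨ ∃ p, m = p + 2 := by
      obtain _ | _ | p := m
      · simp
      · simp
      · exact Or.inr ⟨p, rfl⟩
    · exact EvenGr.base hm (hodd m) (fun n => by rw [gauss_zero hB, hone])
        (fun n => by rw [gauss_self hB, hone])
    · refine (ih p (by omega)).step (ih (p + 1) (by omega)) (hodd _)
        (fun n => by rw [gauss_zero hB, hone]) (fun n => by rw [gauss_self hB, hone]) ?_
      intro i hi n _
      rw [gauss_rec hB hi]
      simp only [add_comp, sub_comp, mul_comp, X_pow_comp, coeff_add, coeff_sub, ← pow_mul,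
        coeff_X_pow_mul']
      rfl

theorem hasDim_gr_odd {E : Type} [NormedAddCommGroup E] [InnerProductSpace ℝ E]
    [FiniteDimensional ℝ E] {S : Submodule ℝ E} {m j : ℕ} (hm : 1 ≤ m) (hj : j ≤ m - 1)
    (hS : finrank ℝ S = 2 * m) (n : ℕ) :
    HasDim (H n (Gr S (2 * j + 1)))
      (((1 + X ^ (2 * m - 1)) * (B (m - 1) j).comp (X ^ 4)).coeff n) := by
  have := (evenGr hB (E := E) (m - 1)).hasDim_odd (S := S) (by omega) hj n
  rw [add_mul, one_mul, coeff_add, coeff_X_pow_mul', show 2 * m - 1 = 2 * (m - 1) + 1 by omega]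
  exact this

end Binomial

end RatHomology

namespace RatHomology

open Module

lemma finrank_homology_eq (S : ShortComplex (ModuleCat.{0} ℚ)) {V M : Type} [AddCommGroup V]
    [Module ℚ V] [AddCommGroup M] [Module ℚ M] (e : S.X₂ ≃ₗ[ℚ] V) (Z : Submodule ℚ V)
    (hZ : ∀ x, S.g.hom x = 0 ↔ e x ∈ Z) (r : Z →ₗ[ℚ] M) (hr : Function.Surjective r)
    (hr' : ∀ x, r x = 0 ↔ ∃ y, e (S.f.hom y) = x) : finrank ℚ S.homology = finrank ℚ M := by
  have hZ' : (LinearMap.ker S.g.hom).map (e : S.X₂ →ₗ[ℚ] V) = Z := by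
    ext v
    obtain ⟨x, rfl⟩ := e.surjective v
    rw [← hZ]
    simp
  let φ : LinearMap.ker S.g.hom ≃ₗ[ℚ] Z := e.ofSubmodules _ _ hZ'
  rw [S.moduleCatHomologyIso.toLinearEquiv.finrank_eq]
  refine LinearEquiv.finrank_eq ((Submodule.quotEquivOfEq _ _ ?_).trans
    ((r ∘ₗ φ.toLinearMap).quotKerEquivOfSurjective (hr.comp φ.surjective)))
  ext x
  rw [LinearMap.mem_ker, LinearMap.comp_apply, hr', LinearMap.mem_range]
  exact exists_congr fun y => Subtype.ext_iff.trans e.injective.eq_iff.symm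

/-- The dual cochain complex of a chain complex of rational vector spaces. -/
noncomputable abbrev cochains (C : ChainComplex (ModuleCat.{0} ℚ) ℕ) :
    HomologicalComplex (ModuleCat ℚ) (ComplexShape.down ℕ).symm :=
  (((linearYoneda ℚ (ModuleCat ℚ)).obj (ModuleCat.of ℚ ℚ)).mapHomologicalComplex _).obj C.op

/-- Cochains on a chain complex are linear functionals. -/
noncomputable def cochainEquiv (C : ChainComplex (ModuleCat.{0} ℚ) ℕ) (n : ℕ) :
    (cochains C).X n ≃ₗ[ℚ] Dual ℚ (C.X n) := ModuleCat.homLinearEquiv (S := ℚ)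

variable (X : Type) [TopologicalSpace X]

/-- Singular cochains are functionals on singular chains. -/
noncomputable def singularCochainEquiv (n : ℕ) :
    (cochains (singularChainComplex ℚ (TopCat.of X))).X n ≃ₗ[ℚ] Dual ℚ (Chain n X) :=
  (cochainEquiv _ n).trans (chainEquiv n X).dualMap

variable {X}

lemma singularCochainEquiv_d (n : ℕ) (x) :
    singularCochainEquiv X (n + 1)
      (((cochains (singularChainComplex ℚ (TopCat.of X))).d n (n + 1)).hom x) =
    (bdry n X).dualMap (singularCochainEquiv X n x) := by
  refine LinearMap.ext fun a => ?_
  exact congrArg (cochainEquiv _ n x) (chainEquiv_bdry n a).symm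

lemma cocycle_iff (n : ℕ) (x) :
    ((cochains (singularChainComplex ℚ (TopCat.of X))).d n
      ((ComplexShape.down ℕ).symm.next n)).hom x = 0 ↔
      singularCochainEquiv X n x ∈ LinearMap.ker (bdry n X).dualMap := by
  have hn : (ComplexShape.down ℕ).symm.next n = n + 1 := ComplexShape.next_eq' _ rfl
  rw [hn, LinearMap.mem_ker, ← singularCochainEquiv_d, LinearEquiv.map_eq_zero_iff]

lemma coboundary_iff (n : ℕ) (φ : Dual ℚ (Chain n X)) :
    (∃ y, singularCochainEquiv X n (((cochains (singularChainComplex ℚ (TopCat.of X))).d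
      ((ComplexShape.down ℕ).symm.prev n) n).hom y) = φ) ↔ ∀ c ∈ cycles n X, φ c = 0 := by
  obtain _ | n := n
  · rw [HomologicalComplex.shape _ _ _ (by simp [ComplexShape.down, ComplexShape.symm])]
    constructor
    · rintro ⟨y, rfl⟩ c -
      exact LinearMap.congr_fun (map_zero (singularCochainEquiv X 0)) c
    · intro h
      refine ⟨0, LinearMap.ext fun c => ?_⟩
      rw [h c trivial]
      exact LinearMap.congr_fun (map_zero (singularCochainEquiv X 0)) c
  · have hn : (ComplexShape.down ℕ).symm.prev (n + 1) = n := ComplexShape.prev_eq' _ rfl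
    rw [hn]
    have h1 : (∃ y, singularCochainEquiv X (n + 1)
        (((cochains (singularChainComplex ℚ (TopCat.of X))).d n (n + 1)).hom y) = φ) ↔
        φ ∈ LinearMap.range (bdry n X).dualMap := by
      simp only [singularCochainEquiv_d]
      exact ((singularCochainEquiv X n).surjective.exists
        (p := fun ψ => (bdry n X).dualMap ψ = φ)).symm
    rw [h1, LinearMap.range_dualMap_eq_dualAnnihilator_ker, Submodule.mem_dualAnnihilator]
    rfl

variable (X) in
/-- Cocycles induce functionals on homology. -/
noncomputable def cocycleToDual (n : ℕ) :
    LinearMap.ker (bdry n X).dualMap →ₗ[ℚ] Dual ℚ (H n X) where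
  toFun x := Submodule.liftQ _ (x.1.domRestrict (cycles n X)) <| by
    rintro ⟨c, hc⟩ ⟨b, rfl⟩
    exact LinearMap.congr_fun x.2 b
  map_add' x y := by
    ext c
    simp
  map_smul' a x := by
    ext c
    simp

lemma cocycleToDual_mk {n : ℕ} (x) {c : Chain n X} (hc : c ∈ cycles n X) :
    cocycleToDual X n x (H.mk c hc) = x.1 c := rfl

lemma cocycleToDual_surjective (n : ℕ) : Function.Surjective (cocycleToDual X n) := by
  intro φ
  obtain ⟨ψ, hψ⟩ := LinearMap.exists_extend (φ ∘ₗ Submodule.mkQ _ : cycles n X →ₗ[ℚ] ℚ)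
  have hψ' (c) (hc : c ∈ cycles n X) : ψ c = φ (H.mk c hc) := LinearMap.congr_fun hψ ⟨c, hc⟩
  refine ⟨⟨ψ, LinearMap.ext fun b => ?_⟩, LinearMap.ext fun y => ?_⟩
  · rw [LinearMap.dualMap_apply, hψ' _ (bdry_mem_cycles b), (H.mk_eq_zero _).2 ⟨b, rfl⟩, map_zero]
    rfl
  · induction y using H.ind with
    | h c hc => rw [cocycleToDual_mk, hψ' c hc]

theorem finrank_singularCohomology (X : Type) [TopologicalSpace X] (n : ℕ) :
    finrank ℚ (singularCohomology ℚ (TopCat.of X) n) = finrank ℚ (H n X) := by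
  rw [← Subspace.dual_finrank_eq (K := ℚ) (V := H n X)]
  refine finrank_homology_eq _ (singularCochainEquiv X n) _ (cocycle_iff n) (cocycleToDual X n)
    (cocycleToDual_surjective n) fun x => Iff.trans ?_ (coboundary_iff n x.1).symm
  refine ⟨fun h c hc => ?_, fun h => LinearMap.ext fun y => ?_⟩
  · rw [← cocycleToDual_mk x hc, h]
    rfl
  · induction y using H.ind with
    | h c hc => exact h c hc

end RatHomology

namespace RatHomology

open Module

/-- A map with closed graph into a compact space is continuous. -/
lemma continuous_of_graph {X Y : Type} [TopologicalSpace X] [TopologicalSpace Y] [CompactSpace Y]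
    {f : X → Y} (h : IsClosed {p : X × Y | f p.1 = p.2}) : Continuous f := by
  refine continuous_iff_isClosed.2 fun C hC => ?_
  have := isClosedMap_fst_of_compactSpace _ (h.inter (hC.preimage continuous_snd))
  convert this using 1
  ext x
  constructor
  · exact fun hx => ⟨(x, f x), ⟨rfl, hx⟩, rfl⟩
  · rintro ⟨⟨x, y⟩, ⟨hxy, hy⟩, rfl⟩
    have hxy : f x = y := hxy
    exact Set.mem_preimage.2 (hxy ▸ hy)

section Frame

variable {n k : ℕ}

/-- The standard identification of `ℝⁿ` with Euclidean space. -/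
noncomputable def toE (n : ℕ) : (Fin n → ℝ) ≃L[ℝ] EuclideanSpace ℝ (Fin n) :=
  (EuclideanSpace.equiv (Fin n) ℝ).symm

/-- The span of a frame in Euclidean space. -/
noncomputable def frameSpan (A : Fin k → (Fin n → ℝ)) : Submodule ℝ (EuclideanSpace ℝ (Fin n)) :=
  (Submodule.span ℝ (Set.range A)).map (toE n : (Fin n → ℝ) →ₗ[ℝ] EuclideanSpace ℝ (Fin n))

lemma frameSpan_le {A : Fin k → (Fin n → ℝ)} {U : Submodule ℝ (EuclideanSpace ℝ (Fin n))} :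
    frameSpan A ≤ U ↔ ∀ i, toE n (A i) ∈ U := by
  rw [frameSpan, Submodule.map_le_iff_le_comap, Submodule.span_le, Set.range_subset_iff]
  rfl

lemma frameSpan_inj {A B : Fin k → (Fin n → ℝ)} :
    frameSpan A = frameSpan B ↔ Submodule.span ℝ (Set.range A) = Submodule.span ℝ (Set.range B) :=
  (Submodule.map_injective_of_injective (toE n).injective).eq_iff

lemma finrank_frameSpan {A : Fin k → (Fin n → ℝ)} (hA : LinearIndependent ℝ A) :
    finrank ℝ (frameSpan A) = k := by
  exact ((toE n).toLinearEquiv.finrank_map_eq (Submodule.span ℝ (Set.range A))).trans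
    ((finrank_span_eq_card hA).trans (Fintype.card_fin k))

/-- The projection onto the span of a frame. -/
noncomputable def frameGr (A : {A : Fin k → (Fin n → ℝ) // LinearIndependent ℝ A}) :
    Gr (⊤ : Submodule ℝ (EuclideanSpace ℝ (Fin n))) k :=
  ⟨(frameSpan A.1).starProjection, by
    have := (isGr_proj (frameSpan A.1)).mono le_top
    rwa [finrank_frameSpan A.2] at this⟩

lemma frameGr_eq_iff (A : {A : Fin k → (Fin n → ℝ) // LinearIndependent ℝ A})
    (P : Gr (⊤ : Submodule ℝ (EuclideanSpace ℝ (Fin n))) k) :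
    frameGr A = P ↔ ∀ i, P.1 (toE n (A.1 i)) = toE n (A.1 i) := by
  constructor
  · rintro rfl i
    exact Submodule.starProjection_eq_self_iff.2 (frameSpan_le.1 le_rfl i)
  · intro h
    have h1 : frameSpan A.1 = (P.1 : EuclideanSpace ℝ (Fin n) →ₗ[ℝ] EuclideanSpace ℝ (Fin n)).range := by
      refine Submodule.eq_of_le_of_finrank_eq (frameSpan_le.2 fun i => ⟨_, h i⟩) ?_
      rw [finrank_frameSpan A.2, P.2.finrank_range]
    refine Subtype.ext (IsGr.eq_proj (S := frameSpan A.1) (finrank_frameSpan A.2).symm ?_).symm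
    exact ⟨P.2.idem, P.2.symm, fun x => h1 ▸ ⟨x, rfl⟩, P.2.tr⟩

lemma continuous_frameGr : Continuous (frameGr : _ → Gr (⊤ : Submodule ℝ (EuclideanSpace ℝ (Fin n))) k) := by
  refine continuous_of_graph ?_
  simp only [frameGr_eq_iff, Set.ofPred_forall]
  have h (i : Fin k) : Continuous fun p : {A : Fin k → (Fin n → ℝ) // LinearIndependent ℝ A} ×
      Gr (⊤ : Submodule ℝ (EuclideanSpace ℝ (Fin n))) k => toE n (p.1.1 i) :=
    (toE n).continuous.comp ((continuous_apply i).comp (continuous_subtype_val.comp continuous_fst))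
  exact isClosed_iInter fun i => isClosed_eq (.clm_apply (by fun_prop) (h i)) (h i)

lemma frameGr_eq_frameGr (A B : {A : Fin k → (Fin n → ℝ) // LinearIndependent ℝ A}) :
    frameGr A = frameGr B ↔ grassSetoid k n A B := by
  refine Iff.trans ⟨fun h => ?_, fun h => ?_⟩ frameSpan_inj
  · have := congrArg (fun P => (P.1 : EuclideanSpace ℝ (Fin n) →ₗ[ℝ] EuclideanSpace ℝ (Fin n)).range) h
    simpa [frameGr, Submodule.range_starProjection] using this
  · exact Subtype.ext (by simp [frameGr, h])

lemma frameGr_surjective (P : Gr (⊤ : Submodule ℝ (EuclideanSpace ℝ (Fin n))) k) :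
    ∃ A, frameGr A = P := by
  let b := finBasisOfFinrankEq ℝ _ P.2.finrank_range
  let g : (P.1 : EuclideanSpace ℝ (Fin n) →ₗ[ℝ] EuclideanSpace ℝ (Fin n)).range →ₗ[ℝ] (Fin n → ℝ) :=
    ((toE n).symm : _ →ₗ[ℝ] (Fin n → ℝ)) ∘ₗ Submodule.subtype _
  have hg : LinearMap.ker g = ⊥ :=
    LinearMap.ker_eq_bot.2 ((toE n).symm.injective.comp Subtype.val_injective)
  refine ⟨⟨fun i => g (b i), b.linearIndependent.map' g hg⟩, (frameGr_eq_iff _ _).2 fun i => ?_⟩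
  have : toE n (g (b i)) = b i := (toE n).apply_symm_apply _
  rw [this]
  obtain ⟨x, hx⟩ := (b i).2
  rw [← hx]
  exact P.2.idem x

/-- The bijection between subspaces and orthogonal projections. -/
noncomputable def grassEquiv (k n : ℕ) :
    Grassmannian k n ≃ Gr (⊤ : Submodule ℝ (EuclideanSpace ℝ (Fin n))) k :=
  Equiv.ofBijective (Quotient.lift frameGr fun A B h => (frameGr_eq_frameGr A B).2 h) <| by
    constructor
    · rintro ⟨A⟩ ⟨B⟩ h
      exact Quotient.sound ((frameGr_eq_frameGr A B).1 h)
    · intro P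
      obtain ⟨A, hA⟩ := frameGr_surjective P
      exact ⟨Quotient.mk _ A, hA⟩

lemma continuous_grassEquiv_symm (k n : ℕ) : Continuous (grassEquiv k n).symm := by
  refine continuous_iff_continuousAt.2 fun P₀ => ?_
  obtain ⟨A, hA⟩ := frameGr_surjective P₀
  let s : Gr (⊤ : Submodule ℝ (EuclideanSpace ℝ (Fin n))) k → Fin k → (Fin n → ℝ) :=
    fun P i => (toE n).symm (P.1 (toE n (A.1 i)))
  have hs : Continuous s := by fun_prop
  have hs0 : s P₀ = A.1 := by
    ext1 i
    simp only [s, (frameGr_eq_iff A P₀).1 hA i, ContinuousLinearEquiv.symm_apply_apply]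
  have hU : IsOpen {P | LinearIndependent ℝ (s P)} := isOpen_setOfPred_linearIndependent.preimage hs
  refine ContinuousOn.continuousAt (s := {P | LinearIndependent ℝ (s P)}) ?_
    (hU.mem_nhds (by rw [Set.mem_ofPred_eq, hs0]; exact A.2))
  rw [continuousOn_iff_continuous_domRestrict]
  have hc : Continuous fun P : {P | LinearIndependent ℝ (s P)} =>
      (Quotient.mk _ ⟨s P.1, P.2⟩ : Grassmannian k n) :=
    continuous_quotient_mk'.comp (.subtype_mk (hs.comp continuous_subtype_val) _)
  refine hc.congr fun P => ?_
  refine (grassEquiv k n).eq_symm_apply.2 ((frameGr_eq_iff _ _).2 fun i => ?_)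
  simp only [s, ContinuousLinearEquiv.apply_symm_apply]
  exact P.1.2.idem _

/-- The homeomorphism between the two models of the Grassmannian. -/
noncomputable def grassHomeomorph (k n : ℕ) :
    Grassmannian k n ≃ₜ Gr (⊤ : Submodule ℝ (EuclideanSpace ℝ (Fin n))) k where
  toEquiv := grassEquiv k n
  continuous_toFun := continuous_frameGr.quotient_lift _
  continuous_invFun := continuous_grassEquiv_symm k n

end Frame

theorem finrank_cohomology_grassmannian {m j : ℕ} (hm : 1 ≤ m) (hj : j ≤ m - 1)
    {B : ℕ → ℕ → Polynomial ℤ}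
    (hB : ∀ a b : ℕ, b ≤ a → B a b * (qFact b * qFact (a - b)) = qFact a) (i : ℕ) :
    (finrank ℚ (singularCohomology ℚ (TopCat.of (Grassmannian (2 * j + 1) (2 * m))) i) : ℤ) =
      ((1 + X ^ (2 * m - 1)) * (B (m - 1) j).comp (X ^ 4)).coeff i := by
  have h := hasDim_gr_odd hB hm hj
    (S := (⊤ : Submodule ℝ (EuclideanSpace ℝ (Fin (2 * m))))) (by simp) i
  rw [finrank_singularCohomology]
  exact (h.of_bijective' (H.bijective_of_homeomorph (grassHomeomorph (2 * j + 1) (2 * m)) i)).2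

end RatHomology

/-- The Poincaré polynomial of the real Grassmannian `Gr(2j+1, 2m)` over `ℚ` equals
`(1 + t^{2m-1}) · [m-1 choose j]_{t^4}`, stated coefficientwise.  Here `B` is the
Gaussian binomial coefficient, characterized by `B a b * ([b]_q! [a-b]_q!) = [a]_q!`. -/
theorem poincare_poly_grassmannian_odd_even (m j : ℕ) (hm : 1 ≤ m) (hjm : j ≤ m - 1)
    (B : ℕ → ℕ → Polynomial ℤ)
    (hB : ∀ a b : ℕ, b ≤ a → B a b * (qFact b * qFact (a - b)) = qFact a) :
    ∀ i : ℕ,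
      (Module.finrank ℚ
        (singularCohomology ℚ (TopCat.of (Grassmannian (2 * j + 1) (2 * m))) i) : ℤ)
        = ((1 + X ^ (2 * m - 1)) * (B (m - 1) j).comp (X ^ 4)).coeff i := by
  exact RatHomology.finrank_cohomology_grassmannian hm hjm hB
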